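/- Let f(t) = ∑_{n > b} a_n t^{n-1} ∈ ℚ((t)) (with b ∈ ℤ, a_n ∈ ℚ) be a formal Laurent series algebraic over ℚ(t). Then the following are equivalent: (a) every solution of y'(t) = f(t)·y(t) is algebraic over ℚ(t); (b) for all but finitely many primes p, a_{np} − a_n ∈ p ℤ_(p) for all n ≥ 1 and a_n = 0 for all n < 0 — moreover, each of (a) and the congruence conditions forces t·f(t) ∈ ℚ[[t]]; (c) for all but finitely many primes p, a_{np} − a_n ∈ n p ℤ_(p) for all n ≥ 1 and a_n = 0 for all n < 0. -/

import Mathlib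

open PowerSeries

/-- A formal Laurent series `g ∈ ℚ((t))` is algebraic over `ℚ(t)` if there is a nonzero
polynomial `P ∈ ℚ[x][y]` with `P(t, g) = 0`. -/
def IsAlgebraicLS (g : LaurentSeries ℚ) : Prop :=
  ∃ P : Polynomial (Polynomial ℚ), P ≠ 0 ∧
    Polynomial.eval₂ ((HahnSeries.ofPowerSeries ℤ ℚ).comp
      Polynomial.coeToPowerSeries.ringHom) g P = 0

/-- A generalized (Hahn/Puiseux-type) series with rational exponents is algebraic over `ℚ(t)`
if there is a nonzero polynomial `P ∈ ℚ[x][y]` with `P(t, g) = 0`. -/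
def IsAlgebraicHS (g : HahnSeries ℚ ℚ) : Prop :=
  ∃ P : Polynomial (Polynomial ℚ), P ≠ 0 ∧
    Polynomial.eval₂ ((HahnSeries.ofPowerSeries ℚ ℚ).comp
      Polynomial.coeToPowerSeries.ringHom) g P = 0

/-- The canonical embedding `ℚ((t)) → HahnSeries ℚ ℚ` (extending exponents from `ℤ` to `ℚ`). -/
noncomputable def laurentToHahn : LaurentSeries ℚ →+* HahnSeries ℚ ℚ :=
  HahnSeries.embDomainRingHom (Int.castAddHom ℚ) Int.cast_injective
    (fun _ _ => Int.cast_le)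

/-- `y` solves the differential equation `y' = f · y`, written coefficientwise:
the coefficient of `t^k` in `y'` is `(k+1) · (coefficient of `t^{k+1}` in `y`)`. -/
def SolvesODE (f y : HahnSeries ℚ ℚ) : Prop :=
  ∀ k : ℚ, (k + 1) * y.coeff (k + 1) = (f * y).coeff k

/-- `x ∈ ℤ_(p)`, the localization of `ℤ` at the prime `(p)`: the (reduced) denominator of the
rational number `x` is not divisible by `p`. -/
def MemZp (p : ℕ) (x : ℚ) : Prop := ¬ p ∣ x.den

/-- `x ∈ p ℤ_(p)`. -/
def MemPZp (p : ℕ) (x : ℚ) : Prop := ∃ y : ℚ, MemZp p y ∧ x = p * y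

/-- `x ∈ n p ℤ_(p)`. -/
def MemNPZp (n p : ℕ) (x : ℚ) : Prop := ∃ y : ℚ, MemZp p y ∧ x = n * p * y

/-- **Jacobi's formula** for the derivative of a determinant. -/
theorem Derivation.det_eq_trace {R A : Type*} [CommRing R] [CommRing A] [Algebra R A]
    {n : Type*} [Fintype n] [DecidableEq n] (D : Derivation R A A) (M : Matrix n n A) :
    D M.det = (M.adjugate * M.map D).trace := by
  have h1 : ∀ i, (M.adjugate * M.map D) i i = (M.updateCol i (fun j => D (M j i))).det := by
    intro i
    rw [← Matrix.cramer_apply, Matrix.cramer_eq_adjugate_mulVec]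
    rfl
  have key : ∀ (s : Finset n) (g : n → A),
      D (∏ i ∈ s, g i) = ∑ i ∈ s, (∏ j ∈ s.erase i, g j) * D (g i) := by
    intro s g
    induction s using Finset.induction_on with
    | empty => simp
    | insert a s ha ih =>
      rw [Finset.prod_insert ha, D.leibniz, ih, Finset.sum_insert ha, Finset.erase_insert ha,
        smul_eq_mul, smul_eq_mul, Finset.mul_sum, add_comm]
      congr 1
      refine Finset.sum_congr rfl fun i hi => ?_
      have hne : a ≠ i := fun h => ha (h ▸ hi)
      rw [Finset.erase_insert_of_ne hne, Finset.prod_insert (by simp [ha])]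
      ring
  rw [Matrix.trace]
  simp only [Matrix.diag_apply, h1]
  simp only [Matrix.det_apply, map_sum]
  rw [Finset.sum_comm]
  refine Finset.sum_congr rfl fun σ _ => ?_
  rw [← Finset.smul_sum, Units.smul_def, Units.smul_def, map_zsmul, key]
  congr 1
  refine Finset.sum_congr rfl fun i _ => ?_
  rw [← Finset.mul_prod_erase Finset.univ _ (Finset.mem_univ i), mul_comm]
  congr 1
  · simp
  · refine Finset.prod_congr rfl fun j hj => ?_
    rw [Matrix.updateCol_ne (Finset.ne_of_mem_erase hj)]

section LaurentCoefficients

variable {A A' : Type*} [CommRing A] [CommRing A']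

/-- The ring homomorphism of Laurent series induced by a ring homomorphism of coefficients. -/
noncomputable def laurentMap (φ : A →+* A') : LaurentSeries A →+* LaurentSeries A' where
  toFun x := HahnSeries.map x φ
  map_zero' := by ext; simp
  map_one' := by
    ext i
    simp only [HahnSeries.map_coeff, HahnSeries.coeff_one]
    split_ifs <;> simp
  map_add' x y := by ext; simp
  map_mul' _ _ := HahnSeries.map_mul φ.toNonUnitalRingHom

@[simp]
theorem laurentMap_coeff (φ : A →+* A') (x : LaurentSeries A) (i : ℤ) :
    (laurentMap φ x).coeff i = φ (x.coeff i) := rfl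

@[simp]
theorem laurentMap_single (φ : A →+* A') (i : ℤ) (c : A) :
    laurentMap φ (HahnSeries.single i c) = HahnSeries.single i (φ c) := by
  ext j
  rw [laurentMap_coeff, HahnSeries.coeff_single, HahnSeries.coeff_single]
  split_ifs <;> simp

/-- The vanishing of Laurent coefficients below a bound is multiplicative. -/
theorem HahnSeries.coeff_mul_eq_zero_of_lt {x y : LaurentSeries A} {a b : ℤ}
    (hx : ∀ i < a, x.coeff i = 0) (hy : ∀ i < b, y.coeff i = 0) :
    ∀ i < a + b, (x * y).coeff i = 0 := by
  intro i hi
  rw [HahnSeries.coeff_mul]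
  refine Finset.sum_eq_zero fun ij hij => ?_
  have h := (Finset.mem_antidiagonal.1 hij).2.2
  by_cases h1 : ij.1 < a
  · rw [hx _ h1, zero_mul]
  · rw [hy ij.2 (by omega), mul_zero]

theorem ofPowerSeries_coeff_of_neg (x : A⟦X⟧) {i : ℤ} (hi : i < 0) :
    (HahnSeries.ofPowerSeries ℤ A x).coeff i = 0 := by
  rw [HahnSeries.ofPowerSeries_apply]
  refine HahnSeries.embDomain_of_notMem_range ?_
  rintro ⟨j, hj⟩
  simp at hj
  omega

theorem ofPowerSeries_coeff_natCast (x : A⟦X⟧) (j : ℕ) :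
    (HahnSeries.ofPowerSeries ℤ A x).coeff j = PowerSeries.coeff j x :=
  HahnSeries.ofPowerSeries_apply_coeff x j

/-- The embedding of polynomials in `t⁻¹` into Laurent series in `t`. -/
noncomputable def polarEmb (A : Type*) [CommRing A] : Polynomial A →+* LaurentSeries A :=
  Polynomial.eval₂RingHom HahnSeries.C (HahnSeries.single (-1) 1)

theorem polarEmb_C (c : A) : polarEmb A (Polynomial.C c) = HahnSeries.C c := by
  simp [polarEmb]

theorem polarEmb_monomial (j : ℕ) (c : A) :
    polarEmb A (Polynomial.monomial j c) = HahnSeries.single (-(j : ℤ)) c := by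
  have : (HahnSeries.single (-1 : ℤ) (1 : A)) ^ j = HahnSeries.single (-(j : ℤ)) 1 := by
    simp
  rw [polarEmb, Polynomial.coe_eval₂RingHom, Polynomial.eval₂_monomial, this,
    HahnSeries.C_apply, HahnSeries.single_mul_single]
  simp

theorem polarEmb_coeff_neg (p : Polynomial A) (j : ℕ) :
    (polarEmb A p).coeff (-(j : ℤ)) = p.coeff j := by
  induction p using Polynomial.induction_on' with
  | add p q hp hq => simp [hp, hq]
  | monomial n c =>
    rw [polarEmb_monomial, HahnSeries.coeff_single, Polynomial.coeff_monomial]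
    simp only [neg_inj, Nat.cast_inj, eq_comm]

theorem polarEmb_coeff_pos (p : Polynomial A) {i : ℤ} (hi : 0 < i) :
    (polarEmb A p).coeff i = 0 := by
  induction p using Polynomial.induction_on' with
  | add p q hp hq => simp [hp, hq]
  | monomial n c =>
    rw [polarEmb_monomial, HahnSeries.coeff_single, if_neg (by omega)]

theorem polarEmb_injective : Function.Injective (polarEmb A) := by
  intro p q h
  ext j
  rw [← polarEmb_coeff_neg, h, polarEmb_coeff_neg]

end LaurentCoefficients

section Rows

variable {A : Type*} [CommRing A]

/-- The coefficient of `t ^ i`, as a power series in the parameter. -/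
noncomputable def rowAt (i : ℤ) : (LaurentSeries A)⟦X⟧ →+ A⟦X⟧ where
  toFun u := PowerSeries.mk fun s => (PowerSeries.coeff s u).coeff i
  map_zero' := by ext; simp
  map_add' u v := by ext; simp

@[simp]
theorem coeff_rowAt (i : ℤ) (u : (LaurentSeries A)⟦X⟧) (s : ℕ) :
    PowerSeries.coeff s (rowAt i u) = (PowerSeries.coeff s u).coeff i := by
  simp [rowAt]

/-- Series in the parameter, seen as families of constant Laurent series. -/
noncomputable abbrev constEmb (A : Type*) [CommRing A] : A⟦X⟧ →+* (LaurentSeries A)⟦X⟧ :=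
  PowerSeries.map HahnSeries.C

/-- Families of polynomials in `t⁻¹`, seen as families of Laurent series. -/
noncomputable abbrev polEmb (A : Type*) [CommRing A] :
    (Polynomial A)⟦X⟧ →+* (LaurentSeries A)⟦X⟧ :=
  PowerSeries.map (polarEmb A)

/-- Families of power series, seen as families of Laurent series. -/
noncomputable abbrev intEmb (A : Type*) [CommRing A] :
    (A⟦X⟧)⟦X⟧ →+* (LaurentSeries A)⟦X⟧ :=
  PowerSeries.map (HahnSeries.ofPowerSeries ℤ A)

theorem rowAt_constEmb_mul (i : ℤ) (g : A⟦X⟧) (u : (LaurentSeries A)⟦X⟧) :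
    rowAt i (constEmb A g * u) = g * rowAt i u := by
  ext s
  simp only [coeff_rowAt, PowerSeries.coeff_mul, PowerSeries.coeff_map, HahnSeries.coeff_sum,
    HahnSeries.C_mul_eq_smul, HahnSeries.coeff_smul, smul_eq_mul]

theorem rowAt_C_mul (i : ℤ) (j : ℤ) (c : A) (u : (LaurentSeries A)⟦X⟧) :
    rowAt i (PowerSeries.C (HahnSeries.single j c) * u) = PowerSeries.C c * rowAt (i - j) u := by
  ext s
  simp [HahnSeries.coeff_single_mul]

theorem rowAt_polEmb_neg (j : ℕ) (u : (Polynomial A)⟦X⟧) :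
    rowAt (-(j : ℤ)) (polEmb A u) = PowerSeries.mk fun s => (PowerSeries.coeff s u).coeff j := by
  ext s
  simp [polarEmb_coeff_neg]

theorem rowAt_polEmb_pos {i : ℤ} (hi : 0 < i) (u : (Polynomial A)⟦X⟧) :
    rowAt i (polEmb A u) = 0 := by
  ext s
  simp [polarEmb_coeff_pos _ hi]

theorem rowAt_intEmb_neg {i : ℤ} (hi : i < 0) (u : (A⟦X⟧)⟦X⟧) :
    rowAt i (intEmb A u) = 0 := by
  ext s
  simp [ofPowerSeries_coeff_of_neg _ hi]

/-- All members of the family `u` have Laurent coefficients vanishing below `b`. -/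
def RowsVanishBelow (b : ℤ) (u : (LaurentSeries A)⟦X⟧) : Prop :=
  ∀ s, ∀ i < b, (PowerSeries.coeff s u).coeff i = 0

theorem RowsVanishBelow.mul {a b : ℤ} {u v : (LaurentSeries A)⟦X⟧} (hu : RowsVanishBelow a u)
    (hv : RowsVanishBelow b v) : RowsVanishBelow (a + b) (u * v) := by
  intro s i hi
  rw [PowerSeries.coeff_mul, HahnSeries.coeff_sum]
  exact Finset.sum_eq_zero fun p _ =>
    HahnSeries.coeff_mul_eq_zero_of_lt (hu p.1) (hv p.2) i hi

theorem RowsVanishBelow.add {b : ℤ} {u v : (LaurentSeries A)⟦X⟧} (hu : RowsVanishBelow b u)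
    (hv : RowsVanishBelow b v) : RowsVanishBelow b (u + v) := by
  intro s i hi
  simp [hu s i hi, hv s i hi]

theorem rowsVanishBelow_constEmb (g : A⟦X⟧) : RowsVanishBelow 0 (constEmb A g) := by
  intro s i hi
  rw [PowerSeries.coeff_map, HahnSeries.C_apply, HahnSeries.coeff_single_of_ne hi.ne]

theorem rowsVanishBelow_intEmb (g : (A⟦X⟧)⟦X⟧) : RowsVanishBelow 0 (intEmb A g) := by
  intro s i hi
  rw [PowerSeries.coeff_map, ofPowerSeries_coeff_of_neg _ hi]

theorem RowsVanishBelow.mono {a b : ℤ} (h : a ≤ b) {u : (LaurentSeries A)⟦X⟧}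
    (hu : RowsVanishBelow b u) : RowsVanishBelow a u :=
  fun s i hi => hu s i (hi.trans_le h)

theorem rowsVanishBelow_one : RowsVanishBelow 0 (1 : (LaurentSeries A)⟦X⟧) := by
  have := rowsVanishBelow_constEmb (1 : A⟦X⟧)
  rwa [map_one] at this

theorem RowsVanishBelow.pow {b : ℤ} {u : (LaurentSeries A)⟦X⟧} (hu : RowsVanishBelow b u)
    (k : ℕ) : RowsVanishBelow (k * b) (u ^ k) := by
  induction k with
  | zero => simpa using rowsVanishBelow_one
  | succ k ih =>
    rw [pow_succ]
    refine (ih.mul hu).mono ?_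
    push_cast
    linarith

theorem RowsVanishBelow.sum {ι : Type*} {b : ℤ} {s : Finset ι} {u : ι → (LaurentSeries A)⟦X⟧}
    (hu : ∀ i ∈ s, RowsVanishBelow b (u i)) : RowsVanishBelow b (∑ i ∈ s, u i) := by
  intro m i hi
  rw [map_sum, HahnSeries.coeff_sum]
  exact Finset.sum_eq_zero fun j hj => hu j hj m i hi

theorem RowsVanishBelow.rowAt {b : ℤ} {u : (LaurentSeries A)⟦X⟧} (hu : RowsVanishBelow b u)
    {i : ℤ} (hi : i < b) : rowAt i u = 0 := by
  ext s
  simp [hu s i hi]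

end Rows

section LogResidue

variable {A : Type*} [CommRing A]

/-- The residue (coefficient of `t⁻¹`) of `f · u' / u`, where `'` is the derivative with respect to
the parameter. -/
noncomputable def logRes (f : LaurentSeries A) (u : ((LaurentSeries A)⟦X⟧)ˣ) : A⟦X⟧ :=
  rowAt (-1) (C f * derivative (LaurentSeries A) (u : (LaurentSeries A)⟦X⟧) *
    ((u⁻¹ : ((LaurentSeries A)⟦X⟧)ˣ) : (LaurentSeries A)⟦X⟧))

theorem logRes_mul (f : LaurentSeries A) (u v : ((LaurentSeries A)⟦X⟧)ˣ) :
    logRes f (u * v) = logRes f u + logRes f v := by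
  rw [logRes, logRes, logRes, ← map_add]
  congr 1
  rw [Units.val_mul, mul_inv, Units.val_mul, Derivation.leibniz, smul_eq_mul, smul_eq_mul]
  have h1 := u.mul_inv
  have h2 := v.mul_inv
  set u' : (LaurentSeries A)⟦X⟧ := ((u⁻¹ : ((LaurentSeries A)⟦X⟧)ˣ) : (LaurentSeries A)⟦X⟧)
  set v' : (LaurentSeries A)⟦X⟧ := ((v⁻¹ : ((LaurentSeries A)⟦X⟧)ˣ) : (LaurentSeries A)⟦X⟧)
  linear_combination
    C f * derivative (LaurentSeries A) (v : (LaurentSeries A)⟦X⟧) * v' * h1 +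
    C f * derivative (LaurentSeries A) (u : (LaurentSeries A)⟦X⟧) * u' * h2

theorem logRes_pow (f : LaurentSeries A) (u : ((LaurentSeries A)⟦X⟧)ˣ) (k : ℕ) :
    logRes f (u ^ k) = k * logRes f u := by
  induction k with
  | zero => simp [logRes]
  | succ k ih => rw [pow_succ, logRes_mul, ih]; push_cast; ring

theorem RowsVanishBelow.derivative {b : ℤ} {u : (LaurentSeries A)⟦X⟧} (hu : RowsVanishBelow b u) :
    RowsVanishBelow b (derivative (LaurentSeries A) u) := by
  intro s i hi
  rw [coeff_derivative, ← Nat.cast_succ, ← nsmul_eq_mul', HahnSeries.coeff_nsmul]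
  simp [hu _ i hi]

theorem rowsVanishBelow_C {b : ℤ} {f : LaurentSeries A} (hf : ∀ i < b, f.coeff i = 0) :
    RowsVanishBelow b (C f) := by
  intro s i hi
  rw [coeff_C]
  split_ifs
  · exact hf i hi
  · simp

theorem logRes_eq_zero_of_rowsVanishBelow {f : LaurentSeries A} (hf : ∀ i < 0, f.coeff i = 0)
    {u : ((LaurentSeries A)⟦X⟧)ˣ} (hu : RowsVanishBelow 0 (u : (LaurentSeries A)⟦X⟧))
    (hu' : RowsVanishBelow 0 ((u⁻¹ : _ˣ) : (LaurentSeries A)⟦X⟧)) : logRes f u = 0 :=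
  (((rowsVanishBelow_C hf).mul hu.derivative).mul hu').rowAt (by norm_num)

/-- The reciprocity law: if a family of matrices over the polynomials in `t⁻¹` is, after a base
change, block triangular with diagonal blocks an integral family and a scalar `h`, then the
scalar log-derivative block has no residue. -/
theorem rowAt_neg_one_eq_zero_of_block {m : Type*} [Fintype m] [DecidableEq m]
    {U V : Matrix (m ⊕ Unit) (m ⊕ Unit) (LaurentSeries A)⟦X⟧} (hUV : U * V = 1)
    {H H' G : Matrix (m ⊕ Unit) (m ⊕ Unit) (Polynomial A)⟦X⟧} (hH : H * H' = 1)
    {N N' M : Matrix m m (A⟦X⟧)⟦X⟧} (hN : N * N' = 1)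
    {c c' : Matrix m Unit (LaurentSeries A)⟦X⟧} {h h' g : (LaurentSeries A)⟦X⟧} (hh : h * h' = 1)
    (e1 : U * H.map (polEmb A) =
      Matrix.fromBlocks (N.map (intEmb A)) c 0 (Matrix.of fun _ _ => h) * U)
    (e2 : U * (C (HahnSeries.single (-2 : ℤ) (1 : A)) • G.map (polEmb A)) =
      Matrix.fromBlocks (M.map (intEmb A)) c' 0 (Matrix.of fun _ _ => g) * U) :
    rowAt (-1) (g * h') = 0 := by
  have hVU : V * U = 1 := mul_eq_one_comm.1 hUV
  set Hm := H.map (polEmb A) with hHm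
  set Hm' := H'.map (polEmb A) with hHm'
  set Nm := N.map (intEmb A) with hNm
  set Nm' := N'.map (intEmb A) with hNm'
  set Mm := M.map (intEmb A) with hMm
  set Gm := C (HahnSeries.single (-2 : ℤ) (1 : A)) • G.map (polEmb A) with hGm
  have hH1 : Hm * Hm' = 1 := by
    rw [hHm, hHm', ← Matrix.map_mul, hH, Matrix.map_one _ (map_zero _) (map_one _)]
  have hN1 : Nm' * Nm = 1 := by
    rw [hNm, hNm', ← Matrix.map_mul, mul_eq_one_comm.1 hN,
      Matrix.map_one _ (map_zero _) (map_one _)]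
  set hs : Matrix Unit Unit (LaurentSeries A)⟦X⟧ := Matrix.of fun _ _ => h with hhs
  set hs' : Matrix Unit Unit (LaurentSeries A)⟦X⟧ := Matrix.of fun _ _ => h' with hhs'
  set gs : Matrix Unit Unit (LaurentSeries A)⟦X⟧ := Matrix.of fun _ _ => g with hgs
  have hs1 : hs' * hs = 1 := by
    ext i j
    simp [hs, hs', Matrix.mul_apply, mul_comm h', hh]
  set W := Matrix.fromBlocks Nm' (-(Nm' * c * hs')) 0 hs' with hW
  have hWB : W * Matrix.fromBlocks Nm c 0 hs = 1 := by
    rw [hW, Matrix.fromBlocks_multiply, hN1, hs1]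
    simp [Matrix.mul_assoc, hs1]
  have e3 : U * Hm' = W * U := by
    calc U * Hm' = W * Matrix.fromBlocks Nm c 0 hs * U * Hm' := by rw [hWB, one_mul]
      _ = W * (U * Hm) * Hm' := by rw [e1, Matrix.mul_assoc W]
      _ = W * U := by rw [Matrix.mul_assoc, Matrix.mul_assoc, hH1, mul_one]
  have e4 : U * (Gm * Hm') = Matrix.fromBlocks Mm c' 0 gs * W * U := by
    rw [← Matrix.mul_assoc, e2, Matrix.mul_assoc, e3, Matrix.mul_assoc]
  have e5 : (Gm * Hm').trace = (Matrix.fromBlocks Mm c' 0 gs * W).trace := by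
    rw [← one_mul (Gm * Hm'), ← hVU, Matrix.mul_assoc, Matrix.trace_mul_comm, e4,
      Matrix.mul_assoc, hUV, mul_one]
  rw [hW, Matrix.fromBlocks_multiply] at e5
  simp only [Matrix.mul_zero, Matrix.zero_mul, zero_add, add_zero, Matrix.trace, Matrix.diag_apply,
      Fintype.sum_sum_type, Matrix.fromBlocks_apply₁₁,
    Matrix.fromBlocks_apply₂₂] at e5
  have e6 : ∑ x, (gs * hs') x x = g * h' := by
    simp [gs, hs', Matrix.mul_apply]
  have e7 : ∑ x, (Mm * Nm') x x = intEmb A (M * N').trace := by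
    rw [hMm, hNm', ← Matrix.map_mul, AddMonoidHom.map_trace]
    rfl
  have e8 : ∑ x, (Gm * Hm') x x =
      C (HahnSeries.single (-2 : ℤ) (1 : A)) * polEmb A (G * H').trace := by
    rw [hGm, hHm', Matrix.smul_mul, ← Matrix.map_mul, AddMonoidHom.map_trace]
    exact Matrix.trace_smul _ _
  rw [← Fintype.sum_sum_type (fun x => (Gm * Hm') x x), e6, e7, e8] at e5
  have e9 := congrArg (rowAt (-1)) e5
  rw [rowAt_C_mul, rowAt_polEmb_pos (by norm_num), mul_zero, map_add,
    rowAt_intEmb_neg (by norm_num), zero_add] at e9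
  exact e9.symm

end LogResidue

section TruncatedNorm

variable {A : Type*} [CommRing A]

theorem RingSeminorm.map_sum_le (N : RingSeminorm A) {ι : Type*} (s : Finset ι) (g : ι → A) :
    N (∑ i ∈ s, g i) ≤ ∑ i ∈ s, N (g i) :=
  Finset.le_sum_of_subadditive N (map_zero N).le (map_add_le_add N) s g

theorem Finset.sum_range_sum_antidiagonal_le {g : ℕ × ℕ → ℝ} (hg : ∀ p, 0 ≤ g p) (S : ℕ) :
    ∑ s ∈ Finset.range S, ∑ p ∈ Finset.HasAntidiagonal.antidiagonal s, g p ≤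
      ∑ p ∈ Finset.range S ×ˢ Finset.range S, g p := by
  have h : ∀ s ∈ Finset.range S, ∑ p ∈ Finset.HasAntidiagonal.antidiagonal s, g p =
      ∑ p ∈ (Finset.range S ×ˢ Finset.range S).filter (fun p => p.1 + p.2 < S) with
        p.1 + p.2 = s, g p := by
    intro s hs
    refine Finset.sum_congr ?_ fun _ _ => rfl
    ext p
    simp only [Finset.HasAntidiagonal.mem_antidiagonal, Finset.mem_filter, Finset.mem_product,
        Finset.mem_range]
      at hs ⊢
    omega
  rw [Finset.sum_congr rfl h, Finset.sum_fiberwise_of_maps_to (fun p hp => by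
    simpa using (Finset.mem_filter.1 hp).2)]
  exact Finset.sum_le_sum_of_subset_of_nonneg (Finset.filter_subset _ _) fun p _ _ => hg p

/-- The weighted `ℓ¹` norm of the truncation of a power series. -/
noncomputable def truncNorm (N : RingSeminorm A) (r : ℝ) (hr : 0 ≤ r) (S : ℕ) :
    RingSeminorm A⟦X⟧ where
  toFun G := ∑ s ∈ Finset.range S, N (coeff s G) * r ^ s
  map_zero' := by simp
  neg' G := by simp
  add_le' G H := by
    rw [← Finset.sum_add_distrib]
    refine Finset.sum_le_sum fun s _ => ?_
    rw [← add_mul, map_add]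
    exact mul_le_mul_of_nonneg_right (map_add_le_add N _ _) (pow_nonneg hr s)
  mul_le' G H := by
    have h1 : ∀ s ∈ Finset.range S, N (coeff s (G * H)) * r ^ s ≤
        ∑ p ∈ Finset.HasAntidiagonal.antidiagonal s, N (coeff p.1 G) * r ^ p.1 *
          (N (coeff p.2 H) * r ^ p.2) := by
      intro s _
      rw [coeff_mul]
      calc _ ≤ (∑ p ∈ Finset.HasAntidiagonal.antidiagonal s,
            N (coeff p.1 G * coeff p.2 H)) * r ^ s :=
            mul_le_mul_of_nonneg_right (N.map_sum_le _ _) (pow_nonneg hr s)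
        _ ≤ _ := by
            rw [Finset.sum_mul]
            refine Finset.sum_le_sum fun p hp => ?_
            rw [← Finset.HasAntidiagonal.mem_antidiagonal.1 hp, pow_add, mul_mul_mul_comm]
            exact mul_le_mul_of_nonneg_right (map_mul_le_mul N _ _) (by positivity)
    refine (Finset.sum_le_sum h1).trans (
      (Finset.sum_range_sum_antidiagonal_le (fun p => ?_) S).trans
      ?_)
    · exact mul_nonneg (mul_nonneg (apply_nonneg N _) (pow_nonneg hr _))
        (mul_nonneg (apply_nonneg N _) (pow_nonneg hr _))
    · rw [Finset.sum_mul_sum, Finset.sum_product]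

theorem truncNorm_apply (N : RingSeminorm A) (r : ℝ) (hr : 0 ≤ r) (S : ℕ) (G : A⟦X⟧) :
    truncNorm N r hr S G = ∑ s ∈ Finset.range S, N (coeff s G) * r ^ s := rfl

theorem truncNorm_C_le (N : RingSeminorm A) (r : ℝ) (hr : 0 ≤ r) (S : ℕ) (c : A) :
    truncNorm N r hr S (C c) ≤ N c := by
  rw [truncNorm_apply]
  rcases Nat.eq_zero_or_pos S with rfl | hS
  · simp
  · rw [Finset.sum_eq_single_of_mem 0 (by simpa using hS)]
    · simp
    · intro s _ hs
      simp [coeff_C, hs]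

theorem mul_pow_le_truncNorm (N : RingSeminorm A) (r : ℝ) (hr : 0 ≤ r) {S s : ℕ} (hs : s < S)
    (G : A⟦X⟧) : N (coeff s G) * r ^ s ≤ truncNorm N r hr S G := by
  rw [truncNorm_apply]
  exact Finset.single_le_sum (f := fun s => N (coeff s G) * r ^ s)
    (fun i _ => mul_nonneg (apply_nonneg N _) (pow_nonneg hr _)) (Finset.mem_range.2 hs)

/-- Power series converging absolutely on the closed polydisc of radius `r`. -/
noncomputable def convSubring (N : RingSeminorm A) (r : ℝ) (hr : 0 ≤ r) : Subring A⟦X⟧ where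
  carrier := {G | ∃ K, ∀ S, truncNorm N r hr S G ≤ K}
  zero_mem' := ⟨0, fun S => by simp⟩
  one_mem' := ⟨N 1, fun S => by simpa using truncNorm_C_le N r hr S 1⟩
  add_mem' := by
    rintro G H ⟨K, hK⟩ ⟨K', hK'⟩
    exact ⟨K + K', fun S => (map_add_le_add _ _ _).trans (add_le_add (hK S) (hK' S))⟩
  neg_mem' := by
    rintro G ⟨K, hK⟩
    exact ⟨K, fun S => by rw [map_neg_eq_map]; exact hK S⟩
  mul_mem' := by
    rintro G H ⟨K, hK⟩ ⟨K', hK'⟩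
    exact ⟨K * K', fun S => (map_mul_le_mul _ _ _).trans
      (mul_le_mul (hK S) (hK' S) (apply_nonneg _ _) ((apply_nonneg _ _).trans (hK S)))⟩

theorem mem_convSubring {N : RingSeminorm A} {r : ℝ} {hr : 0 ≤ r} {G : A⟦X⟧} :
    G ∈ convSubring N r hr ↔ ∃ K, ∀ S, truncNorm N r hr S G ≤ K := Iff.rfl

theorem C_mem_convSubring (N : RingSeminorm A) (r : ℝ) (hr : 0 ≤ r) (c : A) :
    C c ∈ convSubring N r hr :=
  ⟨N c, fun S => truncNorm_C_le N r hr S c⟩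

theorem mem_convSubring_of_le {N : RingSeminorm A} {r : ℝ} (hr : 0 ≤ r) {G : A⟦X⟧} {K ν : ℝ}
    (hν : 0 ≤ ν) (hrν : r * ν < 1) (h : ∀ s, N (coeff s G) ≤ K * ν ^ s) :
    G ∈ convSubring N r hr := by
  have hK : 0 ≤ K := by simpa using (apply_nonneg N _).trans (h 0)
  refine ⟨K * (1 - r * ν)⁻¹, fun S => ?_⟩
  rw [truncNorm_apply]
  calc _ ≤ ∑ s ∈ Finset.range S, K * (r * ν) ^ s := by
        refine Finset.sum_le_sum fun s _ => ?_
        rw [mul_pow, mul_comm (r ^ s), ← mul_assoc]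
        exact mul_le_mul_of_nonneg_right (h s) (pow_nonneg hr s)
    _ ≤ _ := by
        rw [← Finset.mul_sum]
        refine mul_le_mul_of_nonneg_left ?_ hK
        rw [← tsum_geometric_of_lt_one (by positivity) hrν]
        exact (summable_geometric_of_lt_one (by positivity) hrν).sum_le_tsum _
          fun i _ => by positivity

/-- The coefficient of the `j`-th power of the polynomial variable. -/
noncomputable def polRow (j : ℕ) : (Polynomial A)⟦X⟧ →+ A⟦X⟧ where
  toFun u := PowerSeries.mk fun s => (PowerSeries.coeff s u).coeff j
  map_zero' := by ext; simp
  map_add' u v := by ext; simp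

@[simp]
theorem coeff_polRow (j s : ℕ) (u : (Polynomial A)⟦X⟧) :
    coeff s (polRow j u) = (coeff s u).coeff j := by
  simp [polRow]

theorem polRow_mul (j : ℕ) (u v : (Polynomial A)⟦X⟧) :
    polRow j (u * v) = ∑ p ∈ Finset.HasAntidiagonal.antidiagonal j,
        polRow p.1 u * polRow p.2 v := by
  ext s
  simp only [coeff_polRow, coeff_mul, Polynomial.finsetSum_coeff, Polynomial.coeff_mul, map_sum]
  rw [Finset.sum_comm]

theorem rowAt_polEmb (j : ℕ) (u : (Polynomial A)⟦X⟧) :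
    rowAt (-(j : ℤ)) (polEmb A u) = polRow j u :=
  rowAt_polEmb_neg j u

/-- Families of polynomials all of whose coefficients converge on the polydisc of radius `r`. -/
noncomputable def polConvSubring (N : RingSeminorm A) (r : ℝ) (hr : 0 ≤ r) :
    Subring (Polynomial A)⟦X⟧ where
  carrier := {u | ∀ j, polRow j u ∈ convSubring N r hr}
  zero_mem' j := by rw [map_zero]; exact zero_mem _
  one_mem' j := by
    have : polRow j (1 : (Polynomial A)⟦X⟧) = C ((1 : Polynomial A).coeff j) := by
      ext s
      rw [coeff_polRow, coeff_one, coeff_C]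
      split_ifs <;> simp
    rw [this]
    exact C_mem_convSubring _ _ _ _
  add_mem' hu hv j := by rw [map_add]; exact add_mem (hu j) (hv j)
  neg_mem' hu j := by rw [map_neg]; exact neg_mem (hu j)
  mul_mem' hu hv j := by
    rw [polRow_mul]
    exact sum_mem fun p _ => mul_mem (hu _) (hv _)

theorem map_C_mem_polConvSubring {N : RingSeminorm A} {r : ℝ} {hr : 0 ≤ r} {G : A⟦X⟧}
    (hG : G ∈ convSubring N r hr) : PowerSeries.map Polynomial.C G ∈ polConvSubring N r hr := by
  intro j
  rcases Nat.eq_zero_or_pos j with rfl | hj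
  · convert hG
    ext s
    simp
  · convert zero_mem (convSubring N r hr)
    ext s
    simp [Polynomial.coeff_C, hj.ne']

theorem C_mem_polConvSubring (N : RingSeminorm A) (r : ℝ) (hr : 0 ≤ r) (p : Polynomial A) :
    C p ∈ polConvSubring N r hr := by
  intro j
  convert C_mem_convSubring N r hr (p.coeff j)
  ext s
  rw [coeff_polRow, coeff_C, coeff_C]
  split_ifs <;> simp

theorem Subring.det_mem {R : Type*} [CommRing R] (S : Subring R) {ι : Type*} [Fintype ι]
    [DecidableEq ι] (M : Matrix ι ι R) (hM : ∀ i j, M i j ∈ S) : M.det ∈ S := by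
  rw [Matrix.det_apply]
  refine sum_mem fun σ _ => ?_
  rw [Units.smul_def]
  exact zsmul_mem (prod_mem fun i _ => hM _ _) _

theorem Subring.adjugate_mem {R : Type*} [CommRing R] (S : Subring R) {ι : Type*} [Fintype ι]
    [DecidableEq ι] (M : Matrix ι ι R) (hM : ∀ i j, M i j ∈ S) (i j : ι) :
    M.adjugate i j ∈ S := by
  rw [Matrix.adjugate_apply]
  refine S.det_mem _ fun a b => ?_
  rw [Matrix.updateRow_apply]
  split_ifs
  · rw [Pi.single_apply]
    split_ifs
    exacts [one_mem _, zero_mem _]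
  · exact hM a b

end TruncatedNorm

section Growth

variable {A : Type*} [CommRing A]

/-- Two-variable geometric growth of the coefficients of a family of Laurent series. -/
def GrowthBound (N : RingSeminorm A) (ν θ : ℝ) (u : (LaurentSeries A)⟦X⟧) : Prop :=
  ∃ K, ∀ (s : ℕ) (i : ℤ), N ((coeff s u).coeff i) ≤ K * ν ^ s * θ ^ i

theorem GrowthBound.rowAt_mem {N : RingSeminorm A} {ν θ : ℝ} {u : (LaurentSeries A)⟦X⟧}
    (hu : GrowthBound N ν θ u) {r : ℝ} (hr : 0 ≤ r) (hν : 0 ≤ ν) (hrν : r * ν < 1) (i : ℤ) :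
    rowAt i u ∈ convSubring N r hr := by
  obtain ⟨K, hK⟩ := hu
  refine mem_convSubring_of_le hr (K := K * θ ^ i) hν hrν fun s => ?_
  rw [coeff_rowAt, mul_right_comm]
  exact hK s i

theorem growthBound_C {N : RingSeminorm A} {ν θ K : ℝ} (hν : 0 ≤ ν) (hθ : 0 < θ)
    {f : LaurentSeries A} (hf : ∀ i, N (f.coeff i) ≤ K * θ ^ i) : GrowthBound N ν θ (C f) := by
  have hK : 0 ≤ K := by simpa using (apply_nonneg N _).trans (hf 0)
  refine ⟨K, fun s i => ?_⟩
  rw [coeff_C]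
  split_ifs with h
  · simpa [h] using hf i
  · simp only [HahnSeries.coeff_zero, map_zero]
    positivity

/-- The Laurent polynomial `∑ ξ_l t^{-(l+1)}`. -/
noncomputable def polarSum {n : ℕ} (ξ : Fin n → A) : Polynomial A :=
  ∑ l : Fin n, Polynomial.monomial (l + 1 : ℕ) (ξ l)

theorem coeff_polarEmb_polarSum_mul {n : ℕ} (ξ : Fin n → A) (x : LaurentSeries A) (i : ℤ) :
    (polarEmb A (polarSum ξ) * x).coeff i = ∑ l : Fin n, ξ l * x.coeff (i + (l + 1)) := by
  rw [polarSum, map_sum, Finset.sum_mul, HahnSeries.coeff_sum]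
  refine Finset.sum_congr rfl fun l _ => ?_
  rw [polarEmb_monomial, HahnSeries.coeff_single_mul, sub_neg_eq_add]
  push_cast
  rfl

theorem polarSum_mul_le {N : RingSeminorm A} {n : ℕ} {ξ : Fin n → A} (hξ : ∀ l, N (ξ l) ≤ 1)
    {θ K : ℝ} (hθ : 1 ≤ θ) {x : LaurentSeries A} (hx : ∀ i, N (x.coeff i) ≤ K * θ ^ i) (i : ℤ) :
    N ((polarEmb A (polarSum ξ) * x).coeff i) ≤ n * θ ^ n * K * θ ^ i := by
  have hK : 0 ≤ K := by simpa using (apply_nonneg N _).trans (hx 0)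
  have hθ0 : 0 < θ := by linarith
  rw [coeff_polarEmb_polarSum_mul]
  refine (N.map_sum_le _ _).trans ?_
  calc _ ≤ ∑ l : Fin n, θ ^ n * K * θ ^ i := by
        refine Finset.sum_le_sum fun l _ => ?_
        calc _ ≤ N (ξ l) * N (x.coeff (i + (l + 1))) := map_mul_le_mul N _ _
          _ ≤ 1 * (K * θ ^ (i + (l + 1))) :=
              mul_le_mul (hξ l) (hx _) (apply_nonneg N _) zero_le_one
          _ ≤ 1 * (K * θ ^ (i + n)) := by
              gcongr
              have := l.2
              omega
          _ = _ := by
              rw [zpow_add₀ hθ0.ne', zpow_natCast]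
              ring
    _ = _ := by simp; ring

theorem GrowthBound.mul_polarSum {N : RingSeminorm A} {n : ℕ} {ξ : Fin n → A}
    (hξ : ∀ l, N (ξ l) ≤ 1) {ν θ : ℝ} (hθ : 1 ≤ θ) {u : (LaurentSeries A)⟦X⟧}
    (hu : GrowthBound N ν θ u) :
    GrowthBound N ν θ (C (polarEmb A (polarSum ξ)) * u) := by
  obtain ⟨K, hK⟩ := hu
  refine ⟨n * θ ^ n * K, fun s i => ?_⟩
  rw [coeff_C_mul]
  refine (polarSum_mul_le hξ hθ (hK s) i).trans_eq (by ring)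

theorem GrowthBound.mul_inverse {N : RingSeminorm A} {n : ℕ} {ξ : Fin n → A}
    (hξ : ∀ l, N (ξ l) ≤ 1) {ν θ : ℝ} (hθ : 1 ≤ θ) (hν : 2 * n * θ ^ n ≤ ν) (hν1 : 1 ≤ ν)
    {u w : (LaurentSeries A)⟦X⟧} (hw : (1 + X * C (polarEmb A (polarSum ξ))) * w = 1)
    (hu : GrowthBound N ν θ u) : GrowthBound N ν θ (u * w) := by
  obtain ⟨K, hK⟩ := hu
  have hK0 : 0 ≤ K := by simpa using (apply_nonneg N _).trans (hK 0 0)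
  have hθ0 : 0 < θ := by linarith
  have hrec : u * w = u - X * (C (polarEmb A (polarSum ξ)) * (u * w)) := by
    linear_combination u * hw
  refine ⟨2 * K, fun s => ?_⟩
  induction s with
  | zero =>
    intro i
    rw [hrec, map_sub]
    simp only [coeff_zero_X_mul, sub_zero]
    refine (hK 0 i).trans ?_
    have : 0 ≤ K * ν ^ 0 * θ ^ i := by positivity
    linarith
  | succ s ih =>
    intro i
    rw [hrec, map_sub, coeff_succ_X_mul, coeff_C_mul, HahnSeries.coeff_sub]
    refine (map_sub_le_add N _ _).trans ?_
    have h1 := polarSum_mul_le hξ hθ ih i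
    have h2 : n * θ ^ n * (2 * K * ν ^ s) * θ ^ i ≤ K * ν ^ (s + 1) * θ ^ i := by
      have : 0 ≤ K * ν ^ s * θ ^ i := by positivity
      calc _ = 2 * n * θ ^ n * (K * ν ^ s * θ ^ i) := by ring
        _ ≤ ν * (K * ν ^ s * θ ^ i) := by gcongr
        _ = _ := by ring
    have h3 := hK (s + 1) i
    linarith

end Growth

section BlockRelation

variable {R : Type*} [CommRing R] {m : Type*} [Fintype m]

/-- `U` conjugates `X` to a block upper triangular matrix with diagonal blocks `N` and `h`. -/
def BlockRel (U X : Matrix (m ⊕ Unit) (m ⊕ Unit) R) (N : Matrix m m R) (h : R) : Prop :=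
  ∃ c : Matrix m Unit R, U * X = Matrix.fromBlocks N c 0 (Matrix.of fun _ _ => h) * U

variable {U X Y : Matrix (m ⊕ Unit) (m ⊕ Unit) R} {N M : Matrix m m R} {h g : R}

theorem BlockRel.smul (r : R) (hX : BlockRel U X N h) : BlockRel U (r • X) (r • N) (r * h) := by
  obtain ⟨c, hc⟩ := hX
  refine ⟨r • c, ?_⟩
  have : (Matrix.of fun _ _ => r * h : Matrix Unit Unit R) = r • Matrix.of (fun _ _ => h) := by
    ext; simp
  rw [Matrix.mul_smul, hc, ← Matrix.smul_mul, Matrix.fromBlocks_smul, this, smul_zero]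

theorem BlockRel.map {R' : Type*} [CommRing R'] (φ : R →+* R') (hX : BlockRel U X N h) :
    BlockRel (U.map φ) (X.map φ) (N.map φ) (φ h) := by
  obtain ⟨c, hc⟩ := hX
  refine ⟨c.map φ, ?_⟩
  have : (Matrix.of fun _ _ => φ h : Matrix Unit Unit R') = (Matrix.of fun _ _ => h).map φ := by
    ext; simp
  have h0 : (0 : Matrix Unit m R).map φ = 0 := by ext; simp
  rw [← Matrix.map_mul, hc, Matrix.map_mul, Matrix.fromBlocks_map, this, h0]

variable [DecidableEq m]

theorem BlockRel.one : BlockRel U 1 1 1 := by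
  refine ⟨0, ?_⟩
  have : (Matrix.of fun _ _ => 1 : Matrix Unit Unit R) = 1 := by ext; simp
  rw [this, Matrix.fromBlocks_one, mul_one, one_mul]

theorem BlockRel.zero : BlockRel U 0 0 0 := by
  refine ⟨0, ?_⟩
  have : (Matrix.of fun _ _ => 0 : Matrix Unit Unit R) = 0 := by ext; simp
  rw [this, Matrix.fromBlocks_zero, mul_zero, zero_mul]

theorem BlockRel.add (hX : BlockRel U X N h) (hY : BlockRel U Y M g) :
    BlockRel U (X + Y) (N + M) (h + g) := by
  obtain ⟨c, hc⟩ := hX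
  obtain ⟨d, hd⟩ := hY
  refine ⟨c + d, ?_⟩
  have : (Matrix.of fun _ _ => h + g : Matrix Unit Unit R) =
      Matrix.of (fun _ _ => h) + Matrix.of fun _ _ => g := by ext; simp
  rw [mul_add, hc, hd, ← add_mul, Matrix.fromBlocks_add, this, add_zero]

theorem BlockRel.sum {ι : Type*} (s : Finset ι) {X : ι → Matrix (m ⊕ Unit) (m ⊕ Unit) R}
    {N : ι → Matrix m m R} {h : ι → R} (hX : ∀ i ∈ s, BlockRel U (X i) (N i) (h i)) :
    BlockRel U (∑ i ∈ s, X i) (∑ i ∈ s, N i) (∑ i ∈ s, h i) := by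
  induction s using Finset.cons_induction with
  | empty => simpa using BlockRel.zero
  | cons a s ha ih =>
    simp only [Finset.sum_cons]
    exact (hX a (by simp)).add (ih fun i hi => hX i (by simp [hi]))

theorem BlockRel.det {V : Matrix (m ⊕ Unit) (m ⊕ Unit) R} (hUV : U * V = 1)
    (hX : BlockRel U X N h) : X.det = N.det * h := by
  obtain ⟨c, hc⟩ := hX
  have hd : U.det * V.det = 1 := by rw [← Matrix.det_mul, hUV, Matrix.det_one]
  have := congrArg Matrix.det hc
  rw [Matrix.det_mul, Matrix.det_mul, Matrix.det_fromBlocks_zero₂₁,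
    Matrix.det_unique (Matrix.of _)] at this
  simp only [Matrix.of_apply] at this
  linear_combination V.det * this - (X.det - N.det * h) * hd

end BlockRelation

section SeriesLemmas

variable {R : Type*} [CommRing R]

theorem Matrix.exists_mul_eq_one_of_constantCoeff {ι : Type*} [Fintype ι] [DecidableEq ι]
    (H : Matrix ι ι R⟦X⟧) (hH : ∀ i j, constantCoeff (H i j) = (1 : Matrix ι ι R) i j) :
    (∃ H', H * H' = 1) ∧ constantCoeff H.det = 1 := by
  have h1 : constantCoeff H.det = 1 := by
    rw [RingHom.map_det]
    have : (constantCoeff (R := R)).mapMatrix H = 1 := by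
      ext i j
      exact hH i j
    rw [this, Matrix.det_one]
  refine ⟨⟨H⁻¹, H.mul_nonsing_inv ?_⟩, h1⟩
  rw [PowerSeries.isUnit_iff_constantCoeff, h1]
  exact isUnit_one

theorem PowerSeries.exists_mul_eq_one (u : R⟦X⟧) (hu : constantCoeff u = 1) : ∃ w, u * w = 1 := by
  have : IsUnit u := by
    rw [PowerSeries.isUnit_iff_constantCoeff, hu]
    exact isUnit_one
  exact this.exists_right_inv

theorem Matrix.dvd_det_sub_one {ι : Type*} [Fintype ι] [DecidableEq ι] (x : R)
    (H : Matrix ι ι R) (hH : ∀ i j, x ∣ H i j - (1 : Matrix ι ι R) i j) : x ∣ H.det - 1 := by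
  rw [← Ideal.mem_span_singleton, ← Ideal.Quotient.eq]
  rw [RingHom.map_det]
  have : (Ideal.Quotient.mk (Ideal.span {x})).mapMatrix H = 1 := by
    ext i j
    have := (Ideal.Quotient.eq (I := Ideal.span {x})).2 (Ideal.mem_span_singleton.2 (hH i j))
    rw [RingHom.mapMatrix_apply, Matrix.map_apply, this, Matrix.one_apply, Matrix.one_apply]
    split_ifs <;> simp
  rw [this, Matrix.det_one, map_one]

theorem polRow_map_C_mul (j : ℕ) (g : R⟦X⟧) (u : (Polynomial R)⟦X⟧) :
    polRow j (PowerSeries.map Polynomial.C g * u) = g * polRow j u := by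
  ext s
  simp [coeff_polRow, coeff_mul, Polynomial.finsetSum_coeff]

theorem polEmb_eq_sum {n : ℕ} {p : (Polynomial R)⟦X⟧}
    (hp : RowsVanishBelow (-(n : ℤ)) (polEmb R p)) :
    polEmb R p = ∑ j ∈ Finset.range (n + 1),
      constEmb R (polRow j p) * C (HahnSeries.single (-(j : ℤ)) 1) := by
  ext s i
  rw [map_sum, HahnSeries.coeff_sum]
  simp only [coeff_mul_C, PowerSeries.coeff_map, HahnSeries.C_apply,
    HahnSeries.single_mul_single, zero_add, mul_one, coeff_polRow, HahnSeries.coeff_single]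
  rcases lt_or_ge 0 i with h | h
  · rw [polarEmb_coeff_pos _ h, Finset.sum_eq_zero]
    intro j _
    rw [if_neg (by omega)]
  · obtain ⟨l, rfl⟩ : ∃ j : ℕ, i = -(j : ℤ) := ⟨i.natAbs, by omega⟩
    rw [polarEmb_coeff_neg]
    simp only [neg_inj, Nat.cast_inj, Finset.sum_ite_eq, Finset.mem_range]
    split_ifs with h'
    · rfl
    · have := hp s (-(l : ℤ)) (by omega)
      rwa [PowerSeries.coeff_map, polarEmb_coeff_neg] at this

/-- Division by a unit family with bounded poles does not create poles outside the known range. -/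
theorem RowsVanishBelow.of_mul {a b : ℤ} {V u : (LaurentSeries R)⟦X⟧} (hV0 : constantCoeff V = 1)
    (hV : RowsVanishBelow (b - a) V) (hh : RowsVanishBelow b (V * u))
    (hu : ∀ s i, b ≤ i → i < a → (coeff s u).coeff i = 0) : RowsVanishBelow a u := by
  intro s
  induction s using Nat.strong_induction_on with
  | _ s ih =>
    intro i hi
    rcases le_or_gt b i with hb | hb
    · exact hu s i hb hi
    · have h1 := hh s i hb
      rw [coeff_mul, HahnSeries.coeff_sum, Finset.sum_eq_single (0, s)] at h1
      · simpa [hV0] using h1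
      · rintro ⟨p, q⟩ hpq hne
        rw [Finset.HasAntidiagonal.mem_antidiagonal] at hpq
        have hq : q < s := by
          rcases Nat.eq_zero_or_pos p with rfl | hp
          · exact absurd (by simpa using hpq) (fun h : q = s => hne (by rw [h]))
          · simp only at hpq; omega
        exact HahnSeries.coeff_mul_eq_zero_of_lt (hV p) (ih q hq) i (by omega)
      · simp

end SeriesLemmas

section Reciprocity

variable {A : Type*} [CommRing A]

/-- Matrix families over polynomials in `t⁻¹` which become block triangular with a scalar block
`r j` of prescribed pole order, together with their products with `f`. -/
structure ReciprocityData (f : LaurentSeries A) (m : Type) [Fintype m] [DecidableEq m]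
    (n : ℕ) where
  U : Matrix (m ⊕ Unit) (m ⊕ Unit) (LaurentSeries A)
  V : Matrix (m ⊕ Unit) (m ⊕ Unit) (LaurentSeries A)
  mul_eq_one : U * V = 1
  r : ℕ → LaurentSeries A
  coeff_lead : ∀ j : ℕ, (r j).coeff (-(n + 1 + j : ℤ)) = 1
  coeff_of_lt : ∀ j : ℕ, ∀ i < -(n + 1 + j : ℤ), (r j).coeff i = 0
  R : ℕ → Matrix (m ⊕ Unit) (m ⊕ Unit) (Polynomial A)
  S : ℕ → Matrix (m ⊕ Unit) (m ⊕ Unit) (Polynomial A)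
  N : ℕ → Matrix m m A⟦X⟧
  M : ℕ → Matrix m m A⟦X⟧
  rel : ∀ j, BlockRel U ((R j).map (polarEmb A)) ((N j).map (HahnSeries.ofPowerSeries ℤ A)) (r j)
  rel_mul : ∀ j, BlockRel U ((HahnSeries.single (-2 : ℤ) (1 : A) : LaurentSeries A) •
      (S j).map (polarEmb A))
    ((M j).map (HahnSeries.ofPowerSeries ℤ A)) (f * r j)

/-- Cramer's rule with coefficients in the subring of convergent series. -/
theorem exists_convSubring_solution {N : RingSeminorm A} {r : ℝ} {hr : 0 ≤ r} {L : ℕ} {d : ℕ}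
    (M : Matrix (Fin L) (Fin L) A⟦X⟧) (b : Fin L → A⟦X⟧)
    (hM : ∀ i j, M i j ∈ convSubring N r hr) (hb : ∀ i, b i ∈ convSubring N r hr)
    (hM0 : ∀ i j, j < i → constantCoeff (M i j) = 0) (hM1 : ∀ i, constantCoeff (M i i) = 1)
    (hbX : ∀ i, X ^ d ∣ b i) :
    ∃ (D : A⟦X⟧) (E : Fin L → A⟦X⟧), D ∈ convSubring N r hr ∧
      (∀ j, E j ∈ convSubring N r hr) ∧ constantCoeff D = 1 ∧ (∀ j, X ^ d ∣ E j) ∧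
      ∀ l, D * b l + ∑ j, E j * M l j = 0 := by
  have hmv : ∀ (P : Matrix (Fin L) (Fin L) A⟦X⟧) v j, P.mulVec v j = ∑ i, P j i * v i :=
    fun _ _ _ => rfl
  refine ⟨M.det, fun j => -(M.adjugate.mulVec b) j, Subring.det_mem _ _ hM, fun j => ?_, ?_,
    fun j => ?_, fun l => ?_⟩
  · simp only [hmv]
    exact neg_mem (sum_mem fun i _ => mul_mem (Subring.adjugate_mem _ _ hM _ _) (hb i))
  · rw [RingHom.map_det, Matrix.det_of_isUpperTriangular]
    · exact Finset.prod_eq_one fun i _ => hM1 i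
    · intro i j hij
      exact hM0 i j hij
  · simp only [hmv]
    exact (dvd_neg).2 (Finset.dvd_sum fun i _ => (hbX i).mul_left _)
  · have h1 : M.mulVec (M.adjugate.mulVec b) l = M.det * b l := by
      rw [Matrix.mulVec_mulVec, Matrix.mul_adjugate, Matrix.smul_mulVec, Matrix.one_mulVec]
      rfl
    rw [← h1]
    simp only [neg_mul, Finset.sum_neg_distrib]
    rw [add_neg_eq_zero, hmv]
    exact Finset.sum_congr rfl fun j _ => mul_comm _ _

theorem polEmb_map_C (c : A⟦X⟧) : polEmb A (PowerSeries.map Polynomial.C c) = constEmb A c := by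
  ext s : 1
  simp [polarEmb_C]

theorem intEmb_map_C (c : A⟦X⟧) : intEmb A (PowerSeries.map PowerSeries.C c) = constEmb A c := by
  ext s : 1
  simp

namespace ReciprocityData

variable {f : LaurentSeries A} {m : Type} [Fintype m] [DecidableEq m] {n : ℕ}
  (R : ReciprocityData f m n) {L : ℕ} (c : Fin L → A⟦X⟧)

/-- The matrix family with scalar block `1 + ∑ c_j r_j`. -/
noncomputable def matrixFamily : Matrix (m ⊕ Unit) (m ⊕ Unit) (Polynomial A)⟦X⟧ :=
  1 + ∑ j : Fin L, PowerSeries.map Polynomial.C (c j) • (R.R j).map C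

/-- The scalar family `1 + ∑ c_j r_j`. -/
noncomputable def scalarFamily : (LaurentSeries A)⟦X⟧ :=
  1 + ∑ j : Fin L, constEmb A (c j) * C (R.r j)

/-- The integral block of the matrix family. -/
noncomputable def integralFamily : Matrix m m (A⟦X⟧)⟦X⟧ :=
  1 + ∑ j : Fin L, PowerSeries.map C (c j) • (R.N j).map C

theorem map_C_mul_map_C : R.U.map C * R.V.map C = (1 : Matrix _ _ (LaurentSeries A)⟦X⟧) := by
  rw [← Matrix.map_mul, R.mul_eq_one, Matrix.map_one _ (map_zero _) (map_one _)]

theorem blockRel_family : BlockRel (R.U.map C) ((R.matrixFamily c).map (polEmb A))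
    ((R.integralFamily c).map (intEmb A)) (R.scalarFamily c) := by
  have h := BlockRel.one.add (BlockRel.sum Finset.univ (fun j (_ : j ∈ Finset.univ) =>
    BlockRel.smul (constEmb A (c j)) ((R.rel (j : Fin L)).map (C (R := LaurentSeries A)))))
  have e1 : (R.matrixFamily c).map (polEmb A) = 1 + ∑ j : Fin L, constEmb A (c j) •
      ((R.R j).map (polarEmb A)).map (C (R := LaurentSeries A)) := by
    change (polEmb A).mapMatrix _ = _
    rw [matrixFamily, map_add, map_one, map_sum]
    congr 1
    refine Finset.sum_congr rfl fun j _ => ?_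
    ext a b : 2
    simp [polEmb_map_C]
  have e2 : (R.integralFamily c).map (intEmb A) = 1 + ∑ j : Fin L, constEmb A (c j) •
      ((R.N j).map (HahnSeries.ofPowerSeries ℤ A)).map (C (R := LaurentSeries A)) := by
    change (intEmb A).mapMatrix _ = _
    rw [integralFamily, map_add, map_one, map_sum]
    congr 1
    refine Finset.sum_congr rfl fun j _ => ?_
    ext a b : 2
    simp [intEmb_map_C]
  rw [e1, e2]
  exact h

theorem derivative_constEmb (g : A⟦X⟧) :
    derivative (LaurentSeries A) (constEmb A g) = constEmb A (derivative A g) := by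
  ext s : 1
  simp only [coeff_derivative, PowerSeries.coeff_map, map_mul, map_add, map_natCast, map_one]

theorem derivative_scalarFamily : C f * derivative (LaurentSeries A) (R.scalarFamily c) =
    ∑ j : Fin L, constEmb A (derivative A (c j)) * C (f * R.r j) := by
  rw [scalarFamily, map_add, map_sum, Derivation.map_one_eq_zero, zero_add, Finset.mul_sum]
  refine Finset.sum_congr rfl fun j _ => ?_
  rw [Derivation.leibniz, derivative_constEmb, derivative_C, smul_zero, zero_add, smul_eq_mul,
    map_mul]
  ring

theorem blockRel_derivative : ∃ (G : Matrix (m ⊕ Unit) (m ⊕ Unit) (Polynomial A)⟦X⟧)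
    (M : Matrix m m (A⟦X⟧)⟦X⟧),
    BlockRel (R.U.map C) (C (HahnSeries.single (-2 : ℤ) (1 : A) : LaurentSeries A) •
        G.map (polEmb A)) (M.map (intEmb A))
      (C f * derivative (LaurentSeries A) (R.scalarFamily c)) := by
  refine ⟨∑ j : Fin L, PowerSeries.map Polynomial.C (derivative A (c j)) • (R.S j).map C,
    ∑ j : Fin L, PowerSeries.map C (derivative A (c j)) • (R.M j).map C, ?_⟩
  have h := (BlockRel.sum Finset.univ (fun j (_ : j ∈ Finset.univ) =>
    BlockRel.smul (constEmb A (derivative A (c j)))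
      ((R.rel_mul (j : Fin L)).map (C (R := LaurentSeries A)))))
  have e1 : C (HahnSeries.single (-2 : ℤ) (1 : A) : LaurentSeries A) • (∑ j : Fin L,
      PowerSeries.map Polynomial.C (derivative A (c j)) • (R.S j).map C).map (polEmb A) =
      ∑ j : Fin L, constEmb A (derivative A (c j)) •
      ((HahnSeries.single (-2 : ℤ) (1 : A) : LaurentSeries A) • (R.S j).map (polarEmb A)).map
        (C (R := LaurentSeries A)) := by
    change _ • (polEmb A).mapMatrix _ = _
    rw [map_sum, Finset.smul_sum]
    refine Finset.sum_congr rfl fun j _ => ?_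
    ext a b : 2
    simp only [Matrix.smul_apply, RingHom.mapMatrix_apply, Matrix.map_apply, smul_eq_mul, map_mul,
      polEmb_map_C, PowerSeries.map_C]
    ring_nf
  have e2 : (∑ j : Fin L, PowerSeries.map C (derivative A (c j)) • (R.M j).map C).map (intEmb A) =
      ∑ j : Fin L, constEmb A (derivative A (c j)) •
      ((R.M j).map (HahnSeries.ofPowerSeries ℤ A)).map (C (R := LaurentSeries A)) := by
    change (intEmb A).mapMatrix _ = _
    rw [map_sum]
    refine Finset.sum_congr rfl fun j _ => ?_
    ext a b : 2
    simp only [Matrix.smul_apply, RingHom.mapMatrix_apply, Matrix.map_apply, smul_eq_mul, map_mul,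
      intEmb_map_C, PowerSeries.map_C]
  rw [e1, e2, derivative_scalarFamily]
  exact h

variable {c}

theorem polEmb_det_matrixFamily : polEmb A (R.matrixFamily c).det =
    intEmb A (R.integralFamily c).det * R.scalarFamily c := by
  rw [RingHom.map_det, RingHom.map_det]
  exact (R.blockRel_family c).det R.map_C_mul_map_C

theorem dvd_matrixFamily {x : A⟦X⟧} (hc : ∀ j, x ∣ c j) (a b) :
    PowerSeries.map Polynomial.C x ∣
      R.matrixFamily c a b - (1 : Matrix _ _ (Polynomial A)⟦X⟧) a b := by
  rw [matrixFamily, Matrix.add_apply, add_sub_cancel_left, Matrix.sum_apply]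
  exact Finset.dvd_sum fun j _ => (map_dvd _ (hc j)).mul_right _

theorem dvd_integralFamily {x : A⟦X⟧} (hc : ∀ j, x ∣ c j) (a b) :
    PowerSeries.map C x ∣
      R.integralFamily c a b - (1 : Matrix _ _ (A⟦X⟧)⟦X⟧) a b := by
  rw [integralFamily, Matrix.add_apply, add_sub_cancel_left, Matrix.sum_apply]
  exact Finset.dvd_sum fun j _ => (map_dvd _ (hc j)).mul_right _

theorem dvd_scalarFamily {x : A⟦X⟧} (hc : ∀ j, x ∣ c j) :
    constEmb A x ∣ R.scalarFamily c - 1 := by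
  rw [scalarFamily, add_sub_cancel_left]
  exact Finset.dvd_sum fun j _ => (map_dvd _ (hc j)).mul_right _

theorem logRes_eq_zero (hf : ∀ i < 0, f.coeff i = 0) (hc : ∀ j, X ∣ c j)
    {u : ((LaurentSeries A)⟦X⟧)ˣ}
    (hu : (u : (LaurentSeries A)⟦X⟧) = polEmb A (R.matrixFamily c).det) : logRes f u = 0 := by
  have cc1 : ∀ {B : Type _} [CommRing B] {x y : B⟦X⟧}, X ∣ x - y →
      constantCoeff x = constantCoeff y := by
    intro B _ x y h
    have := X_dvd_iff.1 h
    rwa [map_sub, sub_eq_zero] at this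
  have cc : ∀ {B : Type _} [CommRing B] {x : B⟦X⟧}, X ∣ x - 1 → constantCoeff x = 1 := by
    intro B _ x h
    rw [cc1 h, map_one]
  obtain ⟨⟨H', hH'⟩, -⟩ := Matrix.exists_mul_eq_one_of_constantCoeff (R.matrixFamily c)
      fun a b => by
    have := R.dvd_matrixFamily hc a b
    rw [PowerSeries.map_X] at this
    rw [cc1 this, Matrix.one_apply, Matrix.one_apply]
    split_ifs <;> simp
  obtain ⟨⟨N', hN'⟩, hN1⟩ := Matrix.exists_mul_eq_one_of_constantCoeff (R.integralFamily c)
    fun a b => by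
      have := R.dvd_integralFamily hc a b
      rw [PowerSeries.map_X] at this
      rw [cc1 this, Matrix.one_apply, Matrix.one_apply]
      split_ifs <;> simp
  obtain ⟨h', hh'⟩ := PowerSeries.exists_mul_eq_one (R.scalarFamily c) (by
    have := R.dvd_scalarFamily hc
    rw [PowerSeries.map_X] at this
    exact cc this)
  obtain ⟨d', hd'⟩ := PowerSeries.exists_mul_eq_one _ hN1
  obtain ⟨G, M, ⟨c2, e2⟩⟩ := R.blockRel_derivative c
  obtain ⟨c1, e1⟩ := R.blockRel_family c
  have hI : intEmb A (R.integralFamily c).det * intEmb A d' = 1 := by rw [← map_mul, hd', map_one]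
  have hu2 : u = Units.mkOfMulEqOne _ _ hI * Units.mkOfMulEqOne _ _ hh' := by
    ext1
    rw [hu, R.polEmb_det_matrixFamily]
    rfl
  rw [hu2, logRes_mul, logRes_eq_zero_of_rowsVanishBelow hf, zero_add]
  · exact rowAt_neg_one_eq_zero_of_block R.map_C_mul_map_C hH' hN' hh' e1 e2
  · exact rowsVanishBelow_intEmb _
  · exact rowsVanishBelow_intEmb _

end ReciprocityData

end Reciprocity

section Path

variable {A : Type*} [CommRing A]

theorem polarSum_coeff_succ {n : ℕ} (ξ : Fin n → A) (l : Fin n) :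
    (polarSum ξ).coeff (l + 1) = ξ l := by
  rw [polarSum, Polynomial.finsetSum_coeff, Finset.sum_eq_single l]
  · simp
  · intro b _ hb
    rw [Polynomial.coeff_monomial, if_neg]
    intro h
    exact hb (Fin.ext (by omega))
  · simp

theorem polarSum_coeff_of_lt {n : ℕ} (ξ : Fin n → A) {j : ℕ} (hj : n < j) :
    (polarSum ξ).coeff j = 0 := by
  rw [polarSum, Polynomial.finsetSum_coeff]
  refine Finset.sum_eq_zero fun l _ => ?_
  rw [Polynomial.coeff_monomial, if_neg (by omega)]

theorem rowsVanishBelow_polarSum {n : ℕ} (ξ : Fin n → A) :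
    RowsVanishBelow (-(n : ℤ)) (1 + X * C (polarEmb A (polarSum ξ)) : (LaurentSeries A)⟦X⟧) := by
  refine (rowsVanishBelow_one.mono (by omega)).add ?_
  intro s i hi
  rcases s with _ | s
  · simp
  · rw [coeff_succ_X_mul, coeff_C]
    split_ifs
    · obtain ⟨j, rfl⟩ : ∃ j : ℕ, i = -(j : ℤ) := ⟨i.natAbs, by omega⟩
      rw [polarEmb_coeff_neg, polarSum_coeff_of_lt _ (by omega)]
    · simp

theorem sq_dvd_inverse_pow_sub {R : Type*} [CommRing R] {x p w : R} (hw : (1 + x * p) * w = 1)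
    (k : ℕ) : x ^ 2 ∣ w ^ k - (1 - k * (x * p)) := by
  induction k with
  | zero => simp
  | succ k ih =>
    obtain ⟨c, hc⟩ := ih
    refine ⟨w * c + w * p ^ 2 * (1 - k * (x * p)) + k * p ^ 2, ?_⟩
    rw [pow_succ]
    push_cast
    linear_combination w * hc + (1 - x * p) * (1 - k * (x * p)) * hw

theorem coeff_eq_of_dvd_sub {B : Type*} [CommRing B] {x y : B⟦X⟧} {d i : ℕ} (h : X ^ d ∣ x - y)
    (hi : i < d) : coeff i x = coeff i y := by
  have := X_pow_dvd_iff.1 h i hi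
  rwa [map_sub, sub_eq_zero] at this

theorem GrowthBound.mul_inverse_pow {N : RingSeminorm A} {n : ℕ} {ξ : Fin n → A}
    (hξ : ∀ l, N (ξ l) ≤ 1) {ν θ : ℝ} (hθ : 1 ≤ θ) (hν : 2 * n * θ ^ n ≤ ν) (hν1 : 1 ≤ ν)
    {u w : (LaurentSeries A)⟦X⟧} (hw : (1 + X * C (polarEmb A (polarSum ξ))) * w = 1)
    (hu : GrowthBound N ν θ u) (k : ℕ) : GrowthBound N ν θ (u * w ^ k) := by
  induction k with
  | zero => simpa using hu
  | succ k ih =>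
    rw [pow_succ, ← mul_assoc]
    exact ih.mul_inverse hξ hθ hν hν1 hw

theorem RingSeminorm.map_one_coeff_le (N : RingSeminorm A) {θ : ℝ} (hθ : 0 < θ) (i : ℤ) :
    N ((1 : LaurentSeries A).coeff i) ≤ N 1 * θ ^ i := by
  rw [HahnSeries.coeff_one]
  split_ifs with h
  · simp [h]
  · rw [map_zero]
    have := apply_nonneg N 1
    positivity

theorem growthBound_one (N : RingSeminorm A) {ν θ : ℝ} (hν : 0 ≤ ν) (hθ : 0 < θ) :
    GrowthBound N ν θ (1 : (LaurentSeries A)⟦X⟧) := by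
  have := growthBound_C (N := N) (f := (1 : LaurentSeries A)) hν hθ (N.map_one_coeff_le hθ)
  rwa [map_one] at this

theorem polEmb_inverse {n : ℕ} {ξ : Fin n → A} {w₀ : (Polynomial A)⟦X⟧}
    (hw : (1 + X * C (polarSum ξ)) * w₀ = 1) :
    (1 + X * C (polarEmb A (polarSum ξ))) * polEmb A w₀ = 1 := by
  simpa using congrArg (polEmb A) hw

theorem inverse_mem_polConvSubring {N : RingSeminorm A} {θ ν r : ℝ} {n : ℕ} (hθ : 1 ≤ θ)
    (hr : 0 ≤ r) (hν1 : 1 ≤ ν) (hν : 2 * n * θ ^ n ≤ ν) (hrν : r * ν < 1)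
    {ξ : Fin n → A} (hξ : ∀ l, N (ξ l) ≤ 1) {w₀ : (Polynomial A)⟦X⟧}
    (hw : (1 + X * C (polarSum ξ)) * w₀ = 1) : w₀ ∈ polConvSubring N r hr := by
  intro j
  rw [← rowAt_polEmb, ← one_mul (polEmb A w₀)]
  exact ((growthBound_one N (by linarith) (by linarith)).mul_inverse hξ hθ hν hν1
    (polEmb_inverse hw)).rowAt_mem hr (by linarith) hrν _

namespace ReciprocityData

variable {f : LaurentSeries A} {m : Type} [Fintype m] [DecidableEq m] {n : ℕ}
  (R : ReciprocityData f m n)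

theorem exists_scalarFamily (N : RingSeminorm A) {θ ν r : ℝ} (hθ : 1 ≤ θ) (hr : 0 ≤ r)
    (hν1 : 1 ≤ ν) (hν : 2 * n * θ ^ n ≤ ν) (hrν : r * ν < 1)
    (hR : ∀ j, ∃ K : ℝ, ∀ i, N ((R.r j).coeff i) ≤ K * θ ^ i)
    {ξ : Fin n → A} (hξ : ∀ l, N (ξ l) ≤ 1) (k : ℕ) {w₀ : (Polynomial A)⟦X⟧}
    (hw : (1 + X * C (polarSum ξ)) * w₀ = 1) :
    ∃ (L : ℕ) (D D' : A⟦X⟧) (E : Fin L → A⟦X⟧), D ∈ convSubring N r hr ∧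
      (∀ j, E j ∈ convSubring N r hr) ∧ D * D' = 1 ∧ constantCoeff D = 1 ∧ (∀ j, X ^ 2 ∣ E j) ∧
      RowsVanishBelow (-(n : ℤ)) (R.scalarFamily (fun j => D' * E j) * polEmb A w₀ ^ k) := by
  have hθ0 : 0 < θ := by linarith
  have hw' : (1 + X * C (polarEmb A (polarSum ξ))) * polEmb A w₀ = 1 :=
    polEmb_inverse hw
  have hg : ∀ u, GrowthBound N ν θ u → ∀ i, rowAt i (u * polEmb A w₀ ^ k) ∈ convSubring N r hr :=
    fun u hu i => (hu.mul_inverse_pow hξ hθ hν hν1 hw' k).rowAt_mem hr (by linarith) hrν i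
  have hg1 : GrowthBound N ν θ (1 : (LaurentSeries A)⟦X⟧) :=
    growthBound_one N (by linarith) hθ0
  have hw0 : constantCoeff (polEmb A w₀ ^ k) = 1 := by
    have h := congrArg constantCoeff hw'
    simp only [map_mul, map_add, map_one, constantCoeff_X, zero_mul, add_zero, one_mul] at h
    rw [map_pow, h, one_pow]
  have hMX : ∀ l j : ℕ, constantCoeff (rowAt (-(n + 1 + l : ℤ)) (C (R.r j) * polEmb A w₀ ^ k)) =
      (R.r j).coeff (-(n + 1 + l : ℤ)) := by
    intro l j
    rw [← coeff_zero_eq_constantCoeff_apply, coeff_rowAt, coeff_zero_eq_constantCoeff_apply,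
      map_mul, hw0, mul_one, constantCoeff_C]
  obtain ⟨D, E, hD, hE, hD1, hEX, hsol⟩ := exists_convSubring_solution (N := N) (hr := hr)
    (L := n * k) (d := 2)
    (fun l j => rowAt (-(n + 1 + (l : ℕ) : ℤ)) (C (R.r j) * polEmb A w₀ ^ k))
    (fun l => rowAt (-(n + 1 + (l : ℕ) : ℤ)) (1 * polEmb A w₀ ^ k))
    (fun l j => hg _ (growthBound_C (by linarith) hθ0 (hR j).choose_spec) _)
    (fun l => hg _ hg1 _)
    (fun l j hlj => by
      rw [hMX, R.coeff_of_lt _ _ (by have : (j : ℕ) < l := hlj; omega)])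
    (fun l => by rw [hMX, R.coeff_lead])
    (fun l => by
      rw [one_mul, X_pow_dvd_iff]
      intro s hs
      have h2 := coeff_eq_of_dvd_sub (sq_dvd_inverse_pow_sub hw k) hs
      have h3 : (-(n + 1 + (l : ℕ) : ℤ)) = -((n + 1 + l : ℕ) : ℤ) := by push_cast; ring
      rw [coeff_rowAt, h3, ← map_pow, PowerSeries.coeff_map, polarEmb_coeff_neg, h2]
      interval_cases s
      · simp
        rw [Polynomial.coeff_one, if_neg (by omega)]
      · rw [map_sub, ← nsmul_eq_mul, map_nsmul, ← zero_add 1, coeff_succ_X_mul, coeff_C, if_pos rfl,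
          coeff_one, if_neg (by omega), zero_sub, Polynomial.coeff_neg, Polynomial.coeff_smul,
          polarSum_coeff_of_lt _ (by omega), smul_zero, neg_zero])
  obtain ⟨D', hD'⟩ := PowerSeries.exists_mul_eq_one D hD1
  refine ⟨n * k, D, D', E, hD, hE, hD', hD1, hEX, ?_⟩
  have hV := (rowsVanishBelow_polarSum ξ).pow k
  refine RowsVanishBelow.of_mul (V := (1 + X * C (polarEmb A (polarSum ξ))) ^ k)
    (b := -n - (n * k : ℕ)) ?_ (hV.mono ?_) ?_ ?_
  · simp
  · push_cast
    ring_nf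
    rfl
  · have : (1 + X * C (polarEmb A (polarSum ξ))) ^ k *
        (R.scalarFamily (fun j => D' * E j) * polEmb A w₀ ^ k) =
        R.scalarFamily (fun j => D' * E j) := by
      rw [mul_left_comm, ← mul_pow, hw', one_pow, mul_one]
    rw [this, scalarFamily]
    refine (rowsVanishBelow_one.mono (by omega)).add (RowsVanishBelow.sum fun j _ => ?_)
    refine ((rowsVanishBelow_constEmb _).mul
      (rowsVanishBelow_C (R.coeff_of_lt j))).mono ?_
    have := j.2
    omega
  · intro s i hi1 hi2
    obtain ⟨l, hl, rfl⟩ : ∃ l : ℕ, l < n * k ∧ i = -(n + 1 + l : ℤ) :=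
      ⟨(-(n + 1 + i)).toNat, by omega, by omega⟩
    have h1 := hsol ⟨l, hl⟩
    rw [← coeff_rowAt, scalarFamily, add_mul, Finset.sum_mul, map_add, map_sum]
    simp only [mul_assoc, rowAt_constEmb_mul]
    rw [← Finset.mul_sum, ← one_mul (rowAt _ (1 * _)), ← hD', mul_comm D D', mul_assoc D',
      ← mul_add, h1, mul_zero, map_zero]

theorem map_C_pow_mul_det_mem {N : RingSeminorm A} {r : ℝ} {hr : 0 ≤ r} {L : ℕ} {D D' : A⟦X⟧}
    {E : Fin L → A⟦X⟧} (hD : D ∈ convSubring N r hr) (hE : ∀ j, E j ∈ convSubring N r hr)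
    (hDD : D * D' = 1) :
    PowerSeries.map Polynomial.C (D ^ Fintype.card (m ⊕ Unit)) *
      (R.matrixFamily fun j => D' * E j).det ∈ polConvSubring N r hr := by
  rw [map_pow, ← Matrix.det_smul]
  refine Subring.det_mem _ _ fun a b => ?_
  have h2 : (PowerSeries.map Polynomial.C D • R.matrixFamily fun j => D' * E j) a b =
      PowerSeries.map Polynomial.C D * (1 : Matrix _ _ (Polynomial A)⟦X⟧) a b +
      ∑ j, PowerSeries.map Polynomial.C (E j) * C (R.R j a b) := by
    rw [Matrix.smul_apply, matrixFamily, Matrix.add_apply, Matrix.sum_apply, smul_eq_mul,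
      mul_add, Finset.mul_sum, add_right_inj]
    refine Finset.sum_congr rfl fun j _ => ?_
    rw [Matrix.smul_apply, Matrix.map_apply, smul_eq_mul, ← mul_assoc, ← map_mul,
      ← mul_assoc, hDD, one_mul]
  rw [h2]
  refine add_mem (mul_mem (map_C_mem_polConvSubring hD) ?_) (sum_mem fun j _ =>
    mul_mem (map_C_mem_polConvSubring (hE j)) (C_mem_polConvSubring _ _ _ _))
  rw [Matrix.one_apply]
  split_ifs
  exacts [one_mem _, zero_mem _]

set_option maxHeartbeats 800000 in
theorem exists_path (hf : ∀ i < 0, f.coeff i = 0) (N : RingSeminorm A) {θ ν r : ℝ}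
    (hθ : 1 ≤ θ) (hr : 0 ≤ r)
    (hν1 : 1 ≤ ν) (hν : 2 * n * θ ^ n ≤ ν) (hrν : r * ν < 1)
    (hR : ∀ j, ∃ K : ℝ, ∀ i, N ((R.r j).coeff i) ≤ K * θ ^ i)
    {ξ : Fin n → A} (hξ : ∀ l, N (ξ l) ≤ 1) (k : ℕ) :
    ∃ (e : Fin n → A⟦X⟧) (Q : A⟦X⟧) (u v : ((LaurentSeries A)⟦X⟧)ˣ),
      constantCoeff Q = 1 ∧ Q ∈ convSubring N r hr ∧ (∀ i, Q * e i ∈ convSubring N r hr) ∧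
      (∀ i, constantCoeff (e i) = 0) ∧ (∀ i, coeff 1 (e i) = -(k * ξ i)) ∧
      (u : (LaurentSeries A)⟦X⟧) =
        1 + ∑ i : Fin n, constEmb A (e i) * C (HahnSeries.single (-(i + 1 : ℤ)) 1) ∧
      (v : (LaurentSeries A)⟦X⟧) = 1 + X * C (polarEmb A (polarSum ξ)) ∧
      logRes f u = -(k * logRes f v) := by
  have hθ0 : 0 < θ := by linarith
  obtain ⟨w₀, hw⟩ := PowerSeries.exists_mul_eq_one (1 + X * C (polarSum ξ)) (by simp)
  have hw' : (1 + X * C (polarEmb A (polarSum ξ))) * polEmb A w₀ = 1 :=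
    polEmb_inverse hw
  obtain ⟨L, D, D', E, hD, hE, hDD, hD1, hEX, hvan⟩ :=
    R.exists_scalarFamily N hθ hr hν1 hν hrν hR hξ k hw
  set c : Fin L → A⟦X⟧ := fun j => D' * E j with hc
  have hcX : ∀ j, X ^ 2 ∣ c j := fun j => (hEX j).mul_left _
  have hcX1 : ∀ j, X ∣ c j := fun j => (dvd_pow_self _ two_ne_zero).trans (hcX j)
  set p := (R.matrixFamily c).det * w₀ ^ k with hp
  have hpvan : RowsVanishBelow (-(n : ℤ)) (polEmb A p) := by
    rw [hp, map_mul, map_pow, R.polEmb_det_matrixFamily, mul_assoc, ← zero_add (-(n : ℤ))]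
    exact (rowsVanishBelow_intEmb _).mul hvan
  have hdet : X ^ 2 ∣ (R.matrixFamily c).det - 1 := by
    refine Matrix.dvd_det_sub_one _ _ fun a b => ?_
    have := R.dvd_matrixFamily hcX a b
    rwa [map_pow, PowerSeries.map_X] at this
  have hp2 : X ^ 2 ∣ p - (1 - (k : (Polynomial A)⟦X⟧) * (X * C (polarSum ξ))) := by
    have h1 := hdet.mul_right (w₀ ^ k)
    have h2 := dvd_add h1 (sq_dvd_inverse_pow_sub hw k)
    convert h2 using 1
    rw [hp]
    ring
  have hp0 : coeff 0 p = 1 := by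
    rw [coeff_eq_of_dvd_sub hp2 (by norm_num)]
    simp
  have hp1 : coeff 1 p = -(k • polarSum ξ) := by
    rw [coeff_eq_of_dvd_sub hp2 (by norm_num), map_sub, ← nsmul_eq_mul, map_nsmul, ← zero_add 1,
      coeff_succ_X_mul, coeff_C, if_pos rfl, coeff_one, if_neg (by omega), zero_sub]
  have hA1 : constantCoeff (polRow 0 p) = 1 := by
    rw [← coeff_zero_eq_constantCoeff_apply, coeff_polRow, hp0]
    simp
  obtain ⟨B, hB⟩ := PowerSeries.exists_mul_eq_one _ hA1
  have hB1 : constantCoeff B = 1 := by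
    have := congrArg constantCoeff hB
    rwa [map_mul, hA1, one_mul, map_one] at this
  have hpi : ∀ i : Fin n, constantCoeff (polRow (i + 1) p) = 0 := by
    intro i
    rw [← coeff_zero_eq_constantCoeff_apply, coeff_polRow, hp0, Polynomial.coeff_one,
      if_neg (by omega)]
  have hvU : IsUnit (1 + X * C (polarEmb A (polarSum ξ))) := IsUnit.of_mul_eq_one _ hw'
  obtain ⟨d', hd'⟩ := PowerSeries.exists_mul_eq_one (polEmb A (R.matrixFamily c).det) (by
    have := map_dvd (polEmb A) hdet
    rw [map_pow, PowerSeries.map_X, map_sub, map_one] at this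
    rw [← coeff_zero_eq_constantCoeff_apply, coeff_eq_of_dvd_sub this (by norm_num)]
    simp)
  have hBu : constEmb A B * constEmb A (polRow 0 p) = 1 := by
    rw [← map_mul, mul_comm, hB, map_one]
  let uB : ((LaurentSeries A)⟦X⟧)ˣ := Units.mkOfMulEqOne _ _ hBu
  let ud : ((LaurentSeries A)⟦X⟧)ˣ := Units.mkOfMulEqOne _ _ hd'
  let v : ((LaurentSeries A)⟦X⟧)ˣ := Units.mkOfMulEqOne _ _ hw'
  have hu0 : logRes f uB = 0 := by
    refine logRes_eq_zero_of_rowsVanishBelow hf ?_ ?_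
    · exact rowsVanishBelow_constEmb _
    · exact rowsVanishBelow_constEmb _
  have hwv : logRes f (v⁻¹ ^ k) = -(k * logRes f v) := by
    have h1 : logRes f ((v⁻¹) * v) = 0 := by
      rw [inv_mul_cancel]
      simp [logRes]
    rw [logRes_mul] at h1
    rw [logRes_pow]
    linear_combination (k : A⟦X⟧) * h1
  set K := Fintype.card (m ⊕ Unit) with hK
  have hDp : PowerSeries.map Polynomial.C (D ^ K) * p ∈ polConvSubring N r hr := by
    rw [hp, ← mul_assoc]
    exact mul_mem (R.map_C_pow_mul_det_mem hD hE hDD)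
      (pow_mem (inverse_mem_polConvSubring hθ hr hν1 hν hrν hξ hw) _)
  have hDr : ∀ j, D ^ K * polRow j p ∈ convSubring N r hr := fun j => by
    rw [← polRow_map_C_mul]
    exact hDp j
  refine ⟨fun i => B * polRow (i + 1) p, D ^ K * polRow 0 p, uB * (ud * v⁻¹ ^ k), v, ?_, hDr 0,
    fun i => ?_, fun i => ?_, fun i => ?_, ?_, rfl, ?_⟩
  · rw [map_mul, map_pow, hD1, hA1, one_pow, one_mul]
  · have : D ^ K * polRow 0 p * (B * polRow (i + 1) p) =
        D ^ K * polRow (i + 1) p := by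
      linear_combination D ^ K * polRow (i + 1) p * hB
    rw [this]
    exact hDr _
  · rw [map_mul, hpi, mul_zero]
  · have h1 := hpi i
    rw [← coeff_zero_eq_constantCoeff_apply] at h1
    rw [coeff_mul, Finset.Nat.antidiagonal_succ]
    simp only [Finset.HasAntidiagonal.antidiagonal]
    rw [coeff_polRow, coeff_zero_eq_constantCoeff_apply] at h1
    simp [h1, hB1, hp1, polarSum_coeff_succ]
  · have h1 : ((uB * (ud * v⁻¹ ^ k) : ((LaurentSeries A)⟦X⟧)ˣ) : (LaurentSeries A)⟦X⟧) =
        constEmb A B * polEmb A p := by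
      rw [hp, map_mul, map_pow]
      rfl
    rw [h1, polEmb_eq_sum hpvan, Finset.sum_range_succ', mul_add, Finset.mul_sum,
      ← Fin.sum_univ_eq_sum_range (fun j => constEmb A B * (constEmb A (polRow (j + 1) p) *
        C (HahnSeries.single (-((j + 1 : ℕ) : ℤ)) 1)))]
    have h2 : C (HahnSeries.single (-((0 : ℕ) : ℤ)) 1 : LaurentSeries A) = 1 := by
      simp
    rw [h2, mul_one, hBu, add_comm]
    congr 1
    refine Finset.sum_congr rfl fun i _ => ?_
    rw [← mul_assoc, ← map_mul]
    push_cast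
    rfl
  · rw [logRes_mul, logRes_mul, hu0, hwv, R.logRes_eq_zero hf hcX1 (u := ud) rfl]
    ring

end ReciprocityData

end Path

section ODE

variable {A : Type*} [CommRing A] [Algebra ℚ A]

/-- Coefficients of the solution of `Y' = ρ Y`, `Y(0) = 1`. -/
noncomputable def odeCoeff (ρ : A⟦X⟧) : ℕ → A
  | 0 => 1
  | s + 1 => ((s + 1 : ℚ)⁻¹) • ∑ i : Fin (s + 1), coeff (s - i) ρ * odeCoeff ρ i

/-- The solution of `Y' = ρ Y`, `Y(0) = 1`. -/
noncomputable def odeSol (ρ : A⟦X⟧) : A⟦X⟧ := PowerSeries.mk (odeCoeff ρ)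

theorem constantCoeff_odeSol (ρ : A⟦X⟧) : constantCoeff (odeSol ρ) = 1 := by
  rw [← coeff_zero_eq_constantCoeff_apply, odeSol, coeff_mk, odeCoeff]

theorem coeff_succ_odeSol (ρ : A⟦X⟧) (s : ℕ) : coeff (s + 1) (odeSol ρ) =
    ((s + 1 : ℚ)⁻¹) • ∑ i ∈ Finset.range (s + 1), coeff (s - i) ρ * coeff i (odeSol ρ) := by
  rw [odeSol, coeff_mk, odeCoeff, ← Fin.sum_univ_eq_sum_range
    (fun i => coeff (s - i) ρ * coeff i (PowerSeries.mk (odeCoeff ρ)))]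
  simp only [coeff_mk]

theorem coeff_mul_eq_sum_range {B : Type*} [CommRing B] (ρ y : B⟦X⟧) (s : ℕ) :
    coeff s (ρ * y) = ∑ i ∈ Finset.range (s + 1), coeff (s - i) ρ * coeff i y := by
  rw [mul_comm, coeff_mul]
  refine (Finset.Nat.sum_antidiagonal_eq_sum_range_succ (fun i j => coeff i y * coeff j ρ) s).trans
    (Finset.sum_congr rfl fun i _ => mul_comm _ _)

theorem derivative_odeSol (ρ : A⟦X⟧) : derivative A (odeSol ρ) = ρ * odeSol ρ := by
  ext s
  rw [coeff_derivative, coeff_succ_odeSol, coeff_mul_eq_sum_range]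
  have h : (s + 1 : A) = algebraMap ℚ A (s + 1) := by simp
  rw [h, mul_comm, ← Algebra.smul_def, smul_smul, mul_inv_cancel₀ (by positivity), one_smul]

theorem eq_odeSol {ρ y : A⟦X⟧} (h0 : constantCoeff y = 1) (h : derivative A y = ρ * y) :
    y = odeSol ρ := by
  ext s
  induction s using Nat.strong_induction_on with
  | _ s ih =>
    rcases s with _ | s
    · rw [coeff_zero_eq_constantCoeff_apply, coeff_zero_eq_constantCoeff_apply, h0,
        constantCoeff_odeSol]
    · have h1 := congrArg (coeff s) h
      rw [coeff_derivative, coeff_mul_eq_sum_range] at h1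
      have h2 : (s + 1 : A) = algebraMap ℚ A (s + 1) := by simp
      rw [h2, mul_comm, ← Algebra.smul_def] at h1
      rw [coeff_succ_odeSol, Finset.sum_congr rfl fun i hi => by
        rw [← ih i (Finset.mem_range.1 hi)], ← h1, smul_smul, inv_mul_cancel₀ (by positivity),
        one_smul]

theorem odeSol_zero : odeSol (0 : A⟦X⟧) = 1 := by
  symm
  apply eq_odeSol <;> simp

theorem odeSol_add (ρ σ : A⟦X⟧) : odeSol (ρ + σ) = odeSol ρ * odeSol σ := by
  symm
  apply eq_odeSol
  · simp [constantCoeff_odeSol]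
  · rw [Derivation.leibniz, derivative_odeSol, derivative_odeSol, smul_eq_mul, smul_eq_mul]
    ring

theorem odeSol_natCast_mul (k : ℕ) (ρ : A⟦X⟧) : odeSol ((k : A⟦X⟧) * ρ) = odeSol ρ ^ k := by
  induction k with
  | zero => simp [odeSol_zero]
  | succ k ih => rw [Nat.cast_succ, add_mul, one_mul, odeSol_add, ih, pow_succ]

theorem map_odeSol {A' : Type*} [CommRing A'] [Algebra ℚ A'] (φ : A →+* A') (ρ : A⟦X⟧) :
    PowerSeries.map φ (odeSol ρ) = odeSol (PowerSeries.map φ ρ) := by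
  apply eq_odeSol
  · rw [← coeff_zero_eq_constantCoeff_apply, PowerSeries.coeff_map,
      coeff_zero_eq_constantCoeff_apply, constantCoeff_odeSol, map_one]
  · rw [← map_mul, ← derivative_odeSol]
    ext s
    simp [coeff_derivative]

/-- Solutions depend continuously on the equation for the `X`-adic topology. -/
theorem coeff_odeSol_congr {ρ y : A⟦X⟧} {d : ℕ} (h0 : constantCoeff y = 1)
    (h : X ^ d ∣ derivative A y - ρ * y) : X ^ (d + 1) ∣ y - odeSol ρ := by
  rw [X_pow_dvd_iff]
  intro s hs
  rw [map_sub, sub_eq_zero]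
  induction s using Nat.strong_induction_on with
  | _ s ih =>
    rcases s with _ | s
    · rw [coeff_zero_eq_constantCoeff_apply, coeff_zero_eq_constantCoeff_apply, h0,
        constantCoeff_odeSol]
    · have h1 := coeff_eq_of_dvd_sub h (show s < d by omega)
      rw [coeff_derivative, coeff_mul_eq_sum_range] at h1
      have h2 : (s + 1 : A) = algebraMap ℚ A (s + 1) := by simp
      rw [h2, mul_comm, ← Algebra.smul_def] at h1
      rw [coeff_succ_odeSol, Finset.sum_congr rfl fun i hi => by
        rw [← ih i (Finset.mem_range.1 hi) (by have := Finset.mem_range.1 hi; omega)], ← h1,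
        smul_smul, inv_mul_cancel₀ (by positivity), one_smul]

theorem odeSol_growth {N : RingSeminorm A} (hN : ∀ q : ℚ, N (algebraMap ℚ A q) ≤ |(q : ℝ)|)
    {ρ : A⟦X⟧} {K ν μ : ℝ} (hν : 0 ≤ ν) (hνμ : ν ≤ μ) (hKμ : K ≤ μ)
    (hρ : ∀ s, N (coeff s ρ) ≤ K * ν ^ s) (s : ℕ) : N (coeff s (odeSol ρ)) ≤ μ ^ s := by
  have hK : 0 ≤ K := by simpa using (apply_nonneg N _).trans (hρ 0)
  induction s using Nat.strong_induction_on with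
  | _ s ih =>
    rcases s with _ | s
    · rw [coeff_zero_eq_constantCoeff_apply, constantCoeff_odeSol]
      simpa using hN 1
    · rw [coeff_succ_odeSol, Algebra.smul_def]
      refine (map_mul_le_mul N _ _).trans ?_
      have h1 : N (∑ i ∈ Finset.range (s + 1), coeff (s - i) ρ * coeff i (odeSol ρ)) ≤
          (s + 1) * μ ^ (s + 1) := by
        refine (N.map_sum_le _ _).trans ?_
        calc _ ≤ ∑ i ∈ Finset.range (s + 1), μ ^ (s + 1) := by
              refine Finset.sum_le_sum fun i hi => ?_
              have hi' := Finset.mem_range.1 hi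
              calc _ ≤ N (coeff (s - i) ρ) * N (coeff i (odeSol ρ)) := map_mul_le_mul N _ _
                _ ≤ (K * ν ^ (s - i)) * μ ^ i :=
                    mul_le_mul (hρ _) (ih i hi') (apply_nonneg N _) (by positivity)
                _ ≤ (μ * μ ^ (s - i)) * μ ^ i := by
                    have : 0 ≤ μ := hK.trans hKμ
                    gcongr
                _ = μ ^ (s + 1) := by
                    rw [← pow_succ', ← pow_add]
                    congr 1
                    omega
          _ = _ := by simp
      have h2 := hN ((s + 1 : ℚ)⁻¹)
      have h3 : |(((s + 1 : ℚ)⁻¹ : ℚ) : ℝ)| = ((s : ℝ) + 1)⁻¹ := by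
        push_cast
        exact abs_of_pos (by positivity)
      rw [h3] at h2
      calc _ ≤ ((s : ℝ) + 1)⁻¹ * ((s + 1) * μ ^ (s + 1)) :=
            mul_le_mul h2 h1 (apply_nonneg N _) (by positivity)
        _ = _ := by field_simp

end ODE

section BaseChange

variable {A A' : Type*} [CommRing A] [CommRing A'] (φ : A →+* A')

theorem laurentMap_polarEmb (p : Polynomial A) :
    laurentMap φ (polarEmb A p) = polarEmb A' (p.map φ) := by
  induction p using Polynomial.induction_on' with
  | add p q hp hq => simp [hp, hq]
  | monomial n c => rw [polarEmb_monomial, Polynomial.map_monomial, polarEmb_monomial,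
      laurentMap_single]

theorem laurentMap_ofPowerSeries (p : A⟦X⟧) : laurentMap φ (HahnSeries.ofPowerSeries ℤ A p) =
    HahnSeries.ofPowerSeries ℤ A' (PowerSeries.map φ p) := by
  ext i
  rw [laurentMap_coeff]
  rcases lt_or_ge i 0 with h | h
  · rw [ofPowerSeries_coeff_of_neg _ h, ofPowerSeries_coeff_of_neg _ h, map_zero]
  · lift i to ℕ using h
    rw [ofPowerSeries_coeff_natCast, ofPowerSeries_coeff_natCast, PowerSeries.coeff_map]

/-- Base change of reciprocity data. -/
noncomputable def ReciprocityData.map {f : LaurentSeries A} {m : Type} [Fintype m] [DecidableEq m]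
    {n : ℕ} (R : ReciprocityData f m n) : ReciprocityData (laurentMap φ f) m n where
  U := R.U.map (laurentMap φ)
  V := R.V.map (laurentMap φ)
  mul_eq_one := by
    rw [← Matrix.map_mul, R.mul_eq_one, Matrix.map_one _ (map_zero _) (map_one _)]
  r j := laurentMap φ (R.r j)
  coeff_lead j := by rw [laurentMap_coeff, R.coeff_lead, map_one]
  coeff_of_lt j i hi := by rw [laurentMap_coeff, R.coeff_of_lt j i hi, map_zero]
  R j := (R.R j).map (Polynomial.map φ)
  S j := (R.S j).map (Polynomial.map φ)
  N j := (R.N j).map (PowerSeries.map φ)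
  M j := (R.M j).map (PowerSeries.map φ)
  rel j := by
    have := (R.rel j).map (laurentMap φ)
    simp only [Matrix.map_map, Function.comp_def, laurentMap_polarEmb,
      laurentMap_ofPowerSeries] at this ⊢
    exact this
  rel_mul j := by
    have := (R.rel_mul j).map (laurentMap φ)
    have h : ((HahnSeries.single (-2 : ℤ) (1 : A) : LaurentSeries A) •
        (R.S j).map (polarEmb A)).map (laurentMap φ) =
        (HahnSeries.single (-2 : ℤ) (1 : A') : LaurentSeries A') •
          ((R.S j).map (Polynomial.map φ)).map (polarEmb A') := by
      ext a b : 2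
      simp only [Matrix.map_apply, Matrix.smul_apply, smul_eq_mul, map_mul, laurentMap_single,
        laurentMap_polarEmb, map_one]
    rw [h, map_mul] at this
    simp only [Matrix.map_map, Function.comp_def,
      laurentMap_ofPowerSeries] at this ⊢
    exact this

end BaseChange

section NormSeries

variable {A : Type*} [CommRing A]

/-- The family `1 + ∑ e_i t^{-(i+1)}` of Laurent polynomials. -/
noncomputable def polarFamily {n : ℕ} (e : Fin n → A⟦X⟧) : (LaurentSeries A)⟦X⟧ :=
  1 + ∑ i : Fin n, constEmb A (e i) * C (HahnSeries.single (-(i + 1 : ℤ)) 1)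

/-- The solution of `Y' = - Res(f dlog u) Y` along the family `u = 1 + ∑ e_i t^{-(i+1)}`. -/
noncomputable def normSeries [Algebra ℚ A] (f : LaurentSeries A) {n : ℕ} (e : Fin n → A⟦X⟧) :
    A⟦X⟧ :=
  odeSol (-rowAt (-1) (C f * derivative (LaurentSeries A) (polarFamily e) *
    Ring.inverse (polarFamily e)))

theorem normSeries_eq [Algebra ℚ A] (f : LaurentSeries A) {n : ℕ} {e : Fin n → A⟦X⟧}
    {u : ((LaurentSeries A)⟦X⟧)ˣ} (hu : (u : (LaurentSeries A)⟦X⟧) = polarFamily e) :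
    normSeries f e = odeSol (-logRes f u) := by
  rw [normSeries, logRes, ← hu, Ring.inverse_unit]

theorem ReciprocityData.exists_path_normSeries {f : LaurentSeries ℚ} (hf : ∀ i < 0, f.coeff i = 0)
    {m : Type} [Fintype m] [DecidableEq m] {n : ℕ} (R : ReciprocityData f m n) {θ : ℝ}
    (hθ : 1 ≤ θ) (hfθ : ∃ K : ℝ, ∀ i, |(f.coeff i : ℝ)| ≤ K * θ ^ i)
    (hR : ∀ j, ∃ K : ℝ, ∀ i, |((R.r j).coeff i : ℝ)| ≤ K * θ ^ i)
    [Algebra ℚ A] {N : RingSeminorm A} (hN : ∀ q : ℚ, N (algebraMap ℚ A q) ≤ |(q : ℝ)|)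
    {ξ : Fin n → A} (hξ : ∀ l, N (ξ l) ≤ 1) :
    ∃ (r : ℝ) (hr : 0 ≤ r), 0 < r ∧ ∃ Z ∈ convSubring N r hr, ∀ k : ℕ,
      ∃ (e : Fin n → A⟦X⟧) (Q : A⟦X⟧),
        constantCoeff Q = 1 ∧ Q ∈ convSubring N r hr ∧ (∀ i, Q * e i ∈ convSubring N r hr) ∧
        (∀ i, constantCoeff (e i) = 0) ∧ (∀ i, coeff 1 (e i) = -(k * ξ i)) ∧
        normSeries (laurentMap (algebraMap ℚ A) f) e = Z ^ k := by
  have hθ0 : 0 < θ := by linarith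
  set ν : ℝ := max 1 (2 * n * θ ^ n) with hν
  have hν1 : 1 ≤ ν := le_max_left _ _
  obtain ⟨w₀, hw⟩ := PowerSeries.exists_mul_eq_one (1 + X * C (polarSum ξ)) (by simp)
  have hw' := polEmb_inverse hw
  obtain ⟨v, hv, hvinv⟩ : ∃ v : ((LaurentSeries A)⟦X⟧)ˣ,
      (v : (LaurentSeries A)⟦X⟧) = 1 + X * C (polarEmb A (polarSum ξ)) ∧
      ((v⁻¹ : ((LaurentSeries A)⟦X⟧)ˣ) : (LaurentSeries A)⟦X⟧) = polEmb A w₀ :=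
    ⟨Units.mkOfMulEqOne _ _ hw', rfl, rfl⟩
  have hg : ∀ g : LaurentSeries ℚ, (∃ K : ℝ, ∀ i, |(g.coeff i : ℝ)| ≤ K * θ ^ i) →
      ∃ K : ℝ, ∀ i, N ((laurentMap (algebraMap ℚ A) g).coeff i) ≤ K * θ ^ i := by
    rintro g ⟨K, hK⟩
    exact ⟨K, fun i => (hN _).trans (hK i)⟩
  have hder : derivative (LaurentSeries A) (v : (LaurentSeries A)⟦X⟧) =
      C (polarEmb A (polarSum ξ)) := by
    rw [hv, map_add, Derivation.map_one_eq_zero, Derivation.leibniz, derivative_C, derivative_X]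
    simp
  obtain ⟨K, hK⟩ := hg f hfθ
  obtain ⟨K', hK'⟩ : GrowthBound N ν θ (C (polarEmb A (polarSum ξ)) *
      C (laurentMap (algebraMap ℚ A) f) * polEmb A w₀) :=
    ((growthBound_C (by linarith) hθ0 hK).mul_polarSum hξ hθ).mul_inverse hξ hθ
      (le_max_right _ _) hν1 hw'
  set μ := max ν (K' * θ ^ (-1 : ℤ)) with hμ
  have hμ1 : 1 ≤ μ := hν1.trans (le_max_left _ _)
  have hr0 : 0 < (2 * μ)⁻¹ := by positivity
  have hrμ : (2 * μ)⁻¹ * μ < 1 := by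
    rw [mul_inv, mul_assoc, inv_mul_cancel₀ (by positivity)]
    norm_num
  have hrν : (2 * μ)⁻¹ * ν < 1 :=
    (mul_le_mul_of_nonneg_left (le_max_left _ _) hr0.le).trans_lt hrμ
  refine ⟨(2 * μ)⁻¹, hr0.le, hr0, odeSol (logRes (laurentMap (algebraMap ℚ A) f) v),
    mem_convSubring_of_le _ (K := 1) (by linarith) hrμ fun s => ?_, fun k => ?_⟩
  · rw [one_mul]
    refine odeSol_growth hN (K := K' * θ ^ (-1 : ℤ)) (by linarith : (0 : ℝ) ≤ ν) (le_max_left _ _)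
      (le_max_right _ _) (fun s => ?_) s
    have h1 : C (laurentMap (algebraMap ℚ A) f) * derivative (LaurentSeries A)
        (v : (LaurentSeries A)⟦X⟧) * ((v⁻¹ : ((LaurentSeries A)⟦X⟧)ˣ) : (LaurentSeries A)⟦X⟧) =
        C (polarEmb A (polarSum ξ)) * C (laurentMap (algebraMap ℚ A) f) * polEmb A w₀ := by
      rw [hder, hvinv, mul_comm (C (laurentMap (algebraMap ℚ A) f))]
    rw [logRes, h1, coeff_rowAt]
    exact (hK' s (-1)).trans_eq (by ring)
  · obtain ⟨e, Q, u, v', h1, h2, h3, h4, h5, h6, h7, h8⟩ :=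
      (R.map (algebraMap ℚ A)).exists_path (fun i hi => by rw [laurentMap_coeff, hf i hi, map_zero])
      N hθ hr0.le hν1 (le_max_right _ _) hrν (fun j => hg _ (hR j)) hξ k
    have hvv : v' = v := Units.ext (h7.trans hv.symm)
    refine ⟨e, Q, h1, h2, h3, h4, h5, ?_⟩
    rw [normSeries_eq _ h6, h8, neg_neg, hvv, odeSol_natCast_mul]

end NormSeries

section RowCompanion

variable {R : Type*} [CommRing R] {n : ℕ}

/-- The matrix with first row `-e` and with ones on the subdiagonal. -/
def rowCompanion (e : Fin n → R) : Matrix (Fin n) (Fin n) R :=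
  Matrix.of fun i j => (if (i : ℕ) = j + 1 then 1 else 0) - if (i : ℕ) = 0 then e j else 0

theorem rowCompanion_map {R' : Type*} [CommRing R'] (φ : R →+* R') (e : Fin n → R) :
    (rowCompanion e).map φ = rowCompanion (fun i => φ (e i)) := by
  ext i j
  simp only [rowCompanion, Matrix.map_apply, Matrix.of_apply, map_sub]
  congr 1 <;> split_ifs <;> simp

theorem rowCompanion_zero_apply (i j : Fin n) :
    rowCompanion (0 : Fin n → R) i j = if (i : ℕ) = j + 1 then 1 else 0 := by
  simp [rowCompanion]

theorem rowCompanion_apply (e : Fin n → R) (i j : Fin n) : rowCompanion e i j =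
    (if (i : ℕ) = j + 1 then 1 else 0) - if (i : ℕ) = 0 then e j else 0 := rfl

theorem det_one_sub_smul_rowCompanion (τ : R) (e : Fin n → R) :
    (1 - τ • rowCompanion e).det = 1 + ∑ i : Fin n, e i * τ ^ ((i : ℕ) + 1) := by
  have h1 : (1 - τ • rowCompanion (0 : Fin n → R)).det = 1 := by
    rw [Matrix.det_of_isLowerTriangular]
    · refine Finset.prod_eq_one fun i _ => ?_
      simp [rowCompanion_zero_apply]
    · intro i j hij
      have hij' : i < j := hij
      have hlt : (i : ℕ) < j := hij'
      simp [rowCompanion_zero_apply, hij'.ne, show (i : ℕ) ≠ j + 1 by omega]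
  have h2 : (1 - τ • rowCompanion e) = (1 - τ • rowCompanion (0 : Fin n → R)) *
      (1 + Matrix.replicateCol Unit (fun i : Fin n => τ ^ ((i : ℕ) + 1)) *
        Matrix.replicateRow Unit e) := by
    have h3 : (1 - τ • rowCompanion (0 : Fin n → R)) *
        Matrix.replicateCol Unit (fun i : Fin n => τ ^ ((i : ℕ) + 1)) =
        Matrix.replicateCol Unit (fun i : Fin n => if (i : ℕ) = 0 then τ else 0) := by
      ext i x
      rw [Matrix.sub_mul, Matrix.one_mul, Matrix.sub_apply, Matrix.smul_mul, Matrix.smul_apply,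
        Matrix.mul_apply]
      simp only [Matrix.replicateCol_apply, rowCompanion_zero_apply, ite_mul, one_mul, zero_mul]
      obtain ⟨i, hi⟩ := i
      rcases i with _ | i
      · simp
      · rw [Finset.sum_eq_single ⟨i, by omega⟩]
        · simp [pow_succ']
        · rintro ⟨b, hb⟩ - hne
          rw [if_neg]
          intro h
          apply hne
          simp at h
          simp [h]
        · simp
    rw [mul_add, mul_one, ← Matrix.mul_assoc, h3]
    ext i j
    simp only [Matrix.add_apply, Matrix.mul_apply, Matrix.replicateCol_apply, Finset.univ_unique,
      Finset.sum_singleton, Matrix.sub_apply, Matrix.smul_apply, Pi.zero_apply,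
      rowCompanion_apply, smul_eq_mul, Matrix.replicateRow_apply]
    split_ifs <;> ring
  rw [h2, Matrix.det_mul, h1, one_mul, Matrix.det_one_add_replicateCol_mul_replicateRow]
  rfl

theorem rowCompanion_zero_pow (k : ℕ) (i j : Fin n) :
    (rowCompanion (0 : Fin n → R) ^ k) i j = if (i : ℕ) = j + k then 1 else 0 := by
  induction k generalizing i with
  | zero => simp [Matrix.one_apply, Fin.ext_iff]
  | succ k ih =>
    rw [pow_succ', Matrix.mul_apply]
    simp only [rowCompanion_zero_apply, ih, ite_mul,
      one_mul, zero_mul]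
    obtain ⟨i, hi⟩ := i
    rcases i with _ | i
    · simp
    · rw [Finset.sum_eq_single ⟨i, by omega⟩]
      · simp only [← add_assoc, Nat.add_right_cancel_iff, if_true]
      · rintro ⟨b, hb⟩ - hne
        rw [if_neg]
        intro h
        apply hne
        simp at h
        simp [h]
      · simp

theorem rowCompanion_zero_pow_self : rowCompanion (0 : Fin n → R) ^ n = 0 := by
  ext i j
  rw [rowCompanion_zero_pow, if_neg (by omega), Matrix.zero_apply]

theorem exists_rowCompanion_pow_eq {e : Fin n → R⟦X⟧} (he : ∀ i, constantCoeff (e i) = 0) (l : ℕ) :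
    ∃ S : Matrix (Fin n) (Fin n) R⟦X⟧, rowCompanion e ^ (n * l) = (X ^ l : R⟦X⟧) • S := by
  have h1 : (rowCompanion e).map (constantCoeff (R := R)) = rowCompanion 0 := by
    rw [rowCompanion_map]
    congr 1
    exact funext he
  have h2 : (rowCompanion e ^ n).map (constantCoeff (R := R)) = 0 := by
    have := map_pow (RingHom.mapMatrix (m := Fin n) (constantCoeff (R := R))) (rowCompanion e) n
    rw [RingHom.mapMatrix_apply, RingHom.mapMatrix_apply, h1, rowCompanion_zero_pow_self] at this
    exact this
  have h3 : ∀ i j, ∃ s, (rowCompanion e ^ n) i j = X * s := fun i j =>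
    X_dvd_iff.2 (congrFun (congrFun h2 i) j)
  choose s hs using h3
  have h4 : rowCompanion e ^ n = (X : R⟦X⟧) • Matrix.of s := by
    ext1 i j
    simp [hs]
  exact ⟨Matrix.of s ^ l, by rw [pow_mul, h4, smul_pow]⟩

/-- The determinant of `p` evaluated at the companion matrix of `e`. -/
noncomputable def normPoly [Algebra ℚ R] (p : Polynomial ℚ) (e : Fin n → R) : R :=
  (Polynomial.aeval (rowCompanion e) p).det

theorem map_normPoly [Algebra ℚ R] {R' : Type*} [CommRing R'] [Algebra ℚ R'] (φ : R →ₐ[ℚ] R')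
    (p : Polynomial ℚ) (e : Fin n → R) : φ (normPoly p e) = normPoly p (fun i => φ (e i)) := by
  have h : φ.mapMatrix (rowCompanion e) = rowCompanion (fun i => φ (e i)) :=
    rowCompanion_map φ.toRingHom e
  rw [normPoly, normPoly, AlgHom.map_det, ← h, Polynomial.aeval_algHom_apply]

end RowCompanion

section DerivationMatrix

variable {K A : Type*} [CommRing K] [CommRing A] [Algebra K A] {m : Type*} [Fintype m]

theorem Derivation.map_matrix_mul (D : Derivation K A A) (M N : Matrix m m A) :
    (M * N).map D = M.map D * N + M * N.map D := by
  ext i j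
  simp only [Matrix.map_apply, Matrix.mul_apply, Matrix.add_apply, map_sum, D.leibniz, smul_eq_mul,
    ← Finset.sum_add_distrib]
  exact Finset.sum_congr rfl fun k _ => by ring

variable [DecidableEq m]

theorem Derivation.trace_mul_map_pow (D : Derivation K A A) {S T : Matrix m m A}
    (h : Commute S T) (j : ℕ) :
    (S * (T ^ (j + 1)).map D).trace = (j + 1) * (S * T ^ j * T.map D).trace := by
  induction j generalizing S with
  | zero => simp
  | succ j ih =>
    have h2 : (S * (T ^ (j + 1)).map D * T).trace = (S * T * (T ^ (j + 1)).map D).trace := by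
      rw [Matrix.trace_mul_comm, ← mul_assoc, ← h.eq]
    rw [pow_succ T (j + 1), D.map_matrix_mul, mul_add, Matrix.trace_add, ← mul_assoc S, h2,
      ih (h.mul_left (Commute.refl T)), mul_assoc S T, ← pow_succ', ← mul_assoc]
    push_cast
    ring

theorem Derivation.trace_mul_map_aeval (D : Derivation K A A) {S T : Matrix m m A}
    (h : Commute S T) (p : Polynomial K) :
    (S * (Polynomial.aeval T p).map D).trace =
      (S * Polynomial.aeval T p.derivative * T.map D).trace := by
  induction p using Polynomial.induction_on' with
  | add p q hp hq =>
    have : (Polynomial.aeval T p + Polynomial.aeval T q).map D =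
        (Polynomial.aeval T p).map D + (Polynomial.aeval T q).map D := by
      ext; simp
    rw [map_add, this, mul_add, Matrix.trace_add, hp, hq, Polynomial.derivative_add, map_add,
      mul_add, add_mul, Matrix.trace_add]
  | monomial j c =>
    have hc : ∀ M : Matrix m m A, (c • M).map D = c • M.map D := fun M => by ext; simp
    rw [Polynomial.derivative_monomial, Polynomial.aeval_monomial, Polynomial.aeval_monomial,
      ← Algebra.smul_def, ← Algebra.smul_def, hc]
    rcases j with _ | j
    · have h1 : ((1 : Matrix m m A)).map D = 0 := by
        ext i j
        simp only [Matrix.map_apply, Matrix.one_apply, Matrix.zero_apply]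
        split_ifs <;> simp
      simp [h1]
    · rw [Matrix.mul_smul, Matrix.trace_smul, D.trace_mul_map_pow h, Nat.add_sub_cancel,
        Matrix.mul_smul, Matrix.smul_mul, Matrix.trace_smul, mul_smul]
      congr 1
      rw [← Nat.cast_succ, ← nsmul_eq_mul, Nat.cast_smul_eq_nsmul]

end DerivationMatrix

section PolarFamily

variable {A : Type*} [CommRing A] {n : ℕ}

theorem polarFamily_eq_det (e : Fin n → A⟦X⟧) : polarFamily e =
    (1 - C (HahnSeries.single (-1 : ℤ) (1 : A) : LaurentSeries A) •
      (rowCompanion e).map (constEmb A)).det := by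
  rw [rowCompanion_map, det_one_sub_smul_rowCompanion, polarFamily, add_right_inj]
  refine Finset.sum_congr rfl fun i _ => ?_
  rw [← map_pow, HahnSeries.single_pow, one_pow]
  congr 3
  simp

theorem isUnit_polarFamily {e : Fin n → A⟦X⟧} (he : ∀ i, constantCoeff (e i) = 0) :
    IsUnit (polarFamily e) := by
  rw [PowerSeries.isUnit_iff_constantCoeff]
  have : constantCoeff (polarFamily e) = 1 := by
    rw [polarFamily, map_add, map_one, map_sum, Finset.sum_eq_zero, add_zero]
    intro i _
    rw [map_mul, ← coeff_zero_eq_constantCoeff_apply, coeff_map, coeff_zero_eq_constantCoeff_apply,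
      he, map_zero, zero_mul]
  rw [this]
  exact isUnit_one

theorem derivative_constEmb (g : A⟦X⟧) : derivative (LaurentSeries A) (constEmb A g) =
    constEmb A (derivative A g) := by
  ext1 s
  simp only [coeff_derivative, coeff_map, map_mul, map_add, map_natCast, map_one]

theorem X_pow_dvd_rowAt {i : ℤ} {u : (LaurentSeries A)⟦X⟧} {d : ℕ} (h : X ^ d ∣ u) :
    X ^ d ∣ rowAt i u := by
  rw [X_pow_dvd_iff] at h ⊢
  intro s hs
  rw [coeff_rowAt, h s hs]
  rfl

theorem rowAt_neg_one_C_mul (f : LaurentSeries A) (m : ℕ) (g : A⟦X⟧) :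
    rowAt (-1) (C f * (C (HahnSeries.single (-1 : ℤ) (1 : A) : LaurentSeries A) ^ (m + 1) *
      constEmb A g)) = C (f.coeff m) * g := by
  rw [mul_comm, mul_assoc, mul_comm, mul_assoc, rowAt_constEmb_mul, mul_comm]
  congr 1
  rw [← map_pow, ← map_mul]
  ext1 s
  rw [coeff_rowAt, coeff_C, coeff_C]
  split_ifs
  · have h := HahnSeries.coeff_mul_single_add (r := (1 : A)) (x := f) (a := (m : ℤ))
      (b := (m + 1) • (-1 : ℤ))
    rw [show (m : ℤ) + (m + 1) • (-1 : ℤ) = -1 by simp, mul_one] at h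
    rw [HahnSeries.single_pow, one_pow, h]
  · rfl

theorem X_pow_dvd_residue_polarFamily (f : LaurentSeries A) {e : Fin n → A⟦X⟧}
    (he : ∀ i, constantCoeff (e i) = 0) (d : ℕ) :
    X ^ d ∣ -rowAt (-1) (C f * derivative (LaurentSeries A) (polarFamily e) *
      Ring.inverse (polarFamily e)) - ∑ m ∈ Finset.range (n * d), C (f.coeff m) *
        (rowCompanion e ^ m * (rowCompanion e).map (derivative A)).trace := by
  set τ := C (HahnSeries.single (-1 : ℤ) (1 : A) : LaurentSeries A) with hτ
  set T := rowCompanion e with hT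
  set T₁ := T.map (constEmb A) with hT₁
  set u := polarFamily e with hu
  set η : Matrix (Fin n) (Fin n) (LaurentSeries A)⟦X⟧ := 1 - τ • T₁ with hη
  have hdet : u = η.det := polarFamily_eq_det e
  have hinv : Ring.inverse u * u = 1 := Ring.inverse_mul_cancel _ (isUnit_polarFamily he)
  set G := Ring.inverse u • η.adjugate with hG
  have hGη : η * G = 1 := by
    rw [hG, Matrix.mul_smul, Matrix.mul_adjugate, smul_smul, ← hdet, hinv, one_smul]
  have hTd : T₁.map (derivative (LaurentSeries A)) = (T.map (derivative A)).map (constEmb A) := by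
    ext1 i j
    simp only [hT₁, Matrix.map_apply, derivative_constEmb]
  have hηd : η.map (derivative (LaurentSeries A)) =
      -(τ • (T.map (derivative A)).map (constEmb A)) := by
    rw [← hTd]
    ext1 i j
    simp only [hη, Matrix.map_apply, Matrix.sub_apply, Matrix.neg_apply, Matrix.smul_apply,
      smul_eq_mul, map_sub, Derivation.leibniz, hτ, derivative_C, mul_zero, add_zero,
      Matrix.one_apply]
    split_ifs <;> simp
  have hgeom : G = ∑ m ∈ Finset.range (n * d), (τ • T₁) ^ m + (τ • T₁) ^ (n * d) * G := by
    have h := geom_sum_mul_neg (τ • T₁) (n * d)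
    have h2 := congrArg (· * G) h
    simp only [mul_assoc, ← hη, hGη, mul_one, sub_mul, one_mul] at h2
    rw [h2]
    abel
  obtain ⟨S, hS⟩ := exists_rowCompanion_pow_eq he d
  have hT₁d : (τ • T₁) ^ (n * d) = (X ^ d : (LaurentSeries A)⟦X⟧) •
      (τ ^ (n * d) • S.map (constEmb A)) := by
    have h : T₁ ^ (n * d) = (X ^ d : (LaurentSeries A)⟦X⟧) • S.map (constEmb A) := by
      have h1 := map_pow (RingHom.mapMatrix (m := Fin n) (constEmb A)) T (n * d)
      rw [RingHom.mapMatrix_apply, RingHom.mapMatrix_apply, hS] at h1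
      rw [hT₁, ← h1]
      ext1 i j
      simp
    rw [smul_pow, h, smul_comm]
  have hGZ : ∀ Z, G * Z = (∑ m ∈ Finset.range (n * d), (τ • T₁) ^ m + (τ • T₁) ^ (n * d) * G) * Z :=
    fun Z => congrArg (· * Z) hgeom
  have hlog : derivative (LaurentSeries A) u * Ring.inverse u =
      -∑ m ∈ Finset.range (n * d), τ ^ (m + 1) * constEmb A (T ^ m * T.map (derivative A)).trace -
      X ^ d * (τ ^ (n * d) • S.map (constEmb A) * G *
        (τ • (T.map (derivative A)).map (constEmb A))).trace := by
    rw [hdet, Derivation.det_eq_trace, ← hdet, mul_comm, ← smul_eq_mul, ← Matrix.trace_smul,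
      ← Matrix.smul_mul, ← hG, hηd, mul_neg, Matrix.trace_neg, hGZ, add_mul,
      Matrix.trace_add, neg_add, ← sub_eq_add_neg, hT₁d, Matrix.smul_mul, Matrix.smul_mul,
      Matrix.trace_smul, smul_eq_mul, Finset.sum_mul, Matrix.trace_sum]
    congr 2
    refine Finset.sum_congr rfl fun m _ => ?_
    rw [smul_pow, Matrix.smul_mul, Matrix.mul_smul, smul_smul, ← pow_succ, Matrix.trace_smul,
      smul_eq_mul]
    congr 1
    have h1 := map_pow (RingHom.mapMatrix (m := Fin n) (constEmb A)) T m
    rw [RingHom.mapMatrix_apply, RingHom.mapMatrix_apply] at h1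
    rw [← h1, ← Matrix.map_mul, AddMonoidHom.map_trace (constEmb A)]
  rw [mul_assoc, hlog, mul_sub, map_sub, mul_neg, map_neg, Finset.mul_sum, map_sum,
    Finset.sum_congr rfl fun m _ => rowAt_neg_one_C_mul f m _, neg_sub, sub_neg_eq_add,
    add_sub_cancel_right]
  exact X_pow_dvd_rowAt (Dvd.intro _ (mul_left_comm _ _ _))

end PolarFamily

section NormPoly

variable {A : Type*} [CommRing A] [Algebra ℚ A] {n : ℕ}

theorem X_pow_dvd_derivative_trunc_sub {c ρ : ℚ⟦X⟧} (h : derivative ℚ c = ρ * c) (J : ℕ) :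
    (Polynomial.X : Polynomial ℚ) ^ J ∣ (trunc (J + 1) c).derivative -
      trunc J ρ * trunc (J + 1) c := by
  rw [Polynomial.X_pow_dvd_iff]
  intro i hi
  have h1 := congrArg (coeff i) h
  rw [coeff_derivative, coeff_mul] at h1
  rw [Polynomial.coeff_sub, Polynomial.coeff_derivative, coeff_trunc, if_pos (by omega), h1,
    Polynomial.coeff_mul, sub_eq_zero]
  refine Finset.sum_congr rfl fun p hp => ?_
  have := Finset.HasAntidiagonal.mem_antidiagonal.1 hp
  rw [coeff_trunc, coeff_trunc, if_pos (by omega), if_pos (by omega)]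

/-- The constant coefficient as a homomorphism of `ℚ`-algebras. -/
noncomputable def constantCoeffAlgHom (A : Type*) [CommRing A] [Algebra ℚ A] : A⟦X⟧ →ₐ[ℚ] A where
  toRingHom := constantCoeff
  commutes' _ := (congrArg constantCoeff PowerSeries.algebraMap_apply).trans (constantCoeff_C _)

theorem constantCoeff_normPoly {e : Fin n → A⟦X⟧} (he : ∀ i, constantCoeff (e i) = 0)
    {p : Polynomial ℚ} (hp : p.coeff 0 = 1) : constantCoeff (normPoly p e) = 1 := by
  have h : constantCoeff (normPoly p e) = normPoly p (0 : Fin n → A) :=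
    (map_normPoly (constantCoeffAlgHom A) p e).trans (congrArg _ (funext he))
  have hent : ∀ i j : Fin n, Polynomial.aeval (rowCompanion (0 : Fin n → A)) p i j =
      ∑ k ∈ Finset.range (p.natDegree + 1), p.coeff k • if (i : ℕ) = j + k then (1 : A) else 0 := by
    intro i j
    rw [Polynomial.aeval_eq_sum_range, Matrix.sum_apply]
    simp only [Matrix.smul_apply, rowCompanion_zero_pow]
  rw [h, normPoly, Matrix.det_of_isLowerTriangular]
  · refine Finset.prod_eq_one fun i _ => ?_
    rw [hent, Finset.sum_eq_single 0]
    · simp [hp]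
    · intro k _ hk
      rw [if_neg (by omega), smul_zero]
    · simp
  · intro i j hij
    have hij' : (i : ℕ) < j := hij
    rw [hent]
    refine Finset.sum_eq_zero fun k _ => ?_
    rw [if_neg (by omega), smul_zero]

theorem Matrix.commute_adjugate {R ι : Type*} [CommRing R] [Fintype ι] [DecidableEq ι]
    {T η : Matrix ι ι R} (h : Commute T η) (hη : IsUnit η.det) : Commute η.adjugate T := by
  have h1 : η.det • (η.adjugate * T) = η.det • (T * η.adjugate) := by
    calc η.det • (η.adjugate * T) = η.adjugate * T * (η * η.adjugate) := by
          rw [Matrix.mul_adjugate, Matrix.mul_smul, mul_one]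
      _ = η.adjugate * η * T * η.adjugate := by
          rw [mul_assoc η.adjugate T, ← mul_assoc T, h.eq]
          simp only [mul_assoc]
      _ = _ := by
          rw [Matrix.adjugate_mul, Matrix.smul_mul, Matrix.smul_mul, one_mul]
  exact hη.smul_left_cancel.1 h1

theorem normPoly_congr (φ : ℚ⟦X⟧) {e : Fin n → A⟦X⟧} (he : ∀ i, constantCoeff (e i) = 0)
    (b M : ℕ) : X ^ (M + 1) ∣ normPoly (trunc (n * M + 1) (odeSol φ ^ b)) e -
      normSeries (laurentMap (algebraMap ℚ A) (HahnSeries.ofPowerSeries ℤ ℚ φ)) e ^ b := by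
  set c := trunc (n * M + 1) (odeSol φ ^ b) with hc
  rw [normSeries, ← odeSol_natCast_mul]
  have hc0 : c.coeff 0 = 1 := by
    rw [hc, coeff_trunc, if_pos (by omega), coeff_zero_eq_constantCoeff_apply, map_pow,
      constantCoeff_odeSol, one_pow]
  have hcc := constantCoeff_normPoly he hc0
  refine coeff_odeSol_congr hcc ?_
  obtain ⟨ρ, hρ⟩ : (Polynomial.X : Polynomial ℚ) ^ (n * M) ∣ c.derivative -
      trunc (n * M) ((b : ℚ⟦X⟧) * φ) * c :=
    X_pow_dvd_derivative_trunc_sub (by rw [← odeSol_natCast_mul, derivative_odeSol]) _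
  set T := rowCompanion e with hT
  set η := Polynomial.aeval T c with hη
  have hD : normPoly c e = η.det := rfl
  have hunit : IsUnit η.det := by
    rw [← hD, PowerSeries.isUnit_iff_constantCoeff, hcc]
    exact isUnit_one
  have hcomm : Commute T η := by
    have h := congrArg (Polynomial.aeval T) (mul_comm Polynomial.X c)
    rwa [map_mul, map_mul, Polynomial.aeval_X] at h
  have hd : derivative A η.det = (η.adjugate * Polynomial.aeval T c.derivative *
      T.map (derivative A)).trace := by
    rw [Derivation.det_eq_trace]
    exact Derivation.trace_mul_map_aeval ((derivative A).restrictScalars ℚ)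
      (Matrix.commute_adjugate hcomm hunit) c
  obtain ⟨S, hS⟩ := exists_rowCompanion_pow_eq he M
  obtain ⟨w, hw⟩ := X_pow_dvd_residue_polarFamily
    (laurentMap (algebraMap ℚ A) (HahnSeries.ofPowerSeries ℤ ℚ φ)) he M
  rw [sub_eq_iff_eq_add] at hw hρ
  rw [mul_comm _ c] at hρ
  have htr : (Polynomial.aeval T (trunc (n * M) ((b : ℚ⟦X⟧) * φ)) *
      T.map (derivative A)).trace = b * ∑ m ∈ Finset.range (n * M),
      C ((laurentMap (algebraMap ℚ A) (HahnSeries.ofPowerSeries ℤ ℚ φ)).coeff m) *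
        (T ^ m * T.map (derivative A)).trace := by
    rw [trunc_apply, ← Finset.range_eq_Ico, map_sum, Finset.sum_mul, Matrix.trace_sum,
        Finset.mul_sum]
    refine Finset.sum_congr rfl fun m _ => ?_
    rw [Polynomial.aeval_monomial, ← Algebra.smul_def, Matrix.smul_mul, Matrix.trace_smul,
      ← nsmul_eq_mul, map_nsmul, nsmul_eq_mul, laurentMap_coeff, ofPowerSeries_coeff_natCast]
    rw [Algebra.smul_def, ← mul_assoc, PowerSeries.algebraMap_apply]
    simp
  rw [hD, hd, hρ, map_add, map_mul, map_mul, map_pow, Polynomial.aeval_X, hS, hw]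
  refine Dvd.intro ((η.adjugate * (S * Polynomial.aeval T ρ) * T.map (derivative A)).trace -
    b * w * η.det) ?_
  rw [mul_add, add_mul, Matrix.trace_add, ← hη, ← mul_assoc η.adjugate η, Matrix.adjugate_mul,
    Matrix.smul_mul η.det, one_mul, Matrix.smul_mul η.det, Matrix.trace_smul η.det, htr,
    Matrix.smul_mul, Matrix.mul_smul, Matrix.smul_mul, Matrix.trace_smul, smul_eq_mul, smul_eq_mul]
  ring

end NormPoly

section CoeffNorm

/-- The sum of the absolute values of the coefficients of a polynomial. -/
noncomputable def coeffNorm (σ : Type*) : RingSeminorm (MvPolynomial σ ℚ) where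
  toFun p := ∑ d ∈ p.support, |((p.coeff d : ℚ) : ℝ)|
  map_zero' := by simp
  add_le' p q := by
    classical
    have h : ∀ (r : MvPolynomial σ ℚ) (s : Finset (σ →₀ ℕ)), r.support ⊆ s →
        ∑ d ∈ r.support, |((r.coeff d : ℚ) : ℝ)| = ∑ d ∈ s, |((r.coeff d : ℚ) : ℝ)| := fun r s hs =>
      Finset.sum_subset hs fun d _ hd => by simp [MvPolynomial.notMem_support_iff.1 hd]
    rw [h p _ Finset.subset_union_left, h q (p.support ∪ q.support) Finset.subset_union_right,
      h (p + q) _ MvPolynomial.support_add, ← Finset.sum_add_distrib]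
    refine Finset.sum_le_sum fun d _ => ?_
    rw [MvPolynomial.coeff_add, Rat.cast_add]
    exact abs_add_le _ _
  neg' p := by
    rw [MvPolynomial.support_neg]
    simp
  mul_le' p q := by
    classical
    have h : ∀ (r : MvPolynomial σ ℚ) (s : Finset (σ →₀ ℕ)), r.support ⊆ s →
        ∑ d ∈ r.support, |((r.coeff d : ℚ) : ℝ)| = ∑ d ∈ s, |((r.coeff d : ℚ) : ℝ)| := fun r s hs =>
      Finset.sum_subset hs fun d _ hd => by simp [MvPolynomial.notMem_support_iff.1 hd]
    set s := (p.support ×ˢ q.support).image fun x => x.1 + x.2 with hs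
    have hsub : (p * q).support ⊆ s := (MvPolynomial.support_mul p q).trans_eq
      (by rw [hs, Finset.image_add_product])
    rw [h _ _ hsub, Finset.sum_mul_sum, ← Finset.sum_product', ← Finset.sum_fiberwise_of_maps_to
      (g := fun x : (σ →₀ ℕ) × (σ →₀ ℕ) => x.1 + x.2) (t := s)
      (fun x hx => Finset.mem_image_of_mem _ hx)]
    refine Finset.sum_le_sum fun d _ => ?_
    have hc : (p * q).coeff d = ∑ x ∈ p.support ×ˢ q.support with x.1 + x.2 = d,
        p.coeff x.1 * q.coeff x.2 := by
      rw [MvPolynomial.coeff_mul]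
      refine (Finset.sum_subset ?_ ?_).symm
      · intro x hx
        exact Finset.HasAntidiagonal.mem_antidiagonal.2 (Finset.mem_filter.1 hx).2
      · intro x hx hx'
        rw [Finset.mem_filter, Finset.mem_product, not_and'] at hx'
        have := hx' (Finset.HasAntidiagonal.mem_antidiagonal.1 hx)
        rw [not_and_or, MvPolynomial.notMem_support_iff, MvPolynomial.notMem_support_iff] at this
        rcases this with h | h <;> simp [h]
    rw [hc, Rat.cast_sum]
    refine (Finset.abs_sum_le_sum_abs _ _).trans_eq ?_
    exact Finset.sum_congr rfl fun x _ => by rw [Rat.cast_mul, abs_mul]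

variable {σ : Type*}

theorem coeffNorm_apply (p : MvPolynomial σ ℚ) :
    coeffNorm σ p = ∑ d ∈ p.support, |((p.coeff d : ℚ) : ℝ)| := rfl

theorem coeffNorm_monomial (d : σ →₀ ℕ) (q : ℚ) :
    coeffNorm σ (MvPolynomial.monomial d q) = |(q : ℝ)| := by
  classical
  rw [coeffNorm_apply, MvPolynomial.support_monomial]
  split_ifs with h
  · simp [h]
  · simp

theorem coeffNorm_algebraMap (q : ℚ) : coeffNorm σ (algebraMap ℚ _ q) = |(q : ℝ)| :=
  coeffNorm_monomial 0 q

theorem coeffNorm_X (i : σ) : coeffNorm σ (MvPolynomial.X i) = 1 :=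
  (coeffNorm_monomial _ 1).trans (by simp)

theorem coeffNorm_one : coeffNorm σ 1 = 1 :=
  (coeffNorm_monomial 0 1).trans (by simp)

theorem abs_coeff_le_coeffNorm (p : MvPolynomial σ ℚ) (d : σ →₀ ℕ) :
    |((p.coeff d : ℚ) : ℝ)| ≤ coeffNorm σ p := by
  by_cases h : d ∈ p.support
  · exact Finset.single_le_sum (f := fun d => |((p.coeff d : ℚ) : ℝ)|) (fun _ _ => abs_nonneg _) h
  · rw [MvPolynomial.notMem_support_iff.1 h]
    simp

theorem coeffNorm_smul_le (q : ℚ) (p : MvPolynomial σ ℚ) :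
    coeffNorm σ (q • p) ≤ |(q : ℝ)| * coeffNorm σ p := by
  rw [Algebra.smul_def, ← coeffNorm_algebraMap (σ := σ)]
  exact map_mul_le_mul _ _ _

end CoeffNorm

section NormPolyBounds

variable {n : ℕ}

theorem RingSeminorm.map_prod_le_of_one {A : Type*} [CommRing A] (N : RingSeminorm A)
    (h1 : N 1 ≤ 1) {ι : Type*} (s : Finset ι) (g : ι → A) : N (∏ i ∈ s, g i) ≤ ∏ i ∈ s,
        N (g i) := by
  classical
  induction s using Finset.induction_on with
  | empty => simpa using h1
  | insert a s ha ih =>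
    rw [Finset.prod_insert ha, Finset.prod_insert ha]
    exact (map_mul_le_mul N _ _).trans (mul_le_mul_of_nonneg_left ih (apply_nonneg N _))

theorem RingSeminorm.map_det_le {A : Type*} [CommRing A] (N : RingSeminorm A) (h1 : N 1 ≤ 1)
    {M : Matrix (Fin n) (Fin n) A} {B : ℝ} (hM : ∀ i j, N (M i j) ≤ B) :
    N M.det ≤ n.factorial * B ^ n := by
  rw [Matrix.det_apply]
  refine (N.map_sum_le _ _).trans ?_
  have h : ∀ σ : Equiv.Perm (Fin n), N (Equiv.Perm.sign σ • ∏ i, M (σ i) i) ≤ B ^ n := by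
    intro σ
    have h2 : N (Equiv.Perm.sign σ • ∏ i, M (σ i) i) = N (∏ i, M (σ i) i) := by
      rcases Int.units_eq_one_or (Equiv.Perm.sign σ) with h | h <;> simp [h]
    rw [h2]
    refine (N.map_prod_le_of_one h1 _ _).trans ?_
    refine (Finset.prod_le_prod (fun _ _ => apply_nonneg N _) fun i _ => hM _ _).trans_eq ?_
    simp
  refine (Finset.sum_le_sum fun σ _ => h σ).trans_eq ?_
  simp [Fintype.card_perm]

theorem coeffNorm_rowCompanion_pow_le (k : ℕ) (i j : Fin n) :
    coeffNorm (Fin n) ((rowCompanion (MvPolynomial.X : Fin n → MvPolynomial (Fin n) ℚ) ^ k) i j) ≤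
      (2 * n) ^ k := by
  induction k generalizing i with
  | zero =>
    rw [pow_zero, pow_zero, Matrix.one_apply]
    split_ifs
    · exact coeffNorm_one.le
    · simp
  | succ k ih =>
    rw [pow_succ', Matrix.mul_apply]
    refine (RingSeminorm.map_sum_le _ _ _).trans ?_
    have h : ∀ l, coeffNorm (Fin n)
        (rowCompanion (MvPolynomial.X : Fin n → MvPolynomial (Fin n) ℚ) i l *
        (rowCompanion (MvPolynomial.X : Fin n → MvPolynomial (Fin n) ℚ) ^ k) l j) ≤
        2 * (2 * n) ^ k := by
      intro l
      refine (map_mul_le_mul _ _ _).trans (mul_le_mul ?_ (ih l) (apply_nonneg _ _) (by norm_num))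
      rw [rowCompanion_apply]
      refine (map_sub_le_add _ _ _).trans ?_
      have h1 : coeffNorm (Fin n) (if (i : ℕ) = l + 1 then 1 else 0) ≤ 1 := by
        split_ifs
        · exact coeffNorm_one.le
        · simp
      have h2 : coeffNorm (Fin n) (if (i : ℕ) = 0 then MvPolynomial.X l else 0) ≤ 1 := by
        split_ifs
        · exact (coeffNorm_X l).le
        · simp
      linarith
    refine (Finset.sum_le_sum fun l _ => h l).trans_eq ?_
    simp only [Finset.sum_const, Finset.card_univ, Fintype.card_fin, nsmul_eq_mul]
    ring

theorem coeffNorm_normPoly_le {c : ℚ⟦X⟧} {J : ℕ} {B : ℝ} (hn : 0 < n)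
    (hc : ∀ j ≤ J, |((coeff j c : ℚ) : ℝ)| ≤ B) :
    coeffNorm (Fin n) (normPoly (trunc (J + 1) c)
      (MvPolynomial.X : Fin n → MvPolynomial (Fin n) ℚ)) ≤
      n.factorial * ((J + 1) * (B * (2 * n) ^ J)) ^ n := by
  have hB : 0 ≤ B := (abs_nonneg _).trans (hc 0 (Nat.zero_le _))
  refine RingSeminorm.map_det_le _ coeffNorm_one.le fun i j => ?_
  rw [trunc_apply, ← Finset.range_eq_Ico, map_sum, Matrix.sum_apply]
  refine (RingSeminorm.map_sum_le _ _ _).trans ?_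
  refine (Finset.sum_le_sum (g := fun _ => B * (2 * n) ^ J) fun k hk => ?_).trans_eq (by simp)
  have hk' : k ≤ J := Nat.lt_succ_iff.1 (Finset.mem_range.1 hk)
  rw [Polynomial.aeval_monomial, ← Algebra.smul_def, Matrix.smul_apply]
  refine (coeffNorm_smul_le _ _).trans (mul_le_mul (hc k hk') ?_ (apply_nonneg _ _) hB)
  refine (coeffNorm_rowCompanion_pow_le k i j).trans (pow_le_pow_right₀ ?_ hk')
  have : (1 : ℝ) ≤ n := by exact_mod_cast hn
  linarith

theorem smul_normPoly_mem {c : ℚ⟦X⟧} {J : ℕ} {δ : ℚ} (hc : ∀ j ≤ J, ∃ z : ℤ, δ * coeff j c = z) :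
    δ ^ n • normPoly (trunc (J + 1) c) (MvPolynomial.X : Fin n → MvPolynomial (Fin n) ℚ) ∈
      (MvPolynomial.map (σ := Fin n) (Int.castRingHom ℚ)).range := by
  have h : δ ^ n • normPoly (trunc (J + 1) c)
      (MvPolynomial.X : Fin n → MvPolynomial (Fin n) ℚ) =
      (δ • Polynomial.aeval (rowCompanion
        (MvPolynomial.X : Fin n → MvPolynomial (Fin n) ℚ)) (trunc (J + 1) c)).det := by
    have := Matrix.det_smul (Polynomial.aeval (rowCompanion
        (MvPolynomial.X : Fin n → MvPolynomial (Fin n) ℚ)) (trunc (J + 1) c))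
        (algebraMap ℚ (MvPolynomial (Fin n) ℚ) δ)
    rw [Fintype.card_fin, algebraMap_smul, ← map_pow, ← Algebra.smul_def] at this
    exact this.symm
  rw [h]
  have hT : ∀ i j, rowCompanion (MvPolynomial.X : Fin n → MvPolynomial (Fin n) ℚ) i j ∈
      (MvPolynomial.map (σ := Fin n) (Int.castRingHom ℚ)).range := by
    intro i j
    rw [rowCompanion_apply]
    refine sub_mem ?_ ?_
    · split_ifs
      exacts [one_mem _, zero_mem _]
    · split_ifs
      exacts [⟨MvPolynomial.X j, MvPolynomial.map_X _ _⟩, zero_mem _]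
  have hTk : ∀ k i j, (rowCompanion (MvPolynomial.X : Fin n → MvPolynomial (Fin n) ℚ) ^ k) i j ∈
      (MvPolynomial.map (σ := Fin n) (Int.castRingHom ℚ)).range := by
    intro k
    induction k with
    | zero =>
      intro i j
      rw [pow_zero, Matrix.one_apply]
      split_ifs
      exacts [one_mem _, zero_mem _]
    | succ k ih =>
      intro i j
      rw [pow_succ', Matrix.mul_apply]
      exact sum_mem fun l _ => mul_mem (hT _ _) (ih _ _)
  refine Subring.det_mem _ _ fun i j => ?_
  rw [trunc_apply, ← Finset.range_eq_Ico, map_sum, Finset.smul_sum, Matrix.sum_apply]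
  refine sum_mem fun k hk => ?_
  obtain ⟨z, hz⟩ := hc k (Nat.lt_succ_iff.1 (Finset.mem_range.1 hk))
  rw [Polynomial.aeval_monomial, ← Algebra.smul_def, smul_smul, hz, Matrix.smul_apply,
    Int.cast_smul_eq_zsmul]
  exact zsmul_mem (hTk k i j) z

end NormPolyBounds

section Naturality

variable {A A' : Type*} [CommRing A] [CommRing A'] {n : ℕ}

theorem map_polarFamily (ψ : A →+* A') (e : Fin n → A⟦X⟧) :
    PowerSeries.map (laurentMap ψ) (polarFamily e) =
      polarFamily fun i => PowerSeries.map ψ (e i) := by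
  rw [polarFamily, polarFamily, map_add, map_one, map_sum, add_right_inj]
  refine Finset.sum_congr rfl fun i _ => ?_
  rw [map_mul, map_C, laurentMap_single, map_one]
  congr 1
  ext1 s
  simp only [coeff_map]
  rw [HahnSeries.C_apply, laurentMap_single, HahnSeries.C_apply]

theorem map_rowAt (ψ : A →+* A') (i : ℤ) (u : (LaurentSeries A)⟦X⟧) :
    PowerSeries.map ψ (rowAt i u) = rowAt i (PowerSeries.map (laurentMap ψ) u) := by
  ext s
  simp

theorem map_derivative (ψ : A →+* A') (u : A⟦X⟧) :
    PowerSeries.map ψ (derivative A u) = derivative A' (PowerSeries.map ψ u) := by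
  ext s
  simp [coeff_derivative]

theorem map_normSeries [Algebra ℚ A] [Algebra ℚ A'] (ψ : A →ₐ[ℚ] A') (f : LaurentSeries ℚ)
    {e : Fin n → A⟦X⟧} (he : ∀ i, constantCoeff (e i) = 0) :
    PowerSeries.map (ψ : A →+* A') (normSeries (laurentMap (algebraMap ℚ A) f) e) =
      normSeries (laurentMap (algebraMap ℚ A') f)
        fun i => PowerSeries.map (ψ : A →+* A') (e i) := by
  have hf : laurentMap (ψ : A →+* A') (laurentMap (algebraMap ℚ A) f) =
      laurentMap (algebraMap ℚ A') f := by
    ext i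
    simp
  obtain ⟨u, hu⟩ := isUnit_polarFamily he
  rw [normSeries, normSeries, map_odeSol, map_neg, map_rowAt,
    map_mul (PowerSeries.map _), map_mul (PowerSeries.map _), map_C, hf, map_derivative,
        ← map_polarFamily, ← hu, Ring.inverse_unit]
  congr 4
  exact (Ring.inverse_unit (Units.map
    (PowerSeries.map (laurentMap (ψ : A →+* A'))).toMonoidHom u)).symm

/-- Along the family `1 - X t⁻¹` the norm series is the solution of the equation itself. -/
theorem normSeries_single [Algebra ℚ A] [NeZero n] (φ : A⟦X⟧) :
    normSeries (HahnSeries.ofPowerSeries ℤ A φ)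
      (fun i : Fin n => if i = 0 then -X else 0) = odeSol φ := by
  set τ : LaurentSeries A := HahnSeries.single (-1 : ℤ) 1 with hτ
  have hu : polarFamily (fun i : Fin n => if i = 0 then -X else 0) =
      (1 - X * C τ : (LaurentSeries A)⟦X⟧) := by
    rw [polarFamily, Finset.sum_eq_single 0]
    · simp [hτ]
      ring
    · intro i _ hi
      simp [hi]
    · simp
  set g : (LaurentSeries A)⟦X⟧ := PowerSeries.mk fun k => τ ^ k with hg
  have hug : (1 - X * C τ) * g = 1 := by
    ext1 s
    rw [sub_mul, one_mul, mul_assoc, map_sub]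
    cases s with
    | zero => simp [hg]
    | succ s =>
      rw [coeff_succ_X_mul, coeff_C_mul, hg, coeff_mk, coeff_mk, coeff_one, if_neg (by omega),
        pow_succ']
      simp
  have hinv : Ring.inverse (polarFamily (fun i : Fin n => if i = 0 then -X else 0)) = g := by
    rw [hu]
    exact Ring.inverse_unit (Units.mkOfMulEqOne _ _ hug)
  rw [normSeries, hinv, hu]
  congr 1
  ext s
  have hd : derivative (LaurentSeries A) (1 - X * C τ) = -C τ := by
    rw [map_sub, Derivation.map_one_eq_zero, Derivation.leibniz, derivative_C, derivative_X]
    simp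
  rw [hd, map_neg, coeff_rowAt, ← ofPowerSeries_coeff_natCast φ, mul_neg, neg_mul, map_neg,
    HahnSeries.coeff_neg, neg_neg, ← map_mul, coeff_C_mul, hg, coeff_mk, mul_assoc,
    ← pow_succ', hτ, HahnSeries.single_pow, one_pow]
  have := HahnSeries.coeff_mul_single_add (r := (1 : A)) (x := HahnSeries.ofPowerSeries ℤ A φ)
    (a := s) (b := (s + 1) • (-1))
  rw [mul_one] at this
  rw [← this]
  congr 1
  simp

end Naturality

section Relations

variable {A A' : Type*} [CommRing A] [CommRing A'] [Algebra ℚ A] [Algebra ℚ A'] {n D : ℕ}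

/-- A truncation of `relSeries` along the generic family. -/
noncomputable def relPoly (φ : ℚ⟦X⟧) (p : (Fin n → Fin D) × Fin D → ℚ) (J : ℕ) :
    MvPolynomial (Fin n) ℚ :=
  ∑ x, p x • ((∏ i, MvPolynomial.X i ^ (x.1 i : ℕ)) *
    normPoly (trunc (J + 1) (odeSol φ ^ (x.2 : ℕ))) MvPolynomial.X)

/-- A polynomial expression in the parameters of a family and its norm series. -/
noncomputable def relSeries (φ : ℚ⟦X⟧) (p : (Fin n → Fin D) × Fin D → ℚ) (e : Fin n → A⟦X⟧) :
    A⟦X⟧ :=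
  ∑ x, p x • ((∏ i, e i ^ (x.1 i : ℕ)) *
    normSeries (laurentMap (algebraMap ℚ A) (HahnSeries.ofPowerSeries ℤ ℚ φ)) e ^ (x.2 : ℕ))

theorem X_pow_dvd_aeval_relPoly_sub (φ : ℚ⟦X⟧) (p : (Fin n → Fin D) × Fin D → ℚ) {e : Fin n → A⟦X⟧}
    (he : ∀ i, constantCoeff (e i) = 0) (M : ℕ) :
    X ^ (M + 1) ∣ MvPolynomial.aeval e (relPoly φ p (n * M)) - relSeries φ p e := by
  rw [relPoly, relSeries, map_sum, ← Finset.sum_sub_distrib]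
  refine Finset.dvd_sum fun x _ => ?_
  rw [map_smul, map_mul, map_normPoly, map_prod, ← smul_sub]
  simp only [map_pow, MvPolynomial.aeval_X]
  rw [← mul_sub, Algebra.smul_def]
  exact Dvd.dvd.mul_left (Dvd.dvd.mul_left (normPoly_congr φ he _ M) _) _

theorem map_relSeries (φ : ℚ⟦X⟧) (p : (Fin n → Fin D) × Fin D → ℚ) (ψ : A →ₐ[ℚ] A')
    {e : Fin n → A⟦X⟧} (he : ∀ i, constantCoeff (e i) = 0) :
    PowerSeries.map (ψ : A →+* A') (relSeries φ p e) =
      relSeries φ p fun i => PowerSeries.map (ψ : A →+* A') (e i) := by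
  have hs : ∀ (q : ℚ) (g : A⟦X⟧), PowerSeries.map (ψ : A →+* A') (q • g) =
      q • PowerSeries.map (ψ : A →+* A') g := by
    intro q g
    ext s
    simp
  rw [relSeries, relSeries, map_sum]
  refine Finset.sum_congr rfl fun x _ => ?_
  rw [hs, map_mul, map_prod, map_pow, map_normSeries ψ _ he]
  simp only [map_pow]

/-- If the relation vanishes on the generic line, the solution is algebraic. -/
theorem exists_polynomial_of_relSeries_eq_zero [NeZero n] {φ : ℚ⟦X⟧}
    {p : (Fin n → Fin D) × Fin D → ℚ} (hp : p ≠ 0)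
    (h : relSeries φ p (fun i => X * C (MvPolynomial.X i : MvPolynomial (Fin n) ℚ)) = 0) :
    ∃ P : Polynomial (Polynomial ℚ), P ≠ 0 ∧
      P.eval₂ Polynomial.coeToPowerSeries.ringHom (odeSol φ) = 0 := by
  classical
  -- the specialisation `ξ₀ = -1`, `ξ_i = s ^ (D ^ i)`
  set w : (Fin n → Fin D) → ℕ := fun β => ∑ i, if i = 0 then 0 else (β i : ℕ) * D ^ (i : ℕ) with hw
  have hwinj : ∀ β β', w β = w β' → β 0 = β' 0 → β = β' := by
    intro β β' h h0
    apply finFunctionFinEquiv.injective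
    apply Fin.ext
    rw [finFunctionFinEquiv_apply, finFunctionFinEquiv_apply,
      ← Finset.add_sum_erase _ _ (Finset.mem_univ (0 : Fin n)),
      ← Finset.add_sum_erase _ (fun i => (β' i : ℕ) * D ^ (i : ℕ)) (Finset.mem_univ (0 : Fin n)),
          h0]
    congr 1
    have hsum : ∀ β : Fin n → Fin D, w β = ∑ i ∈ Finset.univ.erase 0, (β i : ℕ) * D ^ (i : ℕ) := by
      intro β
      rw [hw]
      simp only
      rw [← Finset.add_sum_erase _ _ (Finset.mem_univ (0 : Fin n)), if_pos rfl, zero_add]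
      exact Finset.sum_congr rfl fun i hi => if_neg (Finset.ne_of_mem_erase hi)
    rw [← hsum, ← hsum, h]
  have hwinj' : ∀ β β' : Fin n → Fin D, w β = w β' →
      ∑ i, (β i : ℕ) = ∑ i, (β' i : ℕ) → β = β' := by
    intro β β' h hsum
    have h1 : β = Function.update β' 0 (β 0) := by
      refine hwinj _ _ (h.trans ?_) (by simp)
      rw [hw]
      refine Finset.sum_congr rfl fun i _ => ?_
      split_ifs with hi
      · rfl
      · rw [Function.update_of_ne hi]
    refine hwinj _ _ h (Fin.ext ?_)
    rw [← Finset.add_sum_erase _ _ (Finset.mem_univ (0 : Fin n)),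
      ← Finset.add_sum_erase _ (fun i => (β' i : ℕ)) (Finset.mem_univ (0 : Fin n))] at hsum
    have h2 : ∑ i ∈ Finset.univ.erase 0, (β i : ℕ) = ∑ i ∈ Finset.univ.erase 0, (β' i : ℕ) := by
      refine Finset.sum_congr rfl fun i hi => ?_
      rw [h1, Function.update_of_ne (Finset.ne_of_mem_erase hi)]
    omega
  set a : Fin n → Polynomial ℚ := fun i => if i = 0 then -1 else Polynomial.X ^ D ^ (i : ℕ) with ha
  set η := normSeries (laurentMap (algebraMap ℚ (Polynomial ℚ)) (HahnSeries.ofPowerSeries ℤ ℚ φ))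
    (fun i => X * C (a i)) with hη
  have h1 : relSeries φ p (fun i => X * C (a i)) = 0 := by
    have := map_relSeries φ p (MvPolynomial.aeval a) (A' := Polynomial ℚ)
      (e := fun i => X * C (MvPolynomial.X i : MvPolynomial (Fin n) ℚ)) (by simp)
    rw [h, map_zero] at this
    rw [this]
    congr 1
    ext1 i
    rw [map_mul, map_X, map_C]
    simp
  have hprod : ∀ β : Fin n → Fin D, ∏ i, (X * C (a i)) ^ (β i : ℕ) =
      (-1) ^ (β 0 : ℕ) * X ^ (∑ i, (β i : ℕ)) * (C (Polynomial.X : Polynomial ℚ)) ^ w β := by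
    intro β
    have : ∀ i, (X * C (a i)) ^ (β i : ℕ) = X ^ (β i : ℕ) *
        ((if i = 0 then (-1) ^ (β 0 : ℕ) else 1) *
        (C (Polynomial.X : Polynomial ℚ)) ^ (if i = 0 then 0 else (β i : ℕ) * D ^ (i : ℕ))) := by
      intro i
      rw [mul_pow, ha]
      split_ifs with hi
      · simp [hi]
      · simp only [if_neg hi, one_mul]
        rw [map_pow, ← pow_mul, mul_comm (D ^ _)]
    simp only [this]
    rw [Finset.prod_mul_distrib, Finset.prod_mul_distrib, Finset.prod_pow_eq_pow_sum,
      Finset.prod_pow_eq_pow_sum, Finset.prod_ite_eq' Finset.univ (0 : Fin n),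
          if_pos (Finset.mem_univ _)]
    ring
  obtain ⟨x₀, hx₀⟩ : ∃ x, p x ≠ 0 := Function.ne_iff.1 hp
  obtain ⟨x₁, hx₁, hmin⟩ := Finset.exists_min_image (Finset.univ.filter fun x => p x ≠ 0)
    (fun x => w x.1) ⟨x₀, by simp [hx₀]⟩
  rw [Finset.mem_filter] at hx₁
  set W := w x₁.1 with hW
  have h2 : ∑ x, p x • ((-1) ^ (x.1 0 : ℕ) * X ^ (∑ i, (x.1 i : ℕ)) *
      (C (Polynomial.X : Polynomial ℚ)) ^ (w x.1 - W) * η ^ (x.2 : ℕ)) = 0 := by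
    have hC : (C (Polynomial.X : Polynomial ℚ) : (Polynomial ℚ)⟦X⟧) ^ W ≠ 0 :=
      pow_ne_zero _ fun h => Polynomial.X_ne_zero (C_injective (h.trans (map_zero C).symm))
    apply (mul_eq_zero.1 _).resolve_left hC
    rw [← h1, relSeries, Finset.mul_sum]
    refine Finset.sum_congr rfl fun x _ => ?_
    by_cases hx : p x = 0
    · simp [hx]
    · rw [hprod, mul_smul_comm]
      congr 1
      have := hmin x (by simp [hx])
      rw [← Nat.add_sub_cancel' this, Nat.add_sub_cancel_left, pow_add]
      ring
  have hev := congrArg (PowerSeries.map (Polynomial.aeval (R := ℚ) (0 : ℚ) : Polynomial ℚ →+* ℚ)) h2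
  have hη0 : PowerSeries.map (Polynomial.aeval (R := ℚ) (0 : ℚ) : Polynomial ℚ →+* ℚ) η =
      odeSol φ := by
    rw [hη, map_normSeries _ _ (by simp), ← normSeries_single (n := n)]
    congr 1
    ext1 i
    rw [map_mul, map_X, map_C, ha]
    simp only
    split_ifs with hi
    · simp
    · have hD : D ≠ 0 := by
        rintro rfl
        exact (x₀.2).elim0
      simp [hD]
  have hs : ∀ (q : ℚ) (g : (Polynomial ℚ)⟦X⟧),
      PowerSeries.map (Polynomial.aeval (R := ℚ) (0 : ℚ) : Polynomial ℚ →+* ℚ) (q • g) =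
      q • PowerSeries.map (Polynomial.aeval (R := ℚ) (0 : ℚ) : Polynomial ℚ →+* ℚ) g := by
    intro q g
    ext s
    simp
  rw [map_sum, map_zero] at hev
  simp only [hs, map_mul, map_pow, map_neg, map_one, hη0, map_X, map_C] at hev
  set T := Finset.univ.filter fun x : (Fin n → Fin D) × Fin D => p x ≠ 0 ∧ w x.1 = W with hT
  refine ⟨∑ x ∈ T, Polynomial.monomial (x.2 : ℕ) (Polynomial.monomial (∑ i, (x.1 i : ℕ))
    (p x * (-1) ^ (x.1 0 : ℕ))), fun h0 => ?_, ?_⟩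
  · have hc := congrArg (fun P : Polynomial (Polynomial ℚ) =>
      (P.coeff (x₁.2 : ℕ)).coeff (∑ i, (x₁.1 i : ℕ))) h0
    simp only [Polynomial.finsetSum_coeff, Polynomial.coeff_zero] at hc
    rw [Finset.sum_eq_single x₁] at hc
    · simp [hx₁.2] at hc
    · intro x hx hne
      rw [Polynomial.coeff_monomial]
      split_ifs with hb
      · rw [Polynomial.coeff_monomial, if_neg]
        intro hsum
        rw [hT, Finset.mem_filter] at hx
        exact hne (Prod.ext (hwinj' _ _ hx.2.2 hsum) (Fin.ext hb))
      · simp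
    · intro h
      exact absurd (by simp [hT, hx₁.2, hW]) h
  · rw [Polynomial.eval₂_finsetSum, ← hev]
    symm
    rw [← Finset.sum_subset (Finset.subset_univ T)]
    · refine Finset.sum_congr rfl fun x hx => ?_
      rw [hT, Finset.mem_filter] at hx
      rw [Polynomial.eval₂_monomial, hx.2.2, Nat.sub_self, pow_zero, mul_one, ← smul_mul_assoc]
      congr 1
      rw [Polynomial.coeToPowerSeries.ringHom_apply, Polynomial.coe_monomial,
        monomial_eq_C_mul_X_pow, map_mul, smul_eq_C_mul, mul_assoc]
      simp
    · intro x _ hx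
      rw [hT, Finset.mem_filter, not_and, not_and] at hx
      by_cases hpx : p x = 0
      · rw [hpx, zero_smul]
      · have h3 := hmin x (by simp [hpx])
        have h4 := hx (Finset.mem_univ _) hpx
        rw [AlgHom.coe_toRingHom, Polynomial.aeval_X, map_zero, zero_pow (by omega)]
        simp

end Relations

section LeadingForm

variable {A : Type*} [CommRing A] [Algebra ℚ A] {n D : ℕ}

theorem MvPolynomial.IsHomogeneous.aeval_mul {R : Type*} [CommRing R] [Algebra ℚ R]
    {F : MvPolynomial (Fin n) ℚ} {m : ℕ} (hF : F.IsHomogeneous m) (x : R) (e : Fin n → R) :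
    MvPolynomial.aeval (fun i => x * e i) F = x ^ m * MvPolynomial.aeval e F := by
  rw [MvPolynomial.aeval_def, MvPolynomial.aeval_def, MvPolynomial.eval₂_eq',
    MvPolynomial.eval₂_eq', Finset.mul_sum]
  refine Finset.sum_congr rfl fun d hd => ?_
  have h := hF (MvPolynomial.mem_support_iff.1 hd)
  replace h : ∑ i, d i = m := by
    rw [← h, ← Finsupp.degree_eq_sum, Finsupp.degree_eq_weight_one]
    rfl
  simp only [mul_pow]
  rw [Finset.prod_mul_distrib, Finset.prod_pow_eq_pow_sum, h]
  ring

theorem coeff_aeval_X_mul (F : MvPolynomial (Fin n) ℚ) (e : Fin n → A⟦X⟧) {M : ℕ}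
    (hF : ∀ m < M, F.homogeneousComponent m = 0) :
    coeff M (MvPolynomial.aeval (fun i => X * e i) F) =
      MvPolynomial.aeval (fun i => constantCoeff (e i)) (F.homogeneousComponent M) := by
  have h1 : coeff M (MvPolynomial.aeval (fun i => X * e i) F) =
      ∑ m ∈ Finset.range (F.totalDegree + 1),
      coeff M (X ^ m * MvPolynomial.aeval e (F.homogeneousComponent m)) := by
    conv_lhs => rw [← MvPolynomial.sum_homogeneousComponent F]
    rw [map_sum, map_sum]
    exact Finset.sum_congr rfl fun m _ => by
      rw [(MvPolynomial.homogeneousComponent_isHomogeneous m F).aeval_mul]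
  have h2 : coeff M (X ^ M * MvPolynomial.aeval e (F.homogeneousComponent M)) =
      MvPolynomial.aeval (fun i => constantCoeff (e i)) (F.homogeneousComponent M) := by
    rw [coeff_X_pow_mul', if_pos le_rfl, Nat.sub_self, coeff_zero_eq_constantCoeff_apply]
    exact (DFunLike.congr_fun (MvPolynomial.comp_aeval e (constantCoeffAlgHom A)) _)
  rw [h1, ← h2]
  apply Finset.sum_eq_single
  · intro m _ hm
    rcases lt_or_gt_of_ne hm with h | h
    · rw [hF m h, map_zero, mul_zero, map_zero]
    · rw [coeff_X_pow_mul', if_neg (by omega)]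
  · intro h
    rw [Finset.mem_range, not_lt] at h
    rw [MvPolynomial.homogeneousComponent_eq_zero M F (by omega), map_zero, mul_zero, map_zero]

theorem coeff_aeval_X_mul_C (F : MvPolynomial (Fin n) ℚ) (M : ℕ) :
    coeff M (MvPolynomial.aeval (fun i => X * C (MvPolynomial.X i : MvPolynomial (Fin n) ℚ)) F) =
      F.homogeneousComponent M := by
  conv_lhs => rw [← MvPolynomial.sum_homogeneousComponent F]
  rw [map_sum, map_sum]
  have h2 : ∀ H : MvPolynomial (Fin n) ℚ, MvPolynomial.aeval
      (fun i => C (MvPolynomial.X i : MvPolynomial (Fin n) ℚ)) H = C H := by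
    intro H
    induction H using MvPolynomial.induction_on with
    | C q =>
      rw [← MvPolynomial.algebraMap_eq, AlgHom.commutes, PowerSeries.algebraMap_apply]
    | add p q hp hq => rw [map_add, map_add, hp, hq]
    | mul_X p i hp => rw [map_mul, map_mul, hp, MvPolynomial.aeval_X]
  have h3 : ∀ m, coeff M (MvPolynomial.aeval
      (fun i => X * C (MvPolynomial.X i : MvPolynomial (Fin n) ℚ)) (F.homogeneousComponent m)) =
      if M = m then F.homogeneousComponent m else 0 := by
    intro m
    rw [(MvPolynomial.homogeneousComponent_isHomogeneous m F).aeval_mul, h2, mul_comm, coeff_C_mul,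
      coeff_X_pow]
    simp
  simp only [h3]
  rw [Finset.sum_ite_eq]
  split_ifs with h
  · rfl
  · rw [Finset.mem_range, not_lt] at h
    rw [MvPolynomial.homogeneousComponent_eq_zero M F (by omega)]

/-- The relation along the generic line. -/
noncomputable def genericRel (φ : ℚ⟦X⟧) (p : (Fin n → Fin D) × Fin D → ℚ) :
    (MvPolynomial (Fin n) ℚ)⟦X⟧ :=
  relSeries φ p fun i => X * C (MvPolynomial.X i : MvPolynomial (Fin n) ℚ)

theorem coeff_genericRel (φ : ℚ⟦X⟧) (p : (Fin n → Fin D) × Fin D → ℚ) {m M : ℕ} (hm : m ≤ M) :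
    coeff m (genericRel φ p) = (relPoly φ p (n * M)).homogeneousComponent m := by
  have h := X_pow_dvd_aeval_relPoly_sub φ p (A := MvPolynomial (Fin n) ℚ)
    (e := fun i => X * C (MvPolynomial.X i : MvPolynomial (Fin n) ℚ)) (by simp) M
  rw [← coeff_aeval_X_mul_C, genericRel, coeff_eq_of_dvd_sub h (by omega)]

theorem coeff_relSeries (φ : ℚ⟦X⟧) (p : (Fin n → Fin D) × Fin D → ℚ) {M : ℕ}
    (hM : ∀ m < M, coeff m (genericRel φ p) = 0) {e : Fin n → (MvPolynomial (Fin n) ℚ)⟦X⟧}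
    (he : ∀ i, constantCoeff (e i) = 0) {c : MvPolynomial (Fin n) ℚ}
    (he' : ∀ i, coeff 1 (e i) = c * MvPolynomial.X i) :
    coeff M (relSeries φ p e) = c ^ M * coeff M (genericRel φ p) := by
  have h := X_pow_dvd_aeval_relPoly_sub φ p he M
  rw [← coeff_eq_of_dvd_sub h (by omega)]
  choose e' he'' using fun i => X_dvd_iff.2 (he i)
  have h1 : e = fun i => X * e' i := funext he''
  have h2 : ∀ i, constantCoeff (e' i) = c * MvPolynomial.X i := by
    intro i
    rw [← he', he'', ← coeff_zero_eq_constantCoeff_apply, ← coeff_succ_X_mul]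
  rw [h1, coeff_aeval_X_mul _ _ fun m hm => by rw [← coeff_genericRel φ p hm.le, hM m hm],
    coeff_genericRel φ p le_rfl]
  simp only [h2]
  rw [(MvPolynomial.homogeneousComponent_isHomogeneous M _).aeval_mul,
      MvPolynomial.aeval_X_left_apply]

end LeadingForm

section Siegel

theorem exists_int_vec_of_two_mul_card_le {α β : Type*} [Fintype α] [Fintype β]
    (h0 : 0 < Fintype.card α) (h : 2 * Fintype.card α ≤ Fintype.card β) (A : Matrix α β ℤ) {B : ℝ}
    (hB : 1 ≤ B) (hA : ∀ i j, |((A i j : ℤ) : ℝ)| ≤ B) :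
    ∃ t : β → ℤ, t ≠ 0 ∧ A.mulVec t = 0 ∧ ∀ j, |((t j : ℤ) : ℝ)| ≤ Fintype.card β * B := by
  classical
  let _ := Matrix.seminormedAddCommGroup (m := α) (n := β) (α := ℤ)
  obtain ⟨t, ht0, ht, hle⟩ := Int.Matrix.exists_ne_zero_int_vec_norm_le A (by omega) h0
  refine ⟨t, ht0, ht, fun j => ?_⟩
  have hn : (1 : ℝ) ≤ Fintype.card β := by exact_mod_cast (show 1 ≤ Fintype.card β by omega)
  have hbase : (1 : ℝ) ≤ Fintype.card β * max 1 ‖A‖ :=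
    one_le_mul_of_one_le_of_one_le hn (le_max_left _ _)
  have h2 : (2 : ℝ) * Fintype.card α ≤ Fintype.card β := by exact_mod_cast h
  have hα : (0 : ℝ) < Fintype.card α := by exact_mod_cast h0
  have hexp : (Fintype.card α : ℝ) / (Fintype.card β - Fintype.card α) ≤ 1 := by
    rw [div_le_one (by linarith)]
    linarith
  have h3 : ‖t j‖ ≤ Fintype.card β * max 1 ‖A‖ :=
    (norm_le_pi_norm t j).trans (hle.trans ((Real.rpow_le_rpow_of_exponent_le hbase hexp).trans_eq
      (Real.rpow_one _)))
  rw [Int.norm_eq_abs] at h3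
  refine h3.trans (mul_le_mul_of_nonneg_left (max_le hB ?_) (by positivity))
  refine (Matrix.norm_le_iff (by linarith)).2 fun i j => ?_
  rw [Int.norm_eq_abs]
  exact hA i j

/-- Bounds for the coefficients of the powers of a power series, and for their denominators. -/
structure DenominatorBound (y : ℚ⟦X⟧) (C : ℝ) (δ : ℕ → ℕ) : Prop where
  one_le : 1 ≤ C
  pos : ∀ J, 0 < δ J
  le : ∀ J, (δ J : ℝ) ≤ C ^ (J + 1)
  exists_int : ∀ J b, ∀ j ≤ J, ∃ z : ℤ, (δ J : ℚ) * coeff j (y ^ b) = z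
  abs_le : ∀ b j, |((coeff j (y ^ b) : ℚ) : ℝ)| ≤ C ^ (b + j + 1)

variable {n D : ℕ}

theorem smul_relPoly_mem {φ : ℚ⟦X⟧} {C : ℝ} {δ : ℕ → ℕ} (hδ : DenominatorBound (odeSol φ) C δ)
    (x : (Fin n → Fin D) × Fin D) (J : ℕ) :
    (δ J : ℚ) ^ n • ((∏ i, MvPolynomial.X i ^ (x.1 i : ℕ)) *
    normPoly (trunc (J + 1) (odeSol φ ^ (x.2 : ℕ))) MvPolynomial.X) ∈
      (MvPolynomial.map (σ := Fin n) (Int.castRingHom ℚ)).range := by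
  rw [← mul_smul_comm]
  have hX : ∀ i, MvPolynomial.X i ∈ (MvPolynomial.map (σ := Fin n) (Int.castRingHom ℚ)).range :=
    fun i => ⟨MvPolynomial.X i, MvPolynomial.map_X _ _⟩
  refine mul_mem (prod_mem fun i _ => pow_mem (hX i) _) ?_
  exact smul_normPoly_mem fun j hj => hδ.exists_int J _ j hj

theorem DenominatorBound.one_le_coeffNorm {φ : ℚ⟦X⟧} {C : ℝ} {δ : ℕ → ℕ}
    (hδ : DenominatorBound (odeSol φ) C δ) (p : (Fin n → Fin D) × Fin D → ℤ) {M : ℕ}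
    (h : coeff M (genericRel φ fun x => (p x : ℚ)) ≠ 0) :
    1 ≤ (δ (n * M) : ℝ) ^ n * coeffNorm (Fin n) (coeff M (genericRel φ fun x => (p x : ℚ))) := by
  have hmem : (δ (n * M) : ℚ) ^ n • relPoly φ (fun x => (p x : ℚ)) (n * M) ∈
      (MvPolynomial.map (σ := Fin n) (Int.castRingHom ℚ)).range := by
    rw [relPoly, Finset.smul_sum]
    refine sum_mem fun x _ => ?_
    rw [smul_comm, Int.cast_smul_eq_zsmul]
    exact zsmul_mem (smul_relPoly_mem hδ x _) _
  obtain ⟨P, hP⟩ := hmem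
  obtain ⟨d, hd⟩ := MvPolynomial.ne_zero_iff.1 h
  rw [coeff_genericRel φ _ le_rfl, MvPolynomial.coeff_homogeneousComponent] at hd
  split_ifs at hd with hdM
  swap
  · exact absurd rfl hd
  have hz : ((P.coeff d : ℤ) : ℚ) = (δ (n * M) : ℚ) ^ n *
      (relPoly φ (fun x => (p x : ℚ)) (n * M)).coeff d := by
    have := congrArg (MvPolynomial.coeff d) hP
    rwa [MvPolynomial.coeff_map, MvPolynomial.coeff_smul] at this
  have hδ0 : (δ (n * M) : ℚ) ^ n ≠ 0 := pow_ne_zero _ (by exact_mod_cast (hδ.pos _).ne')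
  have hP0 : P.coeff d ≠ 0 := by
    intro h0
    rw [h0, Int.cast_zero, eq_comm, mul_eq_zero] at hz
    exact hz.elim hδ0 hd
  have h1 : (1 : ℝ) ≤ |(((P.coeff d : ℤ) : ℚ) : ℝ)| := by
    have := Int.one_le_abs hP0
    rw [Rat.cast_intCast]
    exact_mod_cast this
  refine h1.trans ?_
  rw [hz, Rat.cast_mul, abs_mul]
  have h2 : |(((δ (n * M) : ℚ) ^ n : ℚ) : ℝ)| = (δ (n * M) : ℝ) ^ n := by
    push_cast
    exact abs_of_nonneg (by positivity)
  rw [h2]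
  refine mul_le_mul_of_nonneg_left ?_ (by positivity)
  rw [coeff_genericRel φ _ le_rfl]
  refine le_trans (le_of_eq ?_) (abs_coeff_le_coeffNorm _ d)
  rw [MvPolynomial.coeff_homogeneousComponent, if_pos hdM]

theorem DenominatorBound.exists_relation {φ : ℚ⟦X⟧} {C : ℝ} {δ : ℕ → ℕ}
    (hδ : DenominatorBound (odeSol φ) C δ) (hn : 0 < n) : ∃ C₁ : ℝ, 1 ≤ C₁ ∧ ∀ K : ℕ, 0 < K →
      ∃ p : (Fin n → Fin (2 * K ^ n)) × Fin (2 * K ^ n) → ℤ, p ≠ 0 ∧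
        (∀ x, |((p x : ℤ) : ℝ)| ≤ C₁ ^ K ^ (n + 1)) ∧
        ∀ m < K ^ (n + 1), coeff m (genericRel φ fun x => (p x : ℚ)) = 0 := by
  classical
  have hC := hδ.one_le
  have hn1 : (1 : ℝ) ≤ n := by exact_mod_cast hn
  refine ⟨4 ^ (n + 1) * (C ^ (n * (n + 1)) * (n.factorial *
    (2 ^ (n + 1) * (C ^ (n + 3) * (2 * n) ^ n)) ^ n)), ?_, fun K hK => ?_⟩
  · have h1 : (1 : ℝ) ≤ n.factorial := by exact_mod_cast n.factorial_pos
    refine one_le_mul_of_one_le_of_one_le (one_le_pow₀ (by norm_num))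
      (one_le_mul_of_one_le_of_one_le (one_le_pow₀ hC) (one_le_mul_of_one_le_of_one_le h1
      (one_le_pow₀ (one_le_mul_of_one_le_of_one_le (one_le_pow₀ (by norm_num))
      (one_le_mul_of_one_le_of_one_le (one_le_pow₀ hC) (one_le_pow₀ ?_))))))
    linarith
  set D := 2 * K ^ n with hD
  set M := K ^ (n + 1) with hM
  have hM0 : 1 ≤ M := Nat.one_le_pow _ _ hK
  have hDM : D ≤ 2 * M := Nat.mul_le_mul_left 2 (Nat.pow_le_pow_right hK (Nat.le_succ n))
  choose P hP using fun x : (Fin n → Fin D) × Fin D => smul_relPoly_mem hδ x (n * M)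
  set B : ℝ := C ^ (n * (n * M + 1)) * (n.factorial *
    ((n * M + 1) * (C ^ ((n + 2) * M + 1) * (2 * n) ^ (n * M))) ^ n) with hB
  have hbound : ∀ x d, |(((P x).coeff d : ℤ) : ℝ)| ≤ B := by
    intro x d
    have h1 : (((P x).coeff d : ℤ) : ℚ) =
        MvPolynomial.coeff d ((δ (n * M) : ℚ) ^ n • ((∏ i, MvPolynomial.X i ^ (x.1 i : ℕ)) *
          normPoly (trunc (n * M + 1) (odeSol φ ^ (x.2 : ℕ))) MvPolynomial.X)) := by
      rw [← hP x, MvPolynomial.coeff_map]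
      rfl
    have h2 : |(((P x).coeff d : ℤ) : ℝ)| = |((((P x).coeff d : ℤ) : ℚ) : ℝ)| := by
      rw [Rat.cast_intCast]
    rw [h2, h1]
    refine (abs_coeff_le_coeffNorm _ d).trans ((coeffNorm_smul_le _ _).trans ?_)
    refine mul_le_mul ?_ ?_ (apply_nonneg _ _) (by positivity)
    · push_cast
      rw [abs_of_nonneg (by positivity), mul_comm n (n * M + 1), pow_mul]
      exact pow_le_pow_left₀ (by positivity) (hδ.le _) n
    · refine (map_mul_le_mul _ _ _).trans ?_
      have h3 : coeffNorm (Fin n) (∏ i, MvPolynomial.X i ^ (x.1 i : ℕ)) ≤ 1 := by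
        refine ((coeffNorm (Fin n)).map_prod_le_of_one coeffNorm_one.le _ _).trans ?_
        refine Finset.prod_le_one (fun _ _ => apply_nonneg _ _) fun i _ => ?_
        rw [MvPolynomial.X_pow_eq_monomial, coeffNorm_monomial]
        simp
      refine (mul_le_of_le_one_left (apply_nonneg _ _) h3).trans ?_
      refine (coeffNorm_normPoly_le (B := C ^ ((n + 2) * M + 1)) hn fun j hj => ?_).trans_eq ?_
      · refine (hδ.abs_le _ _).trans (pow_le_pow_right₀ hC ?_)
        have := x.2.2
        nlinarith
      · push_cast
        rfl
  have hB1 : 1 ≤ B := by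
    have h1 : (1 : ℝ) ≤ n.factorial := by exact_mod_cast n.factorial_pos
    have h2 : (1 : ℝ) ≤ n * M + 1 := by
      have : (0 : ℝ) ≤ n * M := by positivity
      linarith
    have h3 : (1 : ℝ) ≤ 2 * n := by linarith
    exact one_le_mul_of_one_le_of_one_le (one_le_pow₀ hC) (one_le_mul_of_one_le_of_one_le h1
      (one_le_pow₀ (one_le_mul_of_one_le_of_one_le h2 (one_le_mul_of_one_le_of_one_le
      (one_le_pow₀ hC) (one_le_pow₀ h3)))))
  have hcard : 2 * Fintype.card (Fin n → Fin M) ≤ Fintype.card ((Fin n → Fin D) × Fin D) := by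
    simp only [Fintype.card_fun, Fintype.card_fin, Fintype.card_prod]
    rw [hD, hM, ← pow_succ, mul_pow, ← pow_mul, ← pow_mul, mul_comm n (n + 1)]
    refine Nat.mul_le_mul_right _ ?_
    calc 2 = 2 ^ 1 := rfl
      _ ≤ 2 ^ (n + 1) := Nat.pow_le_pow_right (by norm_num) (by omega)
  obtain ⟨p, hp0, hp, hple⟩ := exists_int_vec_of_two_mul_card_le (α := Fin n → Fin M)
    (β := (Fin n → Fin D) × Fin D) (by simp [hM, hK]) hcard
    (Matrix.of fun d x => (P x).coeff (Finsupp.equivFunOnFinite.symm fun i => (d i : ℕ))) hB1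
    (fun d x => hbound x _)
  · refine ⟨p, hp0, fun x => (hple x).trans ?_, fun m hm => ?_⟩
    · have h1 : ((Fintype.card ((Fin n → Fin D) × Fin D) : ℕ) : ℝ) ≤ (4 ^ (n + 1)) ^ M := by
        simp only [Fintype.card_fun, Fintype.card_fin, Fintype.card_prod]
        rw [← pow_succ, ← pow_mul, mul_comm (n + 1), pow_mul]
        push_cast
        refine pow_le_pow_left₀ (by positivity) ?_ _
        have h2 : D ≤ 4 ^ M := by
          have h3 : M < 2 ^ M := Nat.lt_two_pow_self
          have h4 : 2 ^ 1 ≤ 2 ^ M := Nat.pow_le_pow_right (by norm_num) hM0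
          calc D ≤ 2 * M := hDM
            _ ≤ 2 ^ M * 2 ^ M := Nat.mul_le_mul (by simpa using h4) h3.le
            _ = 4 ^ M := by rw [← mul_pow]; norm_num
        exact_mod_cast h2
      have h2 : (n.factorial : ℝ) ≤ n.factorial ^ M :=
        le_self_pow₀ (by exact_mod_cast n.factorial_pos) (by omega)
      have h3 : C ^ (n * (n * M + 1)) ≤ (C ^ (n * (n + 1))) ^ M := by
        rw [← pow_mul]
        refine pow_le_pow_right₀ hC ?_
        rw [mul_assoc]
        exact Nat.mul_le_mul_left _ (by nlinarith)
      have h4 : (n : ℝ) * M + 1 ≤ (2 ^ (n + 1)) ^ M := by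
        rw [← pow_mul]
        have h5 : n * M + 1 < 2 ^ (n * M + 1) := Nat.lt_two_pow_self
        have h6 : 2 ^ (n * M + 1) ≤ 2 ^ ((n + 1) * M) :=
          Nat.pow_le_pow_right (by norm_num) (by nlinarith)
        exact_mod_cast h5.le.trans h6
      have h5 : C ^ ((n + 2) * M + 1) ≤ (C ^ (n + 3)) ^ M := by
        rw [← pow_mul]
        exact pow_le_pow_right₀ hC (by nlinarith)
      have h6 : ((2 * n : ℝ) ^ (n * M)) = ((2 * n) ^ n) ^ M := pow_mul _ _ _
      calc _ ≤ (4 ^ (n + 1)) ^ M * ((C ^ (n * (n + 1))) ^ M * ((n.factorial : ℝ) ^ M *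
            ((2 ^ (n + 1)) ^ M * ((C ^ (n + 3)) ^ M * ((2 * n) ^ n) ^ M)) ^ n)) := by
            rw [hB, h6]
            gcongr
        _ = _ := by
            rw [← mul_pow, ← mul_pow, pow_right_comm _ M n, ← mul_pow, ← mul_pow, ← mul_pow]
    · rw [coeff_genericRel φ _ hm.le]
      ext d
      rw [MvPolynomial.coeff_homogeneousComponent, MvPolynomial.coeff_zero]
      split_ifs with hdm
      swap
      · rfl
      have hdM : ∀ i, d i < M := fun i => (Finsupp.le_degree i d).trans_lt (hdm.trans_lt hm)
      have hδ0 : (δ (n * M) : ℚ) ^ n ≠ 0 := pow_ne_zero _ (by exact_mod_cast (hδ.pos _).ne')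
      have h1 := congrFun hp fun i => ⟨d i, hdM i⟩
      have h2 : (Finsupp.equivFunOnFinite.symm fun i => d i) = d := by ext; simp
      simp only [Matrix.mulVec, dotProduct, Matrix.of_apply, h2, Pi.zero_apply] at h1
      have h3 := congrArg (Int.cast (R := ℚ)) h1
      rw [Int.cast_sum, Int.cast_zero] at h3
      apply (mul_eq_zero.1 _).resolve_left hδ0
      rw [← h3, relPoly, MvPolynomial.coeff_sum, Finset.mul_sum]
      refine Finset.sum_congr rfl fun x _ => ?_
      have h4 := congrArg (MvPolynomial.coeff d) (hP x)
      rw [MvPolynomial.coeff_map, MvPolynomial.coeff_smul, smul_eq_mul] at h4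
      rw [MvPolynomial.coeff_smul, smul_eq_mul, Int.cast_mul]
      change _ = (Int.castRingHom ℚ) ((P x).coeff d) * _
      rw [h4]
      ring

end Siegel

variable {n D : ℕ}

theorem exists_bound_of_mem_convSubring {A : Type*} [CommRing A] {N : RingSeminorm A} {r : ℝ}
    {hr : 0 ≤ r} {ι : Type*} [Finite ι] {g : ι → A⟦X⟧} (hg : ∀ i, g i ∈ convSubring N r hr) :
    ∃ K : ℝ, 1 ≤ K ∧ ∀ i S, truncNorm N r hr S (g i) ≤ K := by
  choose K hK using fun i => mem_convSubring.1 (hg i)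
  obtain ⟨B, hB⟩ := (Set.finite_range K).bddAbove
  exact ⟨max 1 B, le_max_left _ _, fun i S =>
    (hK i S).trans ((hB ⟨i, rfl⟩).trans (le_max_right _ _))⟩

theorem truncNorm_pow_mul_relSeries_le {φ : ℚ⟦X⟧} {r : ℝ} {hr : 0 ≤ r} {S : ℕ}
    {e : Fin n → (MvPolynomial (Fin n) ℚ)⟦X⟧} {Q : (MvPolynomial (Fin n) ℚ)⟦X⟧} {K B : ℝ}
    (hK : 1 ≤ K) (h1 : truncNorm (coeffNorm (Fin n)) r hr S 1 ≤ 1)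
    (hQ : truncNorm (coeffNorm (Fin n)) r hr S Q ≤ K)
    (hQe : ∀ i, truncNorm (coeffNorm (Fin n)) r hr S (Q * e i) ≤ K)
    (hη : truncNorm (coeffNorm (Fin n)) r hr S (normSeries (laurentMap (algebraMap ℚ _)
      (HahnSeries.ofPowerSeries ℤ ℚ φ)) e) ≤ K)
    (p : (Fin n → Fin D) × Fin D → ℚ) (hB : ∀ x, |((p x : ℚ) : ℝ)| ≤ B) :
    truncNorm (coeffNorm (Fin n)) r hr S (Q ^ (n * D) * relSeries φ p e) ≤
      D ^ (n + 1) * (B * K ^ (n * D + D)) := by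
  set T := truncNorm (coeffNorm (Fin n)) r hr S with hT
  have hpow : ∀ (g : (MvPolynomial (Fin n) ℚ)⟦X⟧) (k : ℕ), T g ≤ K → T (g ^ k) ≤ K ^ k := by
    intro g k hg
    induction k with
    | zero => simpa using h1
    | succ k ih =>
      rw [pow_succ, pow_succ]
      exact (map_mul_le_mul T _ _).trans (mul_le_mul ih hg (apply_nonneg T _) (by positivity))
  have hterm : ∀ x : (Fin n → Fin D) × Fin D, T (Q ^ (n * D) * (p x • ((∏ i, e i ^ (x.1 i : ℕ)) *
      normSeries (laurentMap (algebraMap ℚ _) (HahnSeries.ofPowerSeries ℤ ℚ φ)) e ^ (x.2 : ℕ)))) ≤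
      B * K ^ (n * D + D) := by
    intro x
    set η := normSeries (laurentMap (algebraMap ℚ _) (HahnSeries.ofPowerSeries ℤ ℚ φ)) e
    have hQD : Q ^ (n * D) * ∏ i, e i ^ (x.1 i : ℕ) =
        ∏ i, (Q ^ (D - (x.1 i : ℕ)) * (Q * e i) ^ (x.1 i : ℕ)) := by
      have : ∀ i, Q ^ (D - (x.1 i : ℕ)) * (Q * e i) ^ (x.1 i : ℕ) = Q ^ D * e i ^ (x.1 i : ℕ) := by
        intro i
        rw [mul_pow, ← mul_assoc, ← pow_add, Nat.sub_add_cancel (x.1 i).2.le]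
      simp only [this]
      rw [Finset.prod_mul_distrib, Finset.prod_const, Finset.card_univ, Fintype.card_fin, ← pow_mul,
        mul_comm D n]
    have hprod : T (Q ^ (n * D) * ∏ i, e i ^ (x.1 i : ℕ)) ≤ K ^ (n * D) := by
      rw [hQD]
      refine (T.map_prod_le_of_one h1 _ _).trans ?_
      have : ∀ i, T (Q ^ (D - (x.1 i : ℕ)) * (Q * e i) ^ (x.1 i : ℕ)) ≤ K ^ D := by
        intro i
        refine (map_mul_le_mul T _ _).trans ((mul_le_mul (hpow _ _ hQ) (hpow _ _ (hQe i))
          (apply_nonneg T _) (by positivity)).trans_eq ?_)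
        rw [← pow_add, Nat.sub_add_cancel (x.1 i).2.le]
      refine (Finset.prod_le_prod (fun _ _ => apply_nonneg T _) fun i _ => this i).trans_eq ?_
      rw [Finset.prod_const, Finset.card_univ, Fintype.card_fin, ← pow_mul, mul_comm D n]
    have hre : Q ^ (n * D) * (p x • ((∏ i, e i ^ (x.1 i : ℕ)) * η ^ (x.2 : ℕ))) =
        C (algebraMap ℚ _ (p x)) * ((Q ^ (n * D) * ∏ i, e i ^ (x.1 i : ℕ)) * η ^ (x.2 : ℕ)) := by
      rw [Algebra.smul_def, PowerSeries.algebraMap_apply]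
      ring
    rw [hre]
    have hc : T (C (algebraMap ℚ _ (p x))) ≤ B :=
      (truncNorm_C_le _ _ _ _ _).trans ((coeffNorm_algebraMap _).le.trans (hB x))
    refine (map_mul_le_mul T _ _).trans (mul_le_mul hc ?_ (apply_nonneg T _)
      ((abs_nonneg _).trans (hB x)))
    rw [pow_add]
    refine (map_mul_le_mul T _ _).trans (mul_le_mul hprod ?_ (apply_nonneg T _) (by positivity))
    exact (hpow _ _ hη).trans (pow_le_pow_right₀ hK x.2.2.le)
  rw [relSeries, Finset.mul_sum]
  refine (T.map_sum_le _ _).trans ((Finset.sum_le_sum fun x _ => hterm x).trans_eq ?_)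
  rw [Finset.sum_const, Finset.card_univ, nsmul_eq_mul]
  simp only [Fintype.card_fun, Fintype.card_fin, Fintype.card_prod]
  push_cast
  ring

/-- The arithmetic criterion: a solution with small denominators and convergent extensions along
the paths produced by reciprocity is algebraic. -/
theorem DenominatorBound.exists_polynomial [NeZero n] {φ : ℚ⟦X⟧} {C : ℝ} {δ : ℕ → ℕ}
    (hδ : DenominatorBound (odeSol φ) C δ) {m : Type} [Fintype m] [DecidableEq m]
    (R : ReciprocityData (HahnSeries.ofPowerSeries ℤ ℚ φ) m n) {θ : ℝ} (hθ : 1 ≤ θ)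
    (hf : ∃ K : ℝ, ∀ i, |(((HahnSeries.ofPowerSeries ℤ ℚ φ).coeff i : ℚ) : ℝ)| ≤ K * θ ^ i)
    (hR : ∀ j, ∃ K : ℝ, ∀ i, |(((R.r j).coeff i : ℚ) : ℝ)| ≤ K * θ ^ i) :
    ∃ P : Polynomial (Polynomial ℚ), P ≠ 0 ∧
      P.eval₂ Polynomial.coeToPowerSeries.ringHom (odeSol φ) = 0 := by
  have hn : 0 < n := Nat.pos_of_ne_zero (NeZero.ne n)
  have hC := hδ.one_le
  obtain ⟨r, hr, hr0, Z, hZ, hpath⟩ := R.exists_path_normSeries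
    (fun i hi => ofPowerSeries_coeff_of_neg φ hi) hθ hf hR (A := MvPolynomial (Fin n) ℚ)
    (N := coeffNorm (Fin n)) (fun q => (coeffNorm_algebraMap q).le) (ξ := MvPolynomial.X)
    (fun l => (coeffNorm_X l).le)
  obtain ⟨C₁, hC₁, hrel⟩ := hδ.exists_relation hn
  set C₂ : ℝ := C ^ (n * (n + 1)) with hC₂
  have hC₂1 : 1 ≤ C₂ := one_le_pow₀ hC
  set C₃ : ℝ := 4 ^ (n + 1) * C₁ with hC₃
  have hC₃1 : 1 ≤ C₃ := one_le_mul_of_one_le_of_one_le (one_le_pow₀ (by norm_num)) hC₁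
  obtain ⟨k, hk⟩ := exists_nat_ge (2 * (C₂ * C₃) / r)
  rw [div_le_iff₀ hr0] at hk
  obtain ⟨e, Q, hQ1, hQ, hQe, he0, he1, hη⟩ := hpath k
  obtain ⟨L, hL1, hL⟩ := exists_bound_of_mem_convSubring (N := coeffNorm (Fin n)) (r := r)
      (hr := hr)
    (g := fun o : Option (Option (Fin n)) => o.elim Q fun o' => o'.elim (Z ^ k) fun i => Q * e i)
    (by
      rintro (_ | _ | i)
      exacts [hQ, pow_mem hZ k, hQe i])
  obtain ⟨K, hK⟩ : ∃ K : ℕ, L ^ (2 * (n + 1)) < 2 ^ K := pow_unbounded_of_one_lt _ (by norm_num)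
  have hK0 : 0 < K := by
    rcases Nat.eq_zero_or_pos K with rfl | h
    · rw [pow_zero] at hK
      exact absurd (one_le_pow₀ hL1) (not_le.2 hK)
    · exact h
  have hrelK := hrel K hK0
  set D := 2 * K ^ n with hD
  set M₀ := K ^ (n + 1) with hM₀
  obtain ⟨p, hp0, hple, hpM⟩ := hrelK
  have hM₀1 : 1 ≤ M₀ := Nat.one_le_pow _ _ hK0
  have hp0' : (fun x => (p x : ℚ)) ≠ 0 := by
    obtain ⟨x, hx⟩ := Function.ne_iff.1 hp0
    exact Function.ne_iff.2 ⟨x, by simpa using hx⟩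
  refine exists_polynomial_of_relSeries_eq_zero hp0' ?_
  change genericRel φ (fun x => (p x : ℚ)) = 0
  by_contra hG
  classical
  have hex : ∃ M, coeff M (genericRel φ fun x => (p x : ℚ)) ≠ 0 := by
    by_contra! h
    exact hG (PowerSeries.ext h)
  set M := Nat.find hex with hM
  have hMne : coeff M (genericRel φ fun x => (p x : ℚ)) ≠ 0 := Nat.find_spec hex
  have hMmin : ∀ m < M, coeff m (genericRel φ fun x => (p x : ℚ)) = 0 := fun m hm =>
    not_not.1 (Nat.find_min hex hm)
  have hMM : M₀ ≤ M := by
    by_contra! h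
    exact hMne (hpM M h)
  have hlow := hδ.one_le_coeffNorm p hMne
  set F := coeff M (genericRel φ fun x => (p x : ℚ)) with hF
  have hcoeff : ∀ s ≤ M, coeff s (relSeries φ (fun x => (p x : ℚ)) e) =
      (algebraMap ℚ (MvPolynomial (Fin n) ℚ) (-k)) ^ s *
      coeff s (genericRel φ fun x => (p x : ℚ)) := by
    intro s hs
    refine coeff_relSeries φ _ (fun m hm => hMmin m (hm.trans_le hs)) he0 fun i => ?_
    rw [he1, map_neg, map_natCast, neg_mul]
  have htop : coeff M (Q ^ (n * D) * relSeries φ (fun x => (p x : ℚ)) e) = ((-k : ℚ) ^ M) • F := by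
    obtain ⟨w, hw⟩ : X ^ M ∣ relSeries φ (fun x => (p x : ℚ)) e := by
      rw [X_pow_dvd_iff]
      intro s hs
      rw [hcoeff s hs.le, hMmin s hs, mul_zero]
    have h1 := hcoeff M le_rfl
    rw [hw, coeff_X_pow_mul', if_pos le_rfl, Nat.sub_self] at h1
    rw [hw, mul_left_comm, coeff_X_pow_mul', if_pos le_rfl, Nat.sub_self,
      coeff_zero_eq_constantCoeff_apply, map_mul, map_pow, hQ1, one_pow, one_mul,
      ← coeff_zero_eq_constantCoeff_apply, h1, Algebra.smul_def, map_pow]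
  have hk0 : (0 : ℝ) < k := by
    have : 0 < 2 * (C₂ * C₃) := by positivity
    by_contra h
    have : (k : ℝ) * r ≤ 0 := mul_nonpos_of_nonpos_of_nonneg (not_lt.1 h) hr
    linarith
  have hFle : (k : ℝ) ^ M * coeffNorm (Fin n) F ≤
      coeffNorm (Fin n) (coeff M (Q ^ (n * D) * relSeries φ (fun x => (p x : ℚ)) e)) := by
    rw [htop]
    have hkq : (-k : ℚ) ^ M ≠ 0 := pow_ne_zero _ (neg_ne_zero.2 (by exact_mod_cast hk0.ne'))
    have h1 := coeffNorm_smul_le ((-k : ℚ) ^ M)⁻¹ ((-k : ℚ) ^ M • F)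
    rw [smul_smul, inv_mul_cancel₀ hkq, one_smul] at h1
    have h2 : |((((-k : ℚ) ^ M)⁻¹ : ℚ) : ℝ)| = ((k : ℝ) ^ M)⁻¹ := by
      push_cast
      rw [abs_inv, abs_pow, abs_neg, abs_of_pos hk0]
    rw [h2] at h1
    rwa [inv_mul_eq_div, le_div_iff₀ (by positivity), mul_comm] at h1
  have hup := truncNorm_pow_mul_relSeries_le (φ := φ) (r := r) (hr := hr) (S := M + 1) (e := e) hL1
    ((truncNorm_C_le (coeffNorm (Fin n)) r hr (M + 1) 1).trans coeffNorm_one.le) (hL none _)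
    (fun i => hL (some (some i)) _) (by rw [hη]; exact hL (some none) _) (fun x => (p x : ℚ))
    (B := C₁ ^ M₀) (fun x => by rw [Rat.cast_intCast]; exact hple x)
  have hmid := mul_pow_le_truncNorm (coeffNorm (Fin n)) r hr (Nat.lt_succ_self M)
    (Q ^ (n * D) * relSeries φ (fun x => (p x : ℚ)) e)
  have hδM : (δ (n * M) : ℝ) ^ n ≤ C₂ ^ M := by
    refine (pow_le_pow_left₀ (by positivity) (hδ.le _) n).trans ?_
    rw [hC₂, ← pow_mul, ← pow_mul]
    refine pow_le_pow_right₀ hC ?_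
    nlinarith [hM₀1.trans hMM, Nat.mul_le_mul_left n (hM₀1.trans hMM)]
  have hDle : (D : ℝ) ^ (n + 1) ≤ (4 ^ (n + 1)) ^ M₀ := by
    rw [← pow_mul, mul_comm (n + 1), pow_mul]
    refine pow_le_pow_left₀ (by positivity) ?_ _
    have h2 : D ≤ 4 ^ M₀ := by
      have h3 : M₀ < 2 ^ M₀ := Nat.lt_two_pow_self
      have h4 : 2 ^ 1 ≤ 2 ^ M₀ := Nat.pow_le_pow_right (by norm_num) hM₀1
      calc D ≤ 2 * M₀ := Nat.mul_le_mul_left 2 (Nat.pow_le_pow_right hK0 (Nat.le_succ n))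
        _ ≤ 2 ^ M₀ * 2 ^ M₀ := Nat.mul_le_mul (by simpa using h4) h3.le
        _ = 4 ^ M₀ := by rw [← mul_pow]; norm_num
    exact_mod_cast h2
  have hchain : (k * r) ^ M ≤ (C₂ * C₃) ^ M * L ^ (n * D + D) := by
    calc (k * r) ^ M = (k : ℝ) ^ M * 1 * r ^ M := by rw [mul_pow, mul_one]
      _ ≤ (k : ℝ) ^ M * (C₂ ^ M * coeffNorm (Fin n) F) * r ^ M := by
          have := hlow.trans (mul_le_mul_of_nonneg_right hδM (apply_nonneg _ F))
          gcongr
      _ = C₂ ^ M * ((k : ℝ) ^ M * coeffNorm (Fin n) F * r ^ M) := by ring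
      _ ≤ C₂ ^ M * (D ^ (n + 1) * (C₁ ^ M₀ * L ^ (n * D + D))) := by
          refine mul_le_mul_of_nonneg_left (le_trans ?_ (hmid.trans hup)) (by positivity)
          exact mul_le_mul_of_nonneg_right hFle (by positivity)
      _ ≤ C₂ ^ M * ((4 ^ (n + 1)) ^ M₀ * (C₁ ^ M₀ * L ^ (n * D + D))) := by gcongr
      _ = C₂ ^ M * C₃ ^ M₀ * L ^ (n * D + D) := by rw [hC₃, mul_pow]; ring
      _ ≤ C₂ ^ M * C₃ ^ M * L ^ (n * D + D) := by gcongr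
      _ = (C₂ * C₃) ^ M * L ^ (n * D + D) := by rw [mul_pow C₂ C₃]
  have h2M : (2 : ℝ) ^ M ≤ L ^ (n * D + D) := by
    have h1 : (2 * (C₂ * C₃)) ^ M ≤ (k * r) ^ M := pow_le_pow_left₀ (by positivity) hk M
    rw [mul_pow, mul_comm] at h1
    exact le_of_mul_le_mul_left (h1.trans hchain) (by positivity)
  have hfin : ((2 : ℝ) ^ K) ^ K ^ n ≤ (L ^ (2 * (n + 1))) ^ K ^ n := by
    rw [← pow_mul, ← pow_mul, ← pow_succ']
    refine (pow_le_pow_right₀ (by norm_num) hMM).trans (h2M.trans_eq ?_)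
    congr 1
    rw [hD]
    ring
  exact absurd (pow_lt_pow_left₀ hK (by positivity) (pow_ne_zero n hK0.ne')) (not_lt.2 hfin)

section Eisenstein

/-- Series whose coefficients up to order `k` lie in a given subring. -/
def coeffSubring {R : Type*} [CommRing R] (B : Subring R) (k : ℕ) : Subring R⟦X⟧ where
  carrier := {u | ∀ i ≤ k, coeff i u ∈ B}
  zero_mem' i _ := by simp
  one_mem' i _ := by
    rw [coeff_one]
    split_ifs
    exacts [one_mem B, zero_mem B]
  add_mem' hu hv i hi := by
    rw [map_add]
    exact add_mem (hu i hi) (hv i hi)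
  neg_mem' hu i hi := by
    rw [map_neg]
    exact neg_mem (hu i hi)
  mul_mem' hu hv i hi := by
    rw [coeff_mul]
    refine sum_mem fun x hx => ?_
    have := Finset.HasAntidiagonal.mem_antidiagonal.1 hx
    exact mul_mem (hu _ (by omega)) (hv _ (by omega))

/-- Geometrically bounded denominators and coefficients. -/
def IsEisenstein (g : ℚ⟦X⟧) : Prop :=
  ∃ N : ℕ, 0 < N ∧ ∀ n, (∃ z : ℤ, (N : ℚ) ^ (n + 1) * coeff n g = z) ∧
    |coeff n g| ≤ (N : ℚ) ^ (n + 1)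

theorem IsEisenstein.of_two {g : ℚ⟦X⟧} {N M : ℕ} (hN : 0 < N) (hM : 0 < M)
    (h1 : ∀ n, ∃ z : ℤ, (N : ℚ) ^ (n + 1) * coeff n g = z)
    (h2 : ∀ n, |coeff n g| ≤ (M : ℚ) ^ (n + 1)) : IsEisenstein g := by
  refine ⟨N * M, Nat.mul_pos hN hM, fun n => ⟨?_, ?_⟩⟩
  · obtain ⟨z, hz⟩ := h1 n
    refine ⟨M ^ (n + 1) * z, ?_⟩
    push_cast
    rw [← hz]
    ring
  · refine (h2 n).trans (pow_le_pow_left₀ (by positivity) ?_ _)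
    exact_mod_cast Nat.le_mul_of_pos_left M hN

theorem IsEisenstein.add {g h : ℚ⟦X⟧} (hg : IsEisenstein g) (hh : IsEisenstein h) :
    IsEisenstein (g + h) := by
  obtain ⟨N, hN, hg⟩ := hg
  obtain ⟨M, hM, hh⟩ := hh
  refine .of_two (N := N * M) (M := N + M) (by positivity) (by positivity) (fun n => ?_)
    fun n => ?_
  · obtain ⟨z, hz⟩ := (hg n).1
    obtain ⟨w, hw⟩ := (hh n).1
    refine ⟨M ^ (n + 1) * z + N ^ (n + 1) * w, ?_⟩
    push_cast
    rw [← hz, ← hw, map_add]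
    ring
  · rw [map_add]
    refine (abs_add_le _ _).trans ((add_le_add (hg n).2 (hh n).2).trans ?_)
    push_cast
    exact pow_add_pow_le (by positivity) (by positivity) (by omega)

theorem IsEisenstein.X_pow_mul {g : ℚ⟦X⟧} (hg : IsEisenstein g) (k : ℕ) :
    IsEisenstein (X ^ k * g) := by
  obtain ⟨N, hN, hg⟩ := hg
  refine ⟨N, hN, fun n => ?_⟩
  rw [coeff_X_pow_mul']
  split_ifs with h
  · obtain ⟨⟨z, hz⟩, hb⟩ := hg (n - k)
    refine ⟨⟨N ^ k * z, ?_⟩, hb.trans (pow_le_pow_right₀ (by exact_mod_cast hN) (by omega))⟩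
    push_cast
    rw [← hz, ← mul_assoc, ← pow_add, show k + (n - k + 1) = n + 1 by omega]
  · exact ⟨⟨0, by simp⟩, by simp⟩

theorem isEisenstein_C (c : ℚ) : IsEisenstein (C c) := by
  refine .of_two (N := c.den) (M := c.num.natAbs + 1) c.pos (by positivity) (fun n => ?_)
    fun n => ?_
  · rw [coeff_C]
    split_ifs with h
    · exact ⟨c.num, by rw [h, zero_add, pow_one, mul_comm, Rat.mul_den_eq_num]⟩
    · exact ⟨0, by simp⟩
  · rw [coeff_C]
    split_ifs with h
    · rw [h, zero_add, pow_one]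
      push_cast
      have h1 : |c| ≤ |(c.num : ℚ)| := by
        conv_lhs => rw [← Rat.num_div_den c]
        rw [abs_div, Nat.abs_cast]
        exact div_le_self (abs_nonneg _) (by exact_mod_cast c.pos)
      have h2 : ((c.num.natAbs : ℕ) : ℚ) = |(c.num : ℚ)| := by
        rw [Nat.cast_natAbs, Int.cast_abs]
      linarith
    · simp only [abs_zero]
      positivity

theorem isEisenstein_coe (q : Polynomial ℚ) : IsEisenstein (q : ℚ⟦X⟧) := by
  induction q using Polynomial.induction_on' with
  | add p q hp hq =>
    rw [Polynomial.coe_add]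
    exact hp.add hq
  | monomial n c =>
    have : ((Polynomial.monomial n c : Polynomial ℚ) : ℚ⟦X⟧) = X ^ n * C c := by
      rw [← Polynomial.C_mul_X_pow_eq_monomial, Polynomial.coe_mul, Polynomial.coe_C,
        Polynomial.coe_pow, Polynomial.coe_X, mul_comm]
    rw [this]
    exact (isEisenstein_C c).X_pow_mul n

local notation "ι" => (Polynomial.coeToPowerSeries.ringHom : Polynomial ℚ →+* ℚ⟦X⟧)

/-- Newton's reduction of an algebraic series to a fixed point equation. -/
theorem exists_eq_add_X_mul_eval₂ {g : ℚ⟦X⟧} {P : Polynomial (Polynomial ℚ)} (hP : P ≠ 0)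
    (hg : P.eval₂ ι g = 0) : ∃ (q : Polynomial ℚ) (c : ℕ) (w : ℚ⟦X⟧) (γ : ℚ)
      (S : Polynomial (Polynomial ℚ)), g = (q : ℚ⟦X⟧) + X ^ c * w ∧ w = C γ + X * S.eval₂ ι w := by
  classical
  have hι : Function.Injective ι := Polynomial.coe_injective ℚ
  obtain ⟨P, ⟨hP, hg⟩, hmin⟩ : ∃ P : Polynomial (Polynomial ℚ), (P ≠ 0 ∧ P.eval₂ ι g = 0) ∧
      ∀ Q : Polynomial (Polynomial ℚ), (Q ≠ 0 ∧ Q.eval₂ ι g = 0) →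
        P.natDegree ≤ Q.natDegree := by
    obtain ⟨P, hP, h⟩ := (InvImage.wf Polynomial.natDegree (Nat.lt_wfRel.wf)).has_min
      {P : Polynomial (Polynomial ℚ) | P ≠ 0 ∧ P.eval₂ ι g = 0} ⟨P, hP, hg⟩
    exact ⟨P, hP, fun Q hQ => not_lt.1 (h Q hQ)⟩
  have hdeg : P.natDegree ≠ 0 := by
    intro h0
    rw [Polynomial.eq_C_of_natDegree_eq_zero h0, Polynomial.eval₂_C,
      map_eq_zero_iff _ hι] at hg
    apply hP
    rw [Polynomial.eq_C_of_natDegree_eq_zero h0, hg, Polynomial.C_0]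
  have hP' : P.derivative.eval₂ ι g ≠ 0 := by
    intro h
    have hd : P.derivative ≠ 0 := fun hd => hdeg (Polynomial.derivative_eq_zero.1 hd)
    exact absurd (hmin _ ⟨hd, h⟩) (not_le.2 (Polynomial.natDegree_derivative_lt hdeg))
  obtain ⟨c, u', hu', hcu⟩ : ∃ (c : ℕ) (u' : ℚ⟦X⟧), constantCoeff u' ≠ 0 ∧
      P.derivative.eval₂ ι g = X ^ c * u' := by
    refine ⟨(P.derivative.eval₂ ι g).order.toNat, divXPowOrder _, ?_,
        X_pow_order_mul_divXPowOrder.symm⟩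
    rwa [Ne, constantCoeff_divXPowOrder_eq_zero_iff]
  obtain ⟨w, hw⟩ : X ^ (c + 1) ∣ g - (trunc (c + 1) g : ℚ⟦X⟧) := by
    rw [X_pow_dvd_iff]
    intro m hm
    rw [map_sub, Polynomial.coeff_coe, coeff_trunc, if_pos hm, sub_self]
  set q := trunc (c + 1) g with hq
  have hgq : g = (q : ℚ⟦X⟧) + X ^ (c + 1) * w := by rw [← hw]; ring
  -- the derivative at `q`
  have hderiv : X ^ (c + 1) ∣ P.derivative.eval₂ ι g - ι (P.derivative.eval q) := by
    have h1 : ι (P.derivative.eval q) = (P.derivative.map ι).eval (ι q) := by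
      rw [Polynomial.eval_map, Polynomial.eval₂_at_apply]
    rw [h1, ← Polynomial.eval_map]
    refine dvd_trans ?_ (Polynomial.sub_dvd_eval_sub _ _ _)
    exact ⟨w, hw⟩
  obtain ⟨u, hu⟩ : Polynomial.X ^ c ∣ P.derivative.eval q := by
    rw [Polynomial.X_pow_dvd_iff]
    intro m hm
    have h := coeff_eq_of_dvd_sub hderiv (show m < c + 1 by omega)
    rw [hcu, coeff_X_pow_mul', if_neg (by omega)] at h
    rw [← Polynomial.coeff_coe]
    exact h.symm
  have hu0 : u.coeff 0 ≠ 0 := by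
    have h := coeff_eq_of_dvd_sub hderiv (show c < c + 1 by omega)
    rw [hcu, coeff_X_pow_mul', if_pos le_rfl, Nat.sub_self, hu] at h
    intro h0
    apply hu'
    rw [← coeff_zero_eq_constantCoeff_apply, h]
    change coeff c ((Polynomial.X ^ c * u : Polynomial ℚ) : ℚ⟦X⟧) = 0
    rw [Polynomial.coeff_coe, Polynomial.coeff_X_pow_mul', if_pos le_rfl, Nat.sub_self, h0]
  obtain ⟨k, hk⟩ := Polynomial.binomExpansion (P.map Polynomial.C)
    (Polynomial.C q : Polynomial (Polynomial ℚ)) (Polynomial.C (Polynomial.X ^ (c + 1)) *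
        Polynomial.X)
  have hexp : (0 : ℚ⟦X⟧) = ι (P.eval q) + ι (P.derivative.eval q) * (X ^ (c + 1) * w) +
      k.eval₂ ι w * (X ^ (c + 1) * w) ^ 2 := by
    have h := congrArg (Polynomial.eval₂RingHom ι w) hk
    simp only [map_add, map_mul, map_pow] at h
    rw [Polynomial.derivative_map, Polynomial.eval_map, Polynomial.eval_map,
      Polynomial.eval_map, Polynomial.eval₂_at_apply, Polynomial.eval₂_at_apply,
      Polynomial.hom_eval₂] at h
    have hcomp : (Polynomial.eval₂RingHom ι w).comp Polynomial.C = ι := by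
      ext <;> simp
    simp only [hcomp, Polynomial.coe_eval₂RingHom, Polynomial.eval₂_add, Polynomial.eval₂_mul,
      Polynomial.eval₂_C, Polynomial.eval₂_X, Polynomial.eval₂_pow] at h
    have hX : ι Polynomial.X = X := Polynomial.coe_X
    have hqq : ι q = q := rfl
    rw [hX, hqq, ← hgq, hg] at h
    exact h
  obtain ⟨v, hv⟩ : Polynomial.X ^ (2 * c + 1) ∣ P.eval q := by
    have hd : X ^ (2 * c + 1) ∣ ι (P.eval q) := by
      refine ⟨-(ι u * w + X * k.eval₂ ι w * w ^ 2), ?_⟩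
      rw [hu, map_mul, map_pow] at hexp
      have hX : ι Polynomial.X = X := Polynomial.coe_X
      rw [hX] at hexp
      linear_combination -hexp
    rw [X_pow_dvd_iff] at hd
    rw [Polynomial.X_pow_dvd_iff]
    intro m hm
    rw [← Polynomial.coeff_coe]
    exact hd m hm
  have hX : ι Polynomial.X = X := Polynomial.coe_X
  have hred : ι v + ι u * w + X * k.eval₂ ι w * w ^ 2 = 0 := by
    rw [hu, hv, map_mul, map_mul, map_pow, map_pow, hX] at hexp
    have h0 : (X : ℚ⟦X⟧) ^ (2 * c + 1) ≠ 0 := pow_ne_zero _ X_ne_zero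
    apply mul_left_cancel₀ h0
    linear_combination -hexp
  have hC : ∀ a : ℚ, ι (Polynomial.C a) = C a := fun a => Polynomial.coe_C a
  rw [← Polynomial.divX_mul_X_add u, ← Polynomial.divX_mul_X_add v, map_add, map_add, map_mul,
    map_mul, hX, hC, hC] at hred
  refine ⟨q, c + 1, w, -((u.coeff 0)⁻¹ * v.coeff 0), -Polynomial.C (Polynomial.C (u.coeff 0)⁻¹) *
    (Polynomial.C v.divX + Polynomial.C u.divX * Polynomial.X + k * Polynomial.X ^ 2), hgq, ?_⟩
  simp only [Polynomial.eval₂_mul, Polynomial.eval₂_add, Polynomial.eval₂_neg,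
    Polynomial.eval₂_C, Polynomial.eval₂_X, Polynomial.eval₂_X_pow, hC, map_neg, map_mul]
  have hinv : (C (u.coeff 0)⁻¹ : ℚ⟦X⟧) * C (u.coeff 0) = 1 := by
    rw [← map_mul, inv_mul_cancel₀ hu0, map_one]
  linear_combination (C (u.coeff 0)⁻¹ : ℚ⟦X⟧) * hred - w * hinv

theorem exists_common_denominator (s : Finset ℚ) :
    ∃ N : ℕ, 0 < N ∧ ∀ q ∈ s, ∃ z : ℤ, (N : ℚ) * q = z := by
  classical
  induction s using Finset.induction_on with
  | empty => exact ⟨1, one_pos, by simp⟩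
  | insert a s _ ih =>
    obtain ⟨N, hN, h⟩ := ih
    refine ⟨N * a.den, Nat.mul_pos hN a.pos, fun q hq => ?_⟩
    rcases Finset.mem_insert.1 hq with rfl | hq
    · refine ⟨N * q.num, ?_⟩
      push_cast
      rw [mul_assoc, mul_comm (q.den : ℚ), Rat.mul_den_eq_num]
    · obtain ⟨z, hz⟩ := h q hq
      refine ⟨a.den * z, ?_⟩
      push_cast
      rw [← hz]
      ring

theorem X_mul_mem_coeffSubring {R : Type*} [CommRing R] {B : Subring R} {k : ℕ} {u : R⟦X⟧}
    (hu : u ∈ coeffSubring B k) : X * u ∈ coeffSubring B (k + 1) := by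
  rintro (_ | i) hi
  · rw [coeff_zero_X_mul]
    exact zero_mem B
  · rw [coeff_succ_X_mul]
    exact hu i (by omega)

theorem C_mem_coeffSubring {R : Type*} [CommRing R] {B : Subring R} {k : ℕ} {c : R} (hc : c ∈ B) :
    C c ∈ coeffSubring B k := by
  intro i _
  rw [coeff_C]
  split_ifs
  exacts [hc, zero_mem B]

theorem exists_int_of_fixed_point {w : ℚ⟦X⟧} {γ : ℚ} {S : Polynomial (Polynomial ℚ)}
    (hw : w = C γ + X * S.eval₂ ι w) :
    ∃ N : ℕ, 0 < N ∧ ∀ n, ∃ z : ℤ, (N : ℚ) ^ (n + 1) * coeff n w = z := by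
  classical
  obtain ⟨N, hN, hint⟩ := exists_common_denominator
    (insert γ (S.support.biUnion fun j => (S.coeff j).support.image (S.coeff j).coeff))
  have hcoeff : ∀ j i, ∃ z : ℤ, (N : ℚ) * (S.coeff j).coeff i = z := by
    intro j i
    by_cases h : (S.coeff j).coeff i = 0
    · exact ⟨0, by simp [h]⟩
    · refine hint _ (Finset.mem_insert_of_mem (Finset.mem_biUnion.2 ⟨j, ?_, Finset.mem_image.2
        ⟨i, Polynomial.mem_support_iff.2 h, rfl⟩⟩))
      rw [Polynomial.mem_support_iff]
      rintro h'
      rw [h', Polynomial.coeff_zero] at h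
      exact h rfl
  set E := S.natDegree with hE
  set B : Subring ℚ := (Int.castRingHom ℚ).range with hB
  have hNB : (N : ℚ) ∈ B := ⟨N, by simp⟩
  set v : ℚ⟦X⟧ := C (N : ℚ) * rescale ((N : ℚ) ^ E) w with hv
  have hfix : v = C (N * γ) + X * ∑ j ∈ Finset.range (E + 1),
      C ((N : ℚ) ^ (E - j)) * (C (N : ℚ) * rescale ((N : ℚ) ^ E) (ι (S.coeff j))) * v ^ j := by
    have hsum : rescale ((N : ℚ) ^ E) (S.eval₂ ι w) = ∑ j ∈ Finset.range (E + 1),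
        rescale ((N : ℚ) ^ E) (ι (S.coeff j)) * rescale ((N : ℚ) ^ E) w ^ j := by
      rw [Polynomial.eval₂_eq_sum_range, map_sum]
      simp only [map_mul, map_pow]
      rfl
    have hRX : rescale ((N : ℚ) ^ E) (X : ℚ⟦X⟧) = C ((N : ℚ) ^ E) * X := rescale_X _
    have hRC : rescale ((N : ℚ) ^ E) (C γ : ℚ⟦X⟧) = C γ := by
      ext i
      rw [coeff_rescale, coeff_C]
      split_ifs with h
      · rw [h, pow_zero, one_mul]
      · rw [mul_zero]
    conv_lhs => rw [hv, hw, map_add, map_mul, hRX, hRC, hsum]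
    rw [mul_add, ← map_mul, Finset.mul_sum, Finset.mul_sum, Finset.mul_sum]
    congr 1
    refine Finset.sum_congr rfl fun j hj => ?_
    have hj' := Finset.mem_range.1 hj
    have hpow : (N : ℚ) ^ E = N ^ (E - j) * N ^ j := by
      rw [← pow_add, Nat.sub_add_cancel (by omega)]
    rw [hv, mul_pow, ← map_pow C (N : ℚ) j]
    have hC : (C ((N : ℚ) ^ E) : ℚ⟦X⟧) = C ((N : ℚ) ^ (E - j)) * C ((N : ℚ) ^ j) := by
      rw [← map_mul, ← hpow]
    linear_combination (C (N : ℚ) * X * (rescale ((N : ℚ) ^ E) (ι (S.coeff j)) *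
      rescale ((N : ℚ) ^ E) w ^ j)) * hC
  have hmem : ∀ k, v ∈ coeffSubring B k := by
    have hγ : ∀ k, (C (N * γ) : ℚ⟦X⟧) ∈ coeffSubring B k := fun k => by
      obtain ⟨z, hz⟩ := hint γ (Finset.mem_insert_self _ _)
      exact C_mem_coeffSubring ⟨z, by rw [hz]; rfl⟩
    intro k
    induction k with
    | zero =>
      rw [hfix]
      refine add_mem (hγ 0) fun i hi => ?_
      rw [Nat.le_zero.1 hi, coeff_zero_X_mul]
      exact zero_mem B
    | succ k ih =>
      rw [hfix]
      refine add_mem (hγ _) (X_mul_mem_coeffSubring (sum_mem fun j _ => mul_mem (mul_mem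
        (C_mem_coeffSubring (pow_mem hNB _)) fun i _ => ?_) (pow_mem ih j)))
      obtain ⟨z, hz⟩ := hcoeff j i
      refine ⟨(N : ℤ) ^ (E * i) * z, ?_⟩
      rw [coeff_C_mul, coeff_rescale]
      change (((N : ℤ) ^ (E * i) * z : ℤ) : ℚ) = N * ((N ^ E) ^ i * coeff i (S.coeff j : ℚ⟦X⟧))
      rw [Polynomial.coeff_coe]
      push_cast
      rw [← hz, pow_mul]
      ring
  refine ⟨N ^ (E + 1), by positivity, fun n => ?_⟩
  obtain ⟨z, hz⟩ := hmem n n le_rfl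
  refine ⟨N ^ (n + E) * z, ?_⟩
  have hz' : (z : ℚ) = N * ((N ^ E) ^ n * coeff n w) := by
    rw [← coeff_rescale, ← coeff_C_mul]
    exact hz
  push_cast
  rw [hz']
  ring

theorem exists_bound_of_fixed_point {w : ℚ⟦X⟧} {γ : ℚ} {S : Polynomial (Polynomial ℚ)}
    (hw : w = C γ + X * S.eval₂ ι w) :
    ∃ N : ℕ, 0 < N ∧ ∀ n, |coeff n w| ≤ (N : ℚ) ^ (n + 1) := by
  set ν := normRingSeminorm ℚ with hν
  have hνa : ∀ q : ℚ, ν q = |(q : ℝ)| := fun q => rfl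
  have hν1 : ν 1 ≤ 1 := by rw [hνa]; simp
  set M : ℝ := ν γ + 1 with hM
  have hM0 : 0 < M := by have := apply_nonneg ν γ; linarith
  set L : ℕ → ℝ := fun j => ∑ i ∈ (S.coeff j).support, ν ((S.coeff j).coeff i) with hL
  have hL0 : ∀ j, 0 ≤ L j := fun j => Finset.sum_nonneg fun i _ => apply_nonneg ν _
  set K : ℝ := ∑ j ∈ Finset.range (S.natDegree + 1), L j * M ^ j with hK
  have hK0 : 0 ≤ K := Finset.sum_nonneg fun j _ => mul_nonneg (hL0 j) (by positivity)
  set r : ℝ := (1 + K)⁻¹ with hr'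
  have hr : 0 ≤ r := by positivity
  have hr1 : r ≤ 1 := inv_le_one_of_one_le₀ (by linarith)
  have hrK : r * K ≤ 1 := by
    rw [hr', inv_mul_le_iff₀ (by positivity)]
    linarith
  have hpoly : ∀ k j, truncNorm ν r hr k (ι (S.coeff j)) ≤ L j := by
    intro k j
    rw [truncNorm_apply]
    have h1 : ∀ s ∈ Finset.range k, ν (coeff s (ι (S.coeff j))) * r ^ s ≤
        ν ((S.coeff j).coeff s) := by
      intro s _
      have : coeff s (ι (S.coeff j)) = (S.coeff j).coeff s := Polynomial.coeff_coe _ _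
      rw [this]
      exact mul_le_of_le_one_right (apply_nonneg ν _) (pow_le_one₀ hr hr1)
    refine (Finset.sum_le_sum h1).trans ?_
    rw [← Finset.sum_filter_of_ne (p := (· ∈ (S.coeff j).support))]
    · exact Finset.sum_le_sum_of_subset_of_nonneg (fun s hs => (Finset.mem_filter.1 hs).2)
        fun i _ _ => apply_nonneg ν _
    · intro s _ hs
      rw [Polynomial.mem_support_iff]
      rintro h
      rw [h, map_zero] at hs
      exact hs rfl
  have hX : ∀ k (u : ℚ⟦X⟧), truncNorm ν r hr (k + 1) (X * u) = r * truncNorm ν r hr k u := by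
    intro k u
    rw [truncNorm_apply, truncNorm_apply, Finset.sum_range_succ', coeff_zero_X_mul, map_zero,
      zero_mul, add_zero, Finset.mul_sum]
    refine Finset.sum_congr rfl fun i _ => ?_
    rw [coeff_succ_X_mul]
    ring
  have hbound : ∀ k, truncNorm ν r hr k w ≤ M := by
    intro k
    induction k with
    | zero =>
      rw [truncNorm_apply, Finset.sum_range_zero]
      exact hM0.le
    | succ k ih =>
      rw [hw]
      refine (map_add_le_add _ _ _).trans (add_le_add (truncNorm_C_le _ _ _ _ _) ?_)
      rw [hX]
      refine le_trans (mul_le_mul_of_nonneg_left ?_ hr) hrK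
      rw [Polynomial.eval₂_eq_sum_range, hK]
      refine (RingSeminorm.map_sum_le _ _ _).trans (Finset.sum_le_sum fun j _ => ?_)
      refine (map_mul_le_mul _ _ _).trans (mul_le_mul (hpoly k j) ?_ (apply_nonneg _ _) (hL0 j))
      rcases Nat.eq_zero_or_pos j with rfl | hj
      · rw [pow_zero, pow_zero, ← map_one C]
        exact (truncNorm_C_le _ _ _ _ _).trans hν1
      · exact (map_pow_le_pow _ _ hj.ne').trans (pow_le_pow_left₀ (apply_nonneg _ _) ih j)
  obtain ⟨N, hN⟩ := exists_nat_ge (max M (1 + K))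
  have hNM : M ≤ N := (le_max_left _ _).trans hN
  have hN0 : (0 : ℝ) < N := hM0.trans_le hNM
  refine ⟨N, by exact_mod_cast hN0, fun n => ?_⟩
  have h := (mul_pow_le_truncNorm ν r hr (Nat.lt_succ_self n) w).trans (hbound _)
  rw [hνa, hr', inv_pow, ← div_eq_mul_inv, div_le_iff₀ (by positivity)] at h
  have h2 : |((coeff n w : ℚ) : ℝ)| ≤ (N : ℝ) ^ (n + 1) := by
    rw [pow_succ']
    exact h.trans (mul_le_mul hNM (pow_le_pow_left₀ (by positivity) ((le_max_right _ _).trans hN) n)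
      (by positivity) hN0.le)
  exact_mod_cast h2

/-- Eisenstein's theorem: algebraic series have geometrically bounded denominators and
coefficients. -/
theorem isEisenstein_of_eval₂_eq_zero {g : ℚ⟦X⟧} {P : Polynomial (Polynomial ℚ)} (hP : P ≠ 0)
    (hg : P.eval₂ ι g = 0) : IsEisenstein g := by
  obtain ⟨q, c, w, γ, S, rfl, hw⟩ := exists_eq_add_X_mul_eval₂ hP hg
  obtain ⟨N, hN, h1⟩ := exists_int_of_fixed_point hw
  obtain ⟨M, hM, h2⟩ := exists_bound_of_fixed_point hw
  exact (isEisenstein_coe q).add ((IsEisenstein.of_two hN hM h1 h2).X_pow_mul c)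

end Eisenstein

section LocalSeries

variable (p : ℕ) [hp : Fact p.Prime]

/-- Rational numbers which are integral at `p`. -/
noncomputable def locSubring : Subring ℚ := (PadicInt.subring p).comap (Rat.castHom ℚ_[p])

variable {p}

theorem mem_locSubring {x : ℚ} : x ∈ locSubring p ↔ ‖(x : ℚ_[p])‖ ≤ 1 := Iff.rfl

theorem mem_locSubring_iff {x : ℚ} : x ∈ locSubring p ↔ ¬ p ∣ x.den := by
  refine ⟨fun h hd => ?_, fun h => Padic.norm_rat_le_one h⟩
  have h1 := PadicInt.isUnit_den x h
  rw [PadicInt.isUnit_iff] at h1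
  have h2 := (PadicInt.norm_lt_one_iff_dvd (x.den : ℤ_[p])).2 (Nat.cast_dvd_cast hd)
  linarith

theorem intCast_mem_locSubring (z : ℤ) : (z : ℚ) ∈ locSubring p := intCast_mem _ z

theorem mem_locSubring_of_mul_mem {q : ℕ} (hq : ¬ p ∣ q) {x : ℚ} (h : (q : ℚ) * x ∈ locSubring p) :
    x ∈ locSubring p := by
  rw [mem_locSubring] at h ⊢
  push_cast at h
  rw [norm_mul] at h
  have h1 : ‖(q : ℚ_[p])‖ = 1 := by
    have := (Padic.norm_intCast_eq_one_iff (p := p) (z := q)).2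
    rw [Int.isCoprime_iff_gcd_eq_one, Int.gcd_natCast_natCast] at this
    exact_mod_cast this ((Nat.Prime.coprime_iff_not_dvd hp.out).2 hq).symm
  rwa [h1, one_mul] at h

variable (p) in
/-- Power series with `p`-integral coefficients. -/
noncomputable def locSeries : Subring ℚ⟦X⟧ := (PowerSeries.map (locSubring p).subtype).range

theorem mem_locSeries {u : ℚ⟦X⟧} : u ∈ locSeries p ↔ ∀ n, coeff n u ∈ locSubring p := by
  constructor
  · rintro ⟨v, rfl⟩ n
    rw [PowerSeries.coeff_map]
    exact (coeff n v).2
  · intro h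
    exact ⟨PowerSeries.mk fun n => ⟨coeff n u, h n⟩, by ext n; simp⟩

theorem C_mem_locSeries {c : ℚ} (hc : c ∈ locSubring p) : C c ∈ locSeries p := by
  rw [mem_locSeries]
  intro n
  rw [coeff_C]
  split_ifs
  exacts [hc, zero_mem _]

theorem natCast_mul_coeff (k n : ℕ) (v : ℚ⟦X⟧) :
    coeff n ((k : ℚ⟦X⟧) * v) = k * coeff n v := by
  rw [← map_natCast (C : ℚ →+* ℚ⟦X⟧) k, coeff_C_mul]

variable (p) in
/-- Reduction modulo `p`. -/
noncomputable def locToZMod : locSubring p →+* ZMod p :=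
  PadicInt.toZMod.comp ((Rat.castHom ℚ_[p]).restrict (locSubring p) (PadicInt.subring p)
    fun _ hx => hx)

theorem exists_eq_of_locToZMod_eq_zero {x : locSubring p} (h : locToZMod p x = 0) :
    ∃ y : locSubring p, x = p * y := by
  have h1 : (⟨((x : ℚ) : ℚ_[p]), x.2⟩ : ℤ_[p]) ∈ RingHom.ker (PadicInt.toZMod (p := p)) := h
  rw [PadicInt.ker_toZMod, PadicInt.maximalIdeal_eq_span_p] at h1
  obtain ⟨y, hy⟩ := (Ideal.mem_span_singleton (α := ℤ_[p])).1 h1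
  have hp0 : (p : ℚ) ≠ 0 := by exact_mod_cast hp.out.ne_zero
  have hy' : ((x : ℚ) : ℚ_[p]) = p * (y : ℚ_[p]) := congrArg Subtype.val hy
  refine ⟨⟨(x : ℚ) / p, ?_⟩, ?_⟩
  · rw [mem_locSubring]
    push_cast
    rw [hy', mul_div_cancel_left₀ _ (by exact_mod_cast hp.out.ne_zero)]
    exact y.2
  · ext
    push_cast
    rw [mul_div_cancel₀ _ hp0]

theorem locSeries_pow_prime {u : ℚ⟦X⟧} (hu : u ∈ locSeries p) :
    ∃ v ∈ locSeries p, u ^ p = expand p hp.out.ne_zero u + (p : ℚ⟦X⟧) * v := by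
  obtain ⟨u, rfl⟩ := hu
  have hfrob : ∀ f : (ZMod p)⟦X⟧, expand p hp.out.ne_zero f = f ^ p := by
    intro f
    have h := MvPowerSeries.map_frobenius_expand p hp.out.ne_zero
        (f := (f : MvPowerSeries Unit (ZMod p)))
    rw [ZMod.frobenius_zmod, MvPowerSeries.map_id] at h
    exact h
  have h0 : PowerSeries.map (locToZMod p) (u ^ p - expand p hp.out.ne_zero u) = 0 := by
    rw [map_sub, map_pow, map_expand, hfrob, sub_self]
  have h1 : ∀ n, ∃ y : locSubring p, coeff n (u ^ p - expand p hp.out.ne_zero u) = p * y := by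
    intro n
    apply exists_eq_of_locToZMod_eq_zero
    rw [← PowerSeries.coeff_map, h0, map_zero]
  choose y hy using h1
  refine ⟨_, ⟨PowerSeries.mk y, rfl⟩, ?_⟩
  have h2 : u ^ p - expand p hp.out.ne_zero u = C (p : locSubring p) * PowerSeries.mk y := by
    ext n : 1
    rw [hy, coeff_C_mul, coeff_mk]
  have h3 := congrArg (PowerSeries.map (locSubring p).subtype) (eq_add_of_sub_eq' h2)
  rw [map_pow, map_add, map_expand, map_mul, map_C] at h3
  rw [h3, map_natCast, map_natCast]

theorem exists_inverse_mem_locSeries {u : ℚ⟦X⟧} (hu : u ∈ locSeries p)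
    (h0 : constantCoeff u = 1) : ∃ v ∈ locSeries p, u * v = 1 := by
  obtain ⟨u, rfl⟩ := hu
  have h : constantCoeff u = 1 := by
    ext
    rw [← coeff_zero_eq_constantCoeff_apply, PowerSeries.coeff_map] at h0
    rw [← coeff_zero_eq_constantCoeff_apply]
    exact h0
  have hu : IsUnit u := isUnit_iff_constantCoeff.2 (by rw [h]; exact isUnit_one)
  obtain ⟨v, hv⟩ := hu.exists_right_inv
  exact ⟨_, ⟨v, rfl⟩, by rw [← map_mul, hv, map_one]⟩

theorem expand_mem_locSeries {u : ℚ⟦X⟧} (hu : u ∈ locSeries p) {q : ℕ} (hq : q ≠ 0) :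
    expand q hq u ∈ locSeries p := by
  rw [mem_locSeries] at hu ⊢
  intro n
  rw [coeff_expand]
  split_ifs
  exacts [hu _, zero_mem _]

theorem derivative_expand (q : ℕ) (hq : q ≠ 0) (u : ℚ⟦X⟧) :
    derivative ℚ (expand q hq u) = (q : ℚ⟦X⟧) * (X ^ (q - 1) * expand q hq (derivative ℚ u)) := by
  ext n
  rw [coeff_derivative, coeff_expand, natCast_mul_coeff, coeff_X_pow_mul', coeff_expand]
  by_cases h : q ∣ n + 1
  · obtain ⟨k, hk⟩ := h
    obtain ⟨k, rfl⟩ : ∃ k', k = k' + 1 := ⟨k - 1, by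
      rcases k with _ | k
      · simp at hk
      · rfl⟩
    have hn : n - (q - 1) = q * k := by
      rw [mul_add, mul_one] at hk
      omega
    have hle : q - 1 ≤ n := by
      rw [mul_add, mul_one] at hk
      have : 0 < q := Nat.pos_of_ne_zero hq
      generalize q * k = m at *
      omega
    rw [if_pos ⟨_, hk⟩, if_pos hle, hn, if_pos (dvd_mul_right _ _), hk,
      Nat.mul_div_cancel_left _ (Nat.pos_of_ne_zero hq),
      Nat.mul_div_cancel_left _ (Nat.pos_of_ne_zero hq), coeff_derivative]
    have : (n : ℚ) + 1 = q * (k + 1) := by exact_mod_cast hk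
    rw [this]
    ring
  · rw [if_neg h, zero_mul]
    split_ifs with h1 h2
    · exfalso
      apply h
      have : n + 1 = q + (n - (q - 1)) := by
        have : 0 < q := Nat.pos_of_ne_zero hq
        omega
      rw [this]
      exact dvd_add dvd_rfl h2
    · rw [mul_zero]
    · rw [mul_zero]

theorem expand_odeSol (q : ℕ) (hq : q ≠ 0) (φ : ℚ⟦X⟧) : expand q hq (odeSol φ) =
    odeSol ((q : ℚ⟦X⟧) * (X ^ (q - 1) * expand q hq φ)) := by
  apply eq_odeSol
  · rw [constantCoeff_expand, constantCoeff_odeSol]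
  · rw [derivative_expand, derivative_odeSol, map_mul]
    ring

/-- The logarithmic derivative of `y ^ p / y(t ^ p)` where `y' = φ y`. -/
noncomputable def frobDefect (p : ℕ) [hp : Fact p.Prime] (φ : ℚ⟦X⟧) : ℚ⟦X⟧ :=
  (p : ℚ⟦X⟧) * (φ - X ^ (p - 1) * expand p hp.out.ne_zero φ)

theorem odeSol_frobDefect_mul (φ : ℚ⟦X⟧) :
    odeSol (frobDefect p φ) * expand p hp.out.ne_zero (odeSol φ) = odeSol φ ^ p := by
  rw [expand_odeSol, ← odeSol_add, ← odeSol_natCast_mul, frobDefect]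
  congr 1
  ring

/-- One direction of Dwork's lemma. -/
theorem exists_odeSol_frobDefect_eq {φ : ℚ⟦X⟧} (h : odeSol φ ∈ locSeries p) :
    ∃ x ∈ locSeries p, odeSol (frobDefect p φ) = 1 + (p : ℚ⟦X⟧) * x := by
  obtain ⟨v, hv, hpow⟩ := locSeries_pow_prime h
  obtain ⟨w, hw, hinv⟩ := exists_inverse_mem_locSeries
    (expand_mem_locSeries h hp.out.ne_zero) (by rw [constantCoeff_expand, constantCoeff_odeSol])
  refine ⟨v * w, mul_mem hv hw, ?_⟩
  have h1 := odeSol_frobDefect_mul (p := p) φ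
  rw [hpow] at h1
  linear_combination w * h1 + (1 - odeSol (frobDefect p φ)) * hinv

end LocalSeries

section DworkLemma

variable {p : ℕ} [hp : Fact p.Prime]

theorem pow_div_mem_locSubring {k n : ℕ} (hn : n ≠ 0) (h : n.factorization p ≤ k) :
    (p : ℚ) ^ k / n ∈ locSubring p := by
  have hn0 : (n : ℚ) ≠ 0 := by exact_mod_cast hn
  have h1 : p ^ n.factorization p * (n / p ^ n.factorization p) = n :=
      Nat.ordProj_mul_ordCompl_eq_self n p
  apply mem_locSubring_of_mul_mem (Nat.not_dvd_ordCompl hp.out hn)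
  have h2 : ((n / p ^ n.factorization p : ℕ) : ℚ) * ((p : ℚ) ^ k / n) =
      ((p ^ (k - n.factorization p) : ℕ) : ℚ) := by
    rw [mul_div_assoc', div_eq_iff hn0]
    have h3 : p ^ k = p ^ (k - n.factorization p) * p ^ n.factorization p := by
      rw [← pow_add, Nat.sub_add_cancel h]
    have h4 : (n / p ^ n.factorization p) * p ^ k = p ^ (k - n.factorization p) * n := by
      rw [h3]
      linear_combination p ^ (k - n.factorization p) * h1
    exact_mod_cast h4
  rw [h2]
  exact natCast_mem _ _

theorem pow_div_succ_mem_locSubring (j : ℕ) : (p : ℚ) ^ j / (j + 1 : ℕ) ∈ locSubring p := by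
  apply pow_div_mem_locSubring (Nat.succ_ne_zero j)
  have h1 : p ^ (j + 1).factorization p ≤ j + 1 := Nat.ordProj_le p (Nat.succ_ne_zero j)
  have h2 : j + 1 < p ^ (j + 1) := Nat.lt_pow_self hp.out.one_lt
  exact Nat.lt_succ_iff.1 ((Nat.pow_lt_pow_iff_right hp.out.one_lt).1 (h1.trans_lt h2))

theorem pow_div_factorial_mem_locSubring (j : ℕ) :
    (p : ℚ) ^ j / (j + 1).factorial ∈ locSubring p := by
  apply pow_div_mem_locSubring (Nat.factorial_ne_zero _)
  have := padicValNat_factorial_lt_of_ne_zero p (Nat.succ_ne_zero j)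
  rw [Nat.factorization_def _ hp.out]
  exact Nat.lt_succ_iff.1 this

theorem natCast_mem_locSeries (n : ℕ) : (n : ℚ⟦X⟧) ∈ locSeries p := natCast_mem _ n

theorem derivative_C_mul (c : ℚ) (u : ℚ⟦X⟧) : derivative ℚ (C c * u) = C c * derivative ℚ u := by
  ext n
  simp [coeff_derivative, coeff_C_mul]

theorem derivative_pow_succ (u : ℚ⟦X⟧) (j : ℕ) :
    derivative ℚ (u ^ (j + 1)) = C ((j + 1 : ℕ) : ℚ) * (u ^ j * derivative ℚ u) := by
  rw [Derivation.leibniz_pow, map_natCast]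
  simp [nsmul_eq_mul, smul_eq_mul]

/-- Solutions `w ≡ 1` modulo `p` have `p`-divisible logarithms. -/
theorem exists_coeff_eq_of_odeSol_eq {ψ x : ℚ⟦X⟧} (hx : x ∈ locSeries p)
    (h : odeSol ψ = 1 + (p : ℚ⟦X⟧) * x) (N : ℕ) :
    ∃ y ∈ locSubring p, coeff N ψ = ((N + 1 : ℕ) : ℚ) * p * y := by
  have hp0 : (p : ℚ) ≠ 0 := by exact_mod_cast hp.out.ne_zero
  have hC : (C (p : ℚ) : ℚ⟦X⟧) = (p : ℚ⟦X⟧) := map_natCast _ _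
  have hx0 : constantCoeff x = 0 := by
    have h1 := congrArg constantCoeff h
    rw [constantCoeff_odeSol, ← hC, map_add, map_mul, map_one, constantCoeff_C] at h1
    have h2 : (p : ℚ) * constantCoeff x = 0 := by linarith
    exact (mul_eq_zero.1 h2).resolve_left hp0
  have hXx : X ∣ x := X_dvd_iff.2 hx0
  set M : ℚ⟦X⟧ := ∑ j ∈ Finset.range (N + 1),
    C ((p : ℚ) ^ j / (j + 1 : ℕ)) * ((-1) ^ j * x ^ (j + 1)) with hM
  have hMmem : M ∈ locSeries p := by
    rw [hM]
    refine sum_mem fun j _ => mul_mem (C_mem_locSeries (pow_div_succ_mem_locSubring j))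
      (mul_mem (pow_mem (neg_mem (one_mem _)) _) (pow_mem hx _))
  have hM' : derivative ℚ M = derivative ℚ x * ∑ j ∈ Finset.range (N + 1),
      (-((p : ℚ⟦X⟧) * x)) ^ j := by
    rw [hM, map_sum, Finset.mul_sum]
    refine Finset.sum_congr rfl fun j _ => ?_
    have hj : ((j + 1 : ℕ) : ℚ) ≠ 0 := by positivity
    have h1 : ((-1 : ℚ⟦X⟧)) ^ j = C ((-1 : ℚ) ^ j) := by simp
    rw [derivative_C_mul, h1, derivative_C_mul, derivative_pow_succ, ← hC]
    have h2 : (C ((p : ℚ) ^ j / (j + 1 : ℕ)) : ℚ⟦X⟧) * C ((j + 1 : ℕ) : ℚ) = C (p : ℚ) ^ j := by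
      rw [← map_mul, div_mul_cancel₀ _ hj, map_pow]
    rw [neg_pow (C (p : ℚ) * x), mul_pow, ← h2, ← h1]
    ring
  have hode : derivative ℚ (odeSol ψ) = ψ * odeSol ψ := derivative_odeSol ψ
  have hxd : derivative ℚ (odeSol ψ) = (p : ℚ⟦X⟧) * derivative ℚ x := by
    rw [h, map_add, ← hC, derivative_C_mul]
    simp
  have hgeom : (∑ j ∈ Finset.range (N + 1), (-((p : ℚ⟦X⟧) * x)) ^ j) * (1 + (p : ℚ⟦X⟧) * x) =
      1 - (-((p : ℚ⟦X⟧) * x)) ^ (N + 1) := by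
    have := mul_neg_geom_sum (-((p : ℚ⟦X⟧) * x)) (N + 1)
    rw [← this]
    ring
  have hdvd : X ^ (N + 1) ∣ ((p : ℚ⟦X⟧) * derivative ℚ M - ψ) * (1 + (p : ℚ⟦X⟧) * x) := by
    have : ((p : ℚ⟦X⟧) * derivative ℚ M - ψ) * (1 + (p : ℚ⟦X⟧) * x) =
        -((p : ℚ⟦X⟧) * derivative ℚ x) * (-((p : ℚ⟦X⟧) * x)) ^ (N + 1) := by
      rw [hM', ← h]
      rw [hxd] at hode
      rw [← h] at hgeom
      linear_combination (p : ℚ⟦X⟧) * derivative ℚ x * hgeom + hode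
    rw [this]
    refine Dvd.dvd.mul_left (pow_dvd_pow_of_dvd ?_ _) _
    exact (dvd_neg).2 (Dvd.dvd.mul_left hXx _)
  have hunit : IsUnit (1 + (p : ℚ⟦X⟧) * x) := by
    rw [← h, isUnit_iff_constantCoeff, constantCoeff_odeSol]
    exact isUnit_one
  have hdvd' := (hunit.dvd_mul_right).1 hdvd
  have hc := coeff_eq_of_dvd_sub hdvd' (Nat.lt_succ_self N)
  refine ⟨coeff (N + 1) M, mem_locSeries.1 hMmem _, ?_⟩
  rw [← hc, natCast_mul_coeff, coeff_derivative]
  push_cast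
  ring

/-- A `p`-integral solution forces the strong congruences. -/
theorem exists_coeff_sub_eq_of_odeSol_mem {φ : ℚ⟦X⟧} (h : odeSol φ ∈ locSeries p) {n : ℕ}
    (hn : 1 ≤ n) : ∃ y ∈ locSubring p,
      coeff (n * p - 1) φ - coeff (n - 1) φ = (n : ℚ) * p * y := by
  obtain ⟨x, hx, hxe⟩ := exists_odeSol_frobDefect_eq h
  obtain ⟨y, hy, hye⟩ := exists_coeff_eq_of_odeSol_eq hx hxe (n * p - 1)
  refine ⟨y, hy, ?_⟩
  have hp0 : (p : ℚ) ≠ 0 := by exact_mod_cast hp.out.ne_zero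
  have hpos := hp.out.pos
  have h1 : n * p - 1 + 1 = n * p := Nat.sub_add_cancel (Nat.mul_pos hn hpos)
  have h2 : n * p - 1 - (p - 1) = p * (n - 1) := by
    obtain ⟨n, rfl⟩ : ∃ k, n = k + 1 := ⟨n - 1, by omega⟩
    rw [Nat.add_sub_cancel, add_mul, one_mul, mul_comm p n]
    omega
  have h3 : p - 1 ≤ n * p - 1 := Nat.sub_le_sub_right (Nat.le_mul_of_pos_left p hn) 1
  rw [h1, frobDefect, natCast_mul_coeff, map_sub, coeff_X_pow_mul', if_pos h3, h2, coeff_expand,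
    if_pos (dvd_mul_right _ _), Nat.mul_div_cancel_left _ hpos] at hye
  apply mul_left_cancel₀ hp0
  rw [hye]
  push_cast
  ring

end DworkLemma

section DworkConverse

variable {p : ℕ} [hp : Fact p.Prime]

theorem coeff_X_pow_mul_expand {q : ℕ} (hq : q ≠ 0) (u : ℚ⟦X⟧) (i : ℕ) :
    coeff i (X ^ (q - 1) * expand q hq u) =
      if q ∣ i + 1 then coeff ((i + 1) / q - 1) u else 0 := by
  have hpos : 0 < q := Nat.pos_of_ne_zero hq
  rw [coeff_X_pow_mul', coeff_expand]
  by_cases h : q ∣ i + 1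
  · have hle : q - 1 ≤ i := by
      have := Nat.le_of_dvd (Nat.succ_pos i) h
      omega
    have he : i + 1 = i - (q - 1) + q := by omega
    have hd : q ∣ i - (q - 1) := by
      rw [he] at h
      exact (Nat.dvd_add_left dvd_rfl).1 h
    rw [if_pos hle, if_pos hd, if_pos h, he, Nat.add_div_right _ hpos, Nat.succ_sub_one]
  · rw [if_neg h]
    split_ifs with h1 h2
    · exfalso
      apply h
      have he : i + 1 = i - (q - 1) + q := by omega
      rw [he]
      exact dvd_add h2 dvd_rfl
    · rfl
    · rfl

/-- The exponential of a `p`-divisible series is `1` modulo `p`. -/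
theorem exists_odeSol_eq_of_derivative {M : ℚ⟦X⟧} (hM : M ∈ locSeries p)
    (h0 : constantCoeff M = 0) :
    ∃ x ∈ locSeries p, odeSol ((p : ℚ⟦X⟧) * derivative ℚ M) = 1 + (p : ℚ⟦X⟧) * x := by
  have hC : (C (p : ℚ) : ℚ⟦X⟧) = (p : ℚ⟦X⟧) := map_natCast _ _
  have hXM : X ∣ M := X_dvd_iff.2 h0
  set ψ : ℚ⟦X⟧ := (p : ℚ⟦X⟧) * derivative ℚ M with hψ
  set V : ℕ → ℚ⟦X⟧ := fun J => ∑ j ∈ Finset.range J,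
    C ((p : ℚ) ^ j / (j + 1).factorial) * M ^ (j + 1) with hV
  have hVmem : ∀ J, V J ∈ locSeries p := fun J => sum_mem fun j _ =>
    mul_mem (C_mem_locSeries (pow_div_factorial_mem_locSubring j)) (pow_mem hM _)
  have hder : ∀ J, derivative ℚ (V J) = derivative ℚ M *
      ∑ j ∈ Finset.range J, C ((p : ℚ) ^ j / j.factorial) * M ^ j := by
    intro J
    rw [hV, map_sum, Finset.mul_sum]
    refine Finset.sum_congr rfl fun j _ => ?_
    rw [derivative_C_mul, derivative_pow_succ]
    have h2 : (C ((p : ℚ) ^ j / (j + 1).factorial) : ℚ⟦X⟧) * C ((j + 1 : ℕ) : ℚ) =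
        C ((p : ℚ) ^ j / j.factorial) := by
      rw [← map_mul, Nat.factorial_succ]
      congr 1
      have h3 : ((j + 1 : ℕ) : ℚ) ≠ 0 := by positivity
      have h4 : (j.factorial : ℚ) ≠ 0 := by positivity
      rw [Nat.cast_mul]
      field_simp
    rw [← h2]
    ring
  have hexp : ∀ J, 1 + (p : ℚ⟦X⟧) * V J = ∑ j ∈ Finset.range (J + 1),
      C ((p : ℚ) ^ j / j.factorial) * M ^ j := by
    intro J
    rw [Finset.sum_range_succ', hV, Finset.mul_sum, add_comm]
    refine congrArg₂ (· + ·) (Finset.sum_congr rfl fun j _ => ?_) (by simp)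
    rw [← mul_assoc, ← hC, ← map_mul, ← mul_div_assoc, ← pow_succ' (p : ℚ)]
  have hdvd : ∀ J, X ^ J ∣ derivative ℚ (1 + (p : ℚ⟦X⟧) * V J) - ψ * (1 + (p : ℚ⟦X⟧) * V J) := by
    intro J
    have h1 : derivative ℚ (1 + (p : ℚ⟦X⟧) * V J) = (p : ℚ⟦X⟧) * derivative ℚ (V J) := by
      rw [map_add, ← hC, derivative_C_mul]
      simp
    have h2 : derivative ℚ (1 + (p : ℚ⟦X⟧) * V J) - ψ * (1 + (p : ℚ⟦X⟧) * V J) =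
        -(ψ * C ((p : ℚ) ^ J / J.factorial)) * M ^ J := by
      rw [h1, hder, hexp, Finset.sum_range_succ, hψ]
      ring
    rw [h2]
    exact Dvd.dvd.mul_left (pow_dvd_pow_of_dvd hXM _) _
  have h1 : ∀ J, constantCoeff (1 + (p : ℚ⟦X⟧) * V J) = 1 := by
    intro J
    have hz : constantCoeff (V J) = 0 := by
      rw [hV, map_sum]
      refine Finset.sum_eq_zero fun j _ => ?_
      rw [map_mul, map_pow, h0]
      simp
    rw [map_add, map_mul, hz, mul_zero, add_zero, map_one]
  refine ⟨PowerSeries.mk fun n => coeff n (V n), mem_locSeries.2 fun n => ?_, ?_⟩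
  · rw [coeff_mk]
    exact mem_locSeries.1 (hVmem n) n
  · ext n
    rw [← coeff_eq_of_dvd_sub (coeff_odeSol_congr (h1 n) (hdvd n)) (Nat.lt_succ_self n), map_add,
      map_add, natCast_mul_coeff, natCast_mul_coeff, coeff_mk]

/-- Dwork's integrality criterion. -/
theorem odeSol_mem_locSeries {φ x : ℚ⟦X⟧} (hx : x ∈ locSeries p)
    (h : odeSol (frobDefect p φ) = 1 + (p : ℚ⟦X⟧) * x) : odeSol φ ∈ locSeries p := by
  have hp0 : (p : ℚ) ≠ 0 := by exact_mod_cast hp.out.ne_zero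
  rw [mem_locSeries]
  intro n
  have hmain := odeSol_frobDefect_mul (p := p) φ
  rw [h] at hmain
  have hy0 := constantCoeff_odeSol φ
  generalize odeSol φ = y at *
  induction n using Nat.strong_induction_on with
  | _ n ih =>
    rcases Nat.eq_zero_or_pos n with rfl | hn
    · rw [coeff_zero_eq_constantCoeff_apply, hy0]
      exact one_mem _
    set u : ℚ⟦X⟧ := (trunc n y : ℚ⟦X⟧) with hu
    have hucoeff : ∀ k, coeff k u = if k < n then coeff k y else 0 := fun k => by
      rw [hu, Polynomial.coeff_coe, coeff_trunc]
    have humem : u ∈ locSeries p := by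
      rw [mem_locSeries]
      intro k
      rw [hucoeff]
      split_ifs with hk
      exacts [ih k hk, zero_mem _]
    obtain ⟨z, hz⟩ : X ^ n ∣ y - u := by
      rw [X_pow_dvd_iff]
      intro k hk
      rw [map_sub, hucoeff, if_pos hk, sub_self]
    have hyu : y = u + X ^ n * z := by rw [← hz]; ring
    have hz0 : coeff n y = constantCoeff z := by
      rw [hyu, map_add, hucoeff, if_neg (lt_irrefl n), zero_add, coeff_X_pow_mul', if_pos le_rfl,
        Nat.sub_self, coeff_zero_eq_constantCoeff_apply]
    have hu0 : constantCoeff u = 1 := by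
      rw [← coeff_zero_eq_constantCoeff_apply, hucoeff, if_pos hn,
        coeff_zero_eq_constantCoeff_apply, hy0]
    obtain ⟨v, hv, hpow⟩ := locSeries_pow_prime humem
    obtain ⟨k, hk⟩ := Polynomial.powAddExpansion u (X ^ n * z) p
    rw [← hyu] at hk
    have hexp : expand p hp.out.ne_zero y =
        expand p hp.out.ne_zero u + X ^ (p * n) * expand p hp.out.ne_zero z := by
      rw [hyu, map_add, map_mul, map_pow, expand_X, pow_mul]
    have hcoeff : coeff n ((p : ℚ⟦X⟧) * (X ^ n * (u ^ (p - 1) * z))) =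
        coeff n ((p : ℚ⟦X⟧) * (x * expand p hp.out.ne_zero u - v)) := by
      apply coeff_eq_of_dvd_sub (d := n + 1) _ (Nat.lt_succ_self n)
      have hpn : n + 1 ≤ p * n := by nlinarith [hp.out.two_le]
      have h2n : n + 1 ≤ n * 2 := by omega
      have e : (p : ℚ⟦X⟧) * (X ^ n * (u ^ (p - 1) * z)) -
          (p : ℚ⟦X⟧) * (x * expand p hp.out.ne_zero u - v) =
          X ^ (p * n) * ((1 + (p : ℚ⟦X⟧) * x) * expand p hp.out.ne_zero z) -
            X ^ (n * 2) * (k * z ^ 2) := by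
        rw [pow_mul X n 2]
        linear_combination (1 + (p : ℚ⟦X⟧) * x) * hexp - hmain - hk - hpow
      rw [e]
      exact dvd_sub (Dvd.dvd.mul_right (pow_dvd_pow _ hpn) _)
        (Dvd.dvd.mul_right (pow_dvd_pow _ h2n) _)
    rw [natCast_mul_coeff, natCast_mul_coeff] at hcoeff
    have h3 := mul_left_cancel₀ hp0 hcoeff
    rw [coeff_X_pow_mul', if_pos le_rfl, Nat.sub_self, coeff_zero_eq_constantCoeff_apply, map_mul,
      map_pow, hu0, one_pow, one_mul] at h3
    rw [hz0, h3]
    exact mem_locSeries.1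
      (sub_mem (mul_mem hx (expand_mem_locSeries humem hp.out.ne_zero)) hv) n

variable (p) in
/-- The series with coefficients `a_{n}` replaced by `a_{n'}`, `n'` the prime-to-`p` part of `n`. -/
noncomputable def frobStable (φ : ℚ⟦X⟧) : ℚ⟦X⟧ :=
  PowerSeries.mk fun i => coeff (ordCompl[p] (i + 1) - 1) φ

theorem odeSol_frobStable_mem {φ : ℚ⟦X⟧} (hφ : φ ∈ locSeries p) :
    odeSol (frobStable p φ) ∈ locSeries p := by
  set M : ℚ⟦X⟧ := PowerSeries.mk fun i => if p ∣ i then 0 else coeff (i - 1) φ / i with hMdef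
  have hM : M ∈ locSeries p := by
    rw [mem_locSeries]
    intro i
    rw [hMdef, coeff_mk]
    split_ifs with h
    · exact zero_mem _
    · apply mem_locSubring_of_mul_mem h
      have hi : (i : ℚ) ≠ 0 := by
        rintro h0
        apply h
        rw [Nat.cast_eq_zero.1 h0]
        exact dvd_zero _
      rw [mul_div_cancel₀ _ hi]
      exact mem_locSeries.1 hφ _
  have h0 : constantCoeff M = 0 := by
    rw [← coeff_zero_eq_constantCoeff_apply, hMdef, coeff_mk, if_pos (dvd_zero _)]
  obtain ⟨x, hx, hxe⟩ := exists_odeSol_eq_of_derivative hM h0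
  refine odeSol_mem_locSeries hx ?_
  rw [← hxe]
  congr 1
  rw [frobDefect]
  congr 1
  ext i
  rw [map_sub, coeff_X_pow_mul_expand, coeff_derivative, hMdef, coeff_mk, frobStable, coeff_mk,
    coeff_mk]
  by_cases h : p ∣ i + 1
  · have h1 : (i + 1) / p - 1 + 1 = (i + 1) / p :=
      Nat.sub_add_cancel (Nat.div_pos (Nat.le_of_dvd (Nat.succ_pos i) h) hp.out.pos)
    rw [if_pos h, if_pos h, h1, Nat.ordCompl_div_of_dvd hp.out h, sub_self, zero_mul]
  · have h1 : ordCompl[p] (i + 1) = i + 1 :=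
      (Nat.ordCompl_eq_self_iff_zero_or_not_dvd _ hp.out).2 (Or.inr h)
    have h2 : ((i : ℚ) + 1) ≠ 0 := by positivity
    rw [if_neg h, if_neg h, h1, sub_zero, Nat.add_sub_cancel]
    push_cast
    rw [div_mul_cancel₀ _ h2]

theorem exists_eq_frobStable_add {φ : ℚ⟦X⟧}
    (h : ∀ n : ℕ, 1 ≤ n → ∃ y ∈ locSubring p,
      coeff (n * p - 1) φ - coeff (n - 1) φ = p * y) :
    ∃ η ∈ locSeries p, φ = frobStable p φ +
      (p : ℚ⟦X⟧) * (X ^ (p - 1) * expand p hp.out.ne_zero η) := by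
  have hp0 : (p : ℚ) ≠ 0 := by exact_mod_cast hp.out.ne_zero
  have key : ∀ n : ℕ, 1 ≤ n → ∃ y ∈ locSubring p,
      coeff (n - 1) φ - coeff (ordCompl[p] n - 1) φ = p * y := by
    intro n
    induction n using Nat.strong_induction_on with
    | _ n ih =>
      intro hn
      by_cases hd : p ∣ n
      · obtain ⟨m, rfl⟩ := hd
        have hm : 1 ≤ m := by
          rcases m with _ | m
          · simp at hn
          · omega
        obtain ⟨y, hy, hye⟩ := h m hm
        obtain ⟨z, hz, hze⟩ := ih m (by nlinarith [hp.out.two_le]) hm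
        have h1 := Nat.ordCompl_div_of_dvd hp.out (dvd_mul_right p m)
        rw [Nat.mul_div_cancel_left _ hp.out.pos] at h1
        refine ⟨y + z, add_mem hy hz, ?_⟩
        rw [← h1, mul_comm p m]
        linear_combination hye + hze
      · rw [(Nat.ordCompl_eq_self_iff_zero_or_not_dvd _ hp.out).2 (Or.inr hd)]
        exact ⟨0, zero_mem _, by simp⟩
  choose! y hy hye using key
  refine ⟨PowerSeries.mk fun i => y (p * (i + 1)), mem_locSeries.2 fun i => ?_, ?_⟩
  · rw [coeff_mk]
    exact hy _ (Nat.mul_pos hp.out.pos (Nat.succ_pos i))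
  · ext i
    rw [map_add, natCast_mul_coeff, coeff_X_pow_mul_expand, frobStable, coeff_mk, coeff_mk]
    by_cases hd : p ∣ i + 1
    · have h1 := hye (i + 1) (Nat.succ_pos i)
      rw [Nat.add_sub_cancel] at h1
      have h2 : (i + 1) / p - 1 + 1 = (i + 1) / p :=
        Nat.sub_add_cancel (Nat.div_pos (Nat.le_of_dvd (Nat.succ_pos i) hd) hp.out.pos)
      rw [if_pos hd, h2, Nat.mul_div_cancel' hd, ← h1]
      ring
    · rw [if_neg hd, mul_zero, add_zero,
        (Nat.ordCompl_eq_self_iff_zero_or_not_dvd _ hp.out).2 (Or.inr hd), Nat.add_sub_cancel]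

theorem factorial_mul_coeff_odeSol_mem (S : Subring ℚ) {η : ℚ⟦X⟧} {N : ℕ}
    (hη : ∀ i, (N : ℚ) ^ (i + 1) * coeff i η ∈ S) (j : ℕ) :
    (j.factorial : ℚ) * (N : ℚ) ^ j * coeff j (odeSol η) ∈ S := by
  induction j using Nat.strong_induction_on with
  | _ j ih =>
    rcases j with _ | j
    · simp [coeff_zero_eq_constantCoeff_apply, constantCoeff_odeSol, one_mem]
    · rw [coeff_succ_odeSol, smul_eq_mul, Nat.factorial_succ]
      have h0 : ((j + 1 : ℕ) : ℚ) ≠ 0 := by positivity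
      have e : (((j + 1) * j.factorial : ℕ) : ℚ) * (N : ℚ) ^ (j + 1) * ((j + 1 : ℚ)⁻¹ *
          ∑ i ∈ Finset.range (j + 1), coeff (j - i) η * coeff i (odeSol η)) =
          ∑ i ∈ Finset.range (j + 1), ((j.factorial / i.factorial : ℕ) : ℚ) *
            (((N : ℚ) ^ (j - i + 1) * coeff (j - i) η) *
              ((i.factorial : ℚ) * (N : ℚ) ^ i * coeff i (odeSol η))) := by
        have h1 : (((j + 1) * j.factorial : ℕ) : ℚ) * (N : ℚ) ^ (j + 1) * ((j + 1 : ℚ)⁻¹ *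
          ∑ i ∈ Finset.range (j + 1), coeff (j - i) η * coeff i (odeSol η)) =
          (j.factorial : ℚ) * (N : ℚ) ^ (j + 1) *
          ∑ i ∈ Finset.range (j + 1), coeff (j - i) η * coeff i (odeSol η) := by
          push_cast at h0 ⊢
          field_simp
        rw [h1, Finset.mul_sum]
        refine Finset.sum_congr rfl fun i hi => ?_
        have hij : i ≤ j := Nat.lt_succ_iff.1 (Finset.mem_range.1 hi)
        have h2 : ((j.factorial / i.factorial : ℕ) : ℚ) * (i.factorial : ℚ) = j.factorial := by
          rw [← Nat.cast_mul, Nat.div_mul_cancel (Nat.factorial_dvd_factorial hij)]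
        have h3 : (N : ℚ) ^ (j + 1) = (N : ℚ) ^ (j - i + 1) * (N : ℚ) ^ i := by
          rw [← pow_add]
          congr 1
          omega
        rw [← h2, h3]
        ring
      rw [e]
      exact sum_mem fun i hi => mul_mem (natCast_mem _ _) (mul_mem (hη _)
        (ih i (Finset.mem_range.1 hi)))

/-- Denominators of the powers of a solution at a prime where the congruences hold. -/
theorem factorial_div_mul_coeff_odeSol_pow_mem {φ : ℚ⟦X⟧} (hφ : φ ∈ locSeries p)
    (h : ∀ n : ℕ, 1 ≤ n → ∃ y ∈ locSubring p,
      coeff (n * p - 1) φ - coeff (n - 1) φ = p * y) (b : ℕ) {j J : ℕ} (hj : j ≤ J) :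
    ((J / p).factorial : ℚ) * coeff j (odeSol φ ^ b) ∈ locSubring p := by
  obtain ⟨η, hη, he⟩ := exists_eq_frobStable_add h
  have h1 : odeSol φ ^ b = odeSol (frobStable p φ) ^ b *
      expand p hp.out.ne_zero (odeSol ((b : ℚ⟦X⟧) * η)) := by
    conv_lhs => rw [he]
    rw [odeSol_add, ← expand_odeSol, mul_pow, odeSol_natCast_mul, map_pow]
  rw [h1, coeff_mul, Finset.mul_sum]
  refine sum_mem fun x hx => ?_
  have hx' := Finset.HasAntidiagonal.mem_antidiagonal.1 hx
  rw [coeff_expand]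
  split_ifs with hd
  · obtain ⟨k, hk⟩ := hd
    rw [hk, Nat.mul_div_cancel_left _ hp.out.pos]
    have hkJ : k ≤ J / p := by
      rw [Nat.le_div_iff_mul_le hp.out.pos, mul_comm]
      omega
    have h2 : (((J / p).factorial / k.factorial : ℕ) : ℚ) * (k.factorial : ℚ) =
        (J / p).factorial := by
      rw [← Nat.cast_mul, Nat.div_mul_cancel (Nat.factorial_dvd_factorial hkJ)]
    have h3 := factorial_mul_coeff_odeSol_mem (locSubring p) (η := (b : ℚ⟦X⟧) * η) (N := 1)
      (fun i => by
        rw [Nat.cast_one, one_pow, one_mul]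
        exact mem_locSeries.1 (mul_mem (natCast_mem_locSeries b) hη) i) k
    rw [Nat.cast_one, one_pow, mul_one] at h3
    have h4 : ((J / p).factorial : ℚ) * (coeff x.1 (odeSol (frobStable p φ) ^ b) *
        coeff k (odeSol ((b : ℚ⟦X⟧) * η))) = (((J / p).factorial / k.factorial : ℕ) : ℚ) *
        (coeff x.1 (odeSol (frobStable p φ) ^ b) *
          ((k.factorial : ℚ) * coeff k (odeSol ((b : ℚ⟦X⟧) * η)))) := by
      rw [← h2]
      ring
    rw [h4]
    exact mul_mem (natCast_mem _ _)
      (mul_mem (mem_locSeries.1 (pow_mem (odeSol_frobStable_mem hφ) b) _) h3)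
  · rw [mul_zero, mul_zero]
    exact zero_mem _

end DworkConverse

section GlobalBound

theorem exists_int_of_forall_mem_locSubring {x : ℚ}
    (h : ∀ (p : ℕ) (_ : Fact p.Prime), x ∈ locSubring p) : ∃ z : ℤ, x = z := by
  refine ⟨x.num, ?_⟩
  have h1 : x.den = 1 := by
    by_contra hne
    obtain ⟨p, hp, hd⟩ := Nat.exists_prime_and_dvd hne
    have : Fact p.Prime := ⟨hp⟩
    exact mem_locSubring_iff.1 (h p ⟨hp⟩) hd
  exact (Rat.den_eq_one_iff x).1 h1 |>.symm

theorem pow_factorization_mul_mem {p : ℕ} [hp : Fact p.Prime] {m : ℕ} (hm : m ≠ 0) {x : ℚ}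
    (h : (m : ℚ) * x ∈ locSubring p) : ((p ^ m.factorization p : ℕ) : ℚ) * x ∈ locSubring p := by
  apply mem_locSubring_of_mul_mem (Nat.not_dvd_ordCompl hp.out hm)
  rw [← mul_assoc, ← Nat.cast_mul, mul_comm (m / _), Nat.ordProj_mul_ordCompl_eq_self]
  exact h

/-- Exponent of `p` in the common denominator. -/
noncomputable def denExponent (B J p : ℕ) : ℕ :=
  if p < B then J.factorial.factorization p else (J / p).factorial.factorization p

/-- Common denominator of the coefficients of order at most `J` of all powers of the solution. -/
noncomputable def commonDen (N B J : ℕ) : ℕ :=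
  N ^ J * ∏ p ∈ Nat.primesBelow (J + 1 + B), p ^ denExponent B J p

theorem commonDen_pos {N : ℕ} (hN : 0 < N) (B J : ℕ) : 0 < commonDen N B J :=
  Nat.mul_pos (pow_pos hN _) (Finset.prod_pos fun _ hp =>
    pow_pos (Nat.prime_of_mem_primesBelow hp).pos _)

theorem pow_denExponent_dvd (B J : ℕ) {p : ℕ} (hp : p.Prime) :
    p ^ denExponent B J p ∣ ∏ p ∈ Nat.primesBelow (J + 1 + B), p ^ denExponent B J p := by
  by_cases h : p < J + 1 + B
  · exact Finset.dvd_prod_of_mem _ (Nat.mem_primesBelow.2 ⟨h, hp⟩)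
  · have h1 : denExponent B J p = 0 := by
      rw [denExponent, if_neg (by omega), Nat.div_eq_of_lt (by omega)]
      simp
    rw [h1, pow_zero]
    exact one_dvd _

theorem exists_commonDen_le (N B : ℕ) (hN : 0 < N) :
    ∃ C : ℝ, 1 ≤ C ∧ ∀ J, (commonDen N B J : ℝ) ≤ C ^ J := by
  set w : ℕ → ℝ := fun n => 4 * (n : ℝ) ^ (-(3 / 2) : ℝ) with hw
  have hsum : Summable w := (Real.summable_nat_rpow.2 (by norm_num)).mul_left 4
  have hw0 : ∀ n, 0 ≤ w n := fun n => by positivity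
  have hprime : ∀ (J p : ℕ), p.Prime → ((p ^ denExponent B J p : ℕ) : ℝ) ≤
      (if p < B then (p : ℝ) ^ J else 1) * Real.exp (J * w p) := by
    intro J p hp
    have hp1 : (1 : ℝ) ≤ p := by exact_mod_cast hp.one_lt.le
    have hp0 : (0 : ℝ) < p := by linarith
    rw [denExponent]
    split_ifs with h
    · have h1 : J.factorial.factorization p ≤ J :=
          (Nat.factorization_factorial_le_div_pred hp J).trans
        (Nat.div_le_self _ _)
      have h2 : (1 : ℝ) ≤ Real.exp (J * w p) := Real.one_le_exp (mul_nonneg (by positivity) (hw0 p))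
      rw [Nat.cast_pow]
      calc (p : ℝ) ^ J.factorial.factorization p ≤ (p : ℝ) ^ J := pow_le_pow_right₀ hp1 h1
        _ ≤ (p : ℝ) ^ J * Real.exp (J * w p) := le_mul_of_one_le_right (by positivity) h2
    · rw [one_mul, Nat.cast_pow, ← Real.rpow_natCast, Real.rpow_def_of_pos hp0]
      apply Real.exp_le_exp.2
      set e := (J / p).factorial.factorization p
      have h1 : e ≤ (J / p) / (p - 1) := Nat.factorization_factorial_le_div_pred hp _
      have h2 : e * (p * (p - 1)) ≤ J := by
        rw [Nat.div_div_eq_div_mul] at h1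
        exact (Nat.mul_le_mul_right _ h1).trans (Nat.div_mul_le_self _ _)
      have h3 : (p : ℝ) ^ 2 ≤ 2 * (p * (p - 1)) := by
        have : (2 : ℝ) ≤ p := by exact_mod_cast hp.two_le
        nlinarith
      have h4 : (e : ℝ) * (p * (p - 1)) ≤ J := by
        have h5 : (((e * (p * (p - 1)) : ℕ)) : ℝ) ≤ J := by exact_mod_cast h2
        rwa [Nat.cast_mul, Nat.cast_mul, Nat.cast_sub hp.one_lt.le, Nat.cast_one] at h5
      have h5 : (e : ℝ) * p ^ 2 ≤ 2 * J := by
        have : (e : ℝ) * p ^ 2 ≤ e * (2 * (p * (p - 1))) :=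
          mul_le_mul_of_nonneg_left h3 (by positivity)
        linarith
      have h6 : Real.log p ≤ 2 * (p : ℝ) ^ (1 / 2 : ℝ) := by
        have := Real.log_le_rpow_div hp0.le (show (0 : ℝ) < 1 / 2 by norm_num)
        linarith
      have h7 : (p : ℝ) ^ (1 / 2 : ℝ) = (p : ℝ) ^ 2 * (p : ℝ) ^ (-(3 / 2) : ℝ) := by
        rw [← Real.rpow_natCast (p : ℝ) 2, ← Real.rpow_add hp0]
        norm_num
      calc Real.log p * e ≤ 2 * (p : ℝ) ^ (1 / 2 : ℝ) * e :=
            mul_le_mul_of_nonneg_right h6 (by positivity)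
        _ = 2 * (p : ℝ) ^ (-(3 / 2) : ℝ) * (e * p ^ 2) := by rw [h7]; ring
        _ ≤ 2 * (p : ℝ) ^ (-(3 / 2) : ℝ) * (2 * J) :=
            mul_le_mul_of_nonneg_left h5 (by positivity)
        _ = J * w p := by rw [hw]; ring
  have hNr : (1 : ℝ) ≤ N := by exact_mod_cast hN
  have hB : (1 : ℝ) ≤ (∏ p ∈ Nat.primesBelow B, p : ℕ) := by
    exact_mod_cast Finset.prod_pos fun p hp => (Nat.prime_of_mem_primesBelow hp).pos
  have hT : (1 : ℝ) ≤ Real.exp (∑' n, w n) := Real.one_le_exp (tsum_nonneg hw0)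
  refine ⟨N * (∏ p ∈ Nat.primesBelow B, p : ℕ) * Real.exp (∑' n, w n),
    one_le_mul_of_one_le_of_one_le (one_le_mul_of_one_le_of_one_le hNr hB) hT, fun J => ?_⟩
  rw [commonDen, Nat.cast_mul, Nat.cast_pow, mul_pow, mul_pow, mul_assoc]
  refine mul_le_mul_of_nonneg_left ?_ (by positivity)
  rw [Nat.cast_prod]
  refine (Finset.prod_le_prod (fun _ _ => by positivity) fun p hp =>
    hprime J p (Nat.prime_of_mem_primesBelow hp)).trans ?_
  rw [Finset.prod_mul_distrib]
  refine mul_le_mul ?_ ?_ (by positivity) (by positivity)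
  · rw [← Finset.prod_filter]
    have : (Nat.primesBelow (J + 1 + B)).filter (· < B) = Nat.primesBelow B := by
      ext p
      simp only [Finset.mem_filter, Nat.mem_primesBelow]
      constructor
      · rintro ⟨⟨_, h1⟩, h2⟩
        exact ⟨h2, h1⟩
      · rintro ⟨h2, h1⟩
        exact ⟨⟨by omega, h1⟩, h2⟩
    rw [this, Nat.cast_prod, Finset.prod_pow]
  · rw [← Real.exp_sum, ← Finset.mul_sum, ← Real.exp_nat_mul]
    exact Real.exp_le_exp.2 (mul_le_mul_of_nonneg_left
      (hsum.sum_le_tsum _ fun n _ => hw0 n) (by positivity))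

theorem abs_coeff_pow_le {y : ℚ⟦X⟧} {N : ℕ} (hy : ∀ j, |((coeff j y : ℚ) : ℝ)| ≤ (N : ℝ) ^ j)
    (b j : ℕ) : |((coeff j (y ^ b) : ℚ) : ℝ)| ≤ 2 ^ b * (2 * N : ℝ) ^ j := by
  induction b generalizing j with
  | zero =>
    rw [pow_zero, coeff_one]
    split_ifs with h
    · subst h
      simp
    · simp only [Rat.cast_zero, abs_zero]
      positivity
  | succ b ih =>
    rw [pow_succ', coeff_mul_eq_sum_range, Rat.cast_sum]
    refine (Finset.abs_sum_le_sum_abs _ _).trans ?_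
    have h1 : ∀ i ∈ Finset.range (j + 1), |((coeff (j - i) y * coeff i (y ^ b) : ℚ) : ℝ)| ≤
        (2 ^ b * (N : ℝ) ^ j) * 2 ^ i := by
      intro i hi
      have hij : i ≤ j := Nat.lt_succ_iff.1 (Finset.mem_range.1 hi)
      rw [Rat.cast_mul, abs_mul]
      refine (mul_le_mul (hy (j - i)) (ih i) (abs_nonneg _) (by positivity)).trans_eq ?_
      have h2 : (N : ℝ) ^ j = (N : ℝ) ^ (j - i) * (N : ℝ) ^ i := by
        rw [← pow_add, Nat.sub_add_cancel hij]
      rw [h2, mul_pow]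
      ring
    refine (Finset.sum_le_sum h1).trans ?_
    rw [← Finset.mul_sum, geom_sum_eq (by norm_num : (2 : ℝ) ≠ 1), mul_pow]
    have h3 : (0 : ℝ) ≤ 2 ^ b * (N : ℝ) ^ j := by positivity
    calc 2 ^ b * (N : ℝ) ^ j * ((2 ^ (j + 1) - 1) / (2 - 1)) ≤ 2 ^ b * (N : ℝ) ^ j * 2 ^ (j + 1) :=
          mul_le_mul_of_nonneg_left (by norm_num) h3
      _ = 2 ^ (b + 1) * (2 ^ j * (N : ℝ) ^ j) := by ring

/-- Solutions of equations satisfying the congruences have small denominators. -/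
theorem exists_denominatorBound {φ : ℚ⟦X⟧} (hφ : IsEisenstein φ) {B : ℕ}
    (h : ∀ p : ℕ, p.Prime → B ≤ p → ∀ n : ℕ, 1 ≤ n → ∃ y : ℚ, ¬ p ∣ y.den ∧
      coeff (n * p - 1) φ - coeff (n - 1) φ = p * y) :
    ∃ (C : ℝ) (δ : ℕ → ℕ), DenominatorBound (odeSol φ) C δ := by
  obtain ⟨N, hN, hφN⟩ := hφ
  set B' := max B (N + 1) with hB'
  obtain ⟨C, hC, hCle⟩ := exists_commonDen_le N B' hN
  have hNr : (1 : ℝ) ≤ N := by exact_mod_cast hN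
  have h2N : (1 : ℝ) ≤ 2 * N := by linarith
  have hgrow : ∀ j, |((coeff j (odeSol φ) : ℚ) : ℝ)| ≤ (N : ℝ) ^ j := by
    refine odeSol_growth (N := normRingSeminorm ℚ) (K := N) (ν := N) (fun q => le_rfl)
      (by positivity) le_rfl le_rfl fun s => ?_
    have h1 : |((coeff s φ : ℚ) : ℝ)| ≤ (N : ℝ) ^ (s + 1) := by exact_mod_cast (hφN s).2
    rwa [pow_succ'] at h1
  refine ⟨max C (2 * N), commonDen N B', ⟨hC.trans (le_max_left _ _), commonDen_pos hN B',
    fun J => ?_, fun J b j hj => ?_, fun b j => ?_⟩⟩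
  · refine (hCle J).trans ((pow_le_pow_left₀ (by linarith) (le_max_left C (2 * N)) J).trans ?_)
    exact pow_le_pow_right₀ (hC.trans (le_max_left _ _)) (Nat.le_succ J)
  · apply exists_int_of_forall_mem_locSubring
    intro p hp
    set c := coeff j (odeSol φ ^ b) with hc
    have key : ((N ^ J * p ^ denExponent B' J p : ℕ) : ℚ) * c ∈ locSubring p := by
      by_cases hpB : p < B'
      · rw [denExponent, if_pos hpB]
        rw [Nat.mul_comm, Nat.cast_mul, mul_assoc]
        apply pow_factorization_mul_mem (Nat.factorial_ne_zero J)
        have h1 := factorial_mul_coeff_odeSol_mem (Int.castRingHom ℚ).range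
          (η := (b : ℚ⟦X⟧) * φ) (N := N) (fun i => by
            obtain ⟨z, hz⟩ := (hφN i).1
            rw [natCast_mul_coeff]
            refine ⟨b * z, ?_⟩
            rw [map_mul, eq_intCast, eq_intCast, ← hz]
            push_cast
            ring) j
        rw [odeSol_natCast_mul] at h1
        obtain ⟨z, hz⟩ := h1
        have h2 : ((J.factorial / j.factorial : ℕ) : ℚ) * (j.factorial : ℚ) = J.factorial := by
          rw [← Nat.cast_mul, Nat.div_mul_cancel (Nat.factorial_dvd_factorial hj)]
        have h3 : (N : ℚ) ^ J = (N : ℚ) ^ (J - j) * (N : ℚ) ^ j := by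
          rw [← pow_add, Nat.sub_add_cancel hj]
        have h4 : (J.factorial : ℚ) * (((N ^ J : ℕ) : ℚ) * c) =
            ((J.factorial / j.factorial * N ^ (J - j) : ℕ) : ℚ) * (z : ℚ) := by
          rw [eq_intCast] at hz
          rw [hz, Nat.cast_pow, h3, ← h2, Nat.cast_mul, Nat.cast_pow]
          ring
        rw [h4]
        exact mul_mem (natCast_mem _ _) (intCast_mem_locSubring z)
      · rw [denExponent, if_neg hpB, Nat.cast_mul, mul_assoc]
        refine mul_mem (natCast_mem _ _) (pow_factorization_mul_mem (Nat.factorial_ne_zero _) ?_)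
        refine factorial_div_mul_coeff_odeSol_pow_mem (mem_locSeries.2 fun i => ?_)
          (fun n hn => ?_) b hj
        swap
        · obtain ⟨y, hy, hye⟩ := h p hp.out ((le_max_left _ _).trans (not_lt.1 hpB)) n hn
          exact ⟨y, mem_locSubring_iff.2 hy, hye⟩
        obtain ⟨z, hz⟩ := (hφN i).1
        have hpN : ¬ p ∣ N := fun hd => by
          have h1 := Nat.le_of_dvd hN hd
          have h2 := (le_max_right B (N + 1)).trans (not_lt.1 hpB)
          omega
        apply mem_locSubring_of_mul_mem (fun hd => hpN (hp.out.dvd_of_dvd_pow hd) :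
          ¬ p ∣ N ^ (i + 1))
        rw [Nat.cast_pow, hz]
        exact intCast_mem_locSubring z
    obtain ⟨m, hm⟩ := pow_denExponent_dvd B' J hp.out
    have h5 : (commonDen N B' J : ℚ) * c =
        (m : ℚ) * (((N ^ J * p ^ denExponent B' J p : ℕ) : ℚ) * c) := by
      rw [commonDen, hm]
      push_cast
      ring
    rw [h5]
    exact mul_mem (natCast_mem _ _) key
  · refine (abs_coeff_pow_le hgrow b j).trans ?_
    have h1 : (2 : ℝ) ^ b ≤ max C (2 * N) ^ b :=
      pow_le_pow_left₀ (by norm_num) (le_trans (by linarith) (le_max_right _ _)) b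
    have h2 : (2 * N : ℝ) ^ j ≤ max C (2 * N) ^ j :=
      pow_le_pow_left₀ (by positivity) (le_max_right _ _) j
    calc (2 : ℝ) ^ b * (2 * N : ℝ) ^ j ≤ max C (2 * N) ^ b * max C (2 * N) ^ j :=
          mul_le_mul h1 h2 (by positivity) (by positivity)
      _ = max C (2 * N) ^ (b + j) := (pow_add _ _ _).symm
      _ ≤ max C (2 * N) ^ (b + j + 1) :=
          pow_le_pow_right₀ (hC.trans (le_max_left _ _)) (Nat.le_succ _)

end GlobalBound

section IntegralElement

theorem exists_monic_eval₂_mul_eq_zero {R K : Type*} [CommRing R] [IsDomain R] [CommRing K]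
    {φ : R →+* K} (hφ : Function.Injective φ) {P : Polynomial R} (hP : P ≠ 0) {f : K}
    (hf : P.eval₂ φ f = 0) :
    ∃ q : R, q ≠ 0 ∧ ∃ Φ : Polynomial R, Φ.Monic ∧ Φ.eval₂ φ (φ q * f) = 0 := by
  refine ⟨P.leadingCoeff, by simpa, P.integralNormalization,
    Polynomial.monic_integralNormalization hP, ?_⟩
  exact Polynomial.integralNormalization_eval₂_eq_zero φ hf
    ((injective_iff_map_eq_zero φ).1 hφ)

/-- A monic equation of minimal degree over a `ℚ`-algebra is separable at its root. -/
theorem exists_minimal_monic {K : Type*} [CommRing K] [Nontrivial K]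
    {φ : Polynomial ℚ →+* K} {s : K}
    (h : ∃ Φ : Polynomial (Polynomial ℚ), Φ.Monic ∧ Φ.eval₂ φ s = 0) :
    ∃ (m : ℕ) (Φ : Polynomial (Polynomial ℚ)), Φ.Monic ∧ Φ.natDegree = m + 1 ∧
      Φ.eval₂ φ s = 0 ∧ ∀ Ψ : Polynomial (Polynomial ℚ), Ψ.Monic → Ψ.natDegree = m + 1 →
        (Polynomial.derivative Ψ).eval₂ φ s ≠ 0 := by
  classical
  have hex : ∃ d, ∃ Φ : Polynomial (Polynomial ℚ), Φ.Monic ∧ Φ.natDegree = d ∧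
      Φ.eval₂ φ s = 0 := by
    obtain ⟨Φ, h1, h2⟩ := h
    exact ⟨_, Φ, h1, rfl, h2⟩
  obtain ⟨Φ, hΦ, hd, hs⟩ := Nat.find_spec hex
  have hpos : Nat.find hex ≠ 0 := by
    intro h0
    rw [h0] at hd
    rw [hΦ.natDegree_eq_zero] at hd
    simp [hd] at hs
  obtain ⟨m, hm⟩ := Nat.exists_eq_succ_of_ne_zero hpos
  refine ⟨m, Φ, hΦ, by rw [hd, hm], hs, fun Ψ hΨ hΨd h0 => ?_⟩
  refine Nat.find_min hex (m := m) (by omega)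
    ⟨Polynomial.C (Polynomial.C ((m + 1 : ℚ)⁻¹)) * Polynomial.derivative Ψ, ?_, ?_, ?_⟩
  all_goals
    have hc : (Polynomial.C (Polynomial.C ((m + 1 : ℚ)⁻¹)) * Polynomial.derivative Ψ).coeff m
        = 1 := by
      rw [Polynomial.coeff_C_mul, Polynomial.coeff_derivative, ← hΨd, hΨ.coeff_natDegree]
      have : (m + 1 : Polynomial ℚ) = Polynomial.C (m + 1 : ℚ) := by simp
      rw [this, one_mul, ← Polynomial.C_mul, inv_mul_cancel₀ (by positivity), Polynomial.C_1]
    have hle : (Polynomial.C (Polynomial.C ((m + 1 : ℚ)⁻¹)) *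
        Polynomial.derivative Ψ).natDegree ≤ m := by
      refine (Polynomial.natDegree_C_mul_le _ _).trans
        ((Polynomial.natDegree_derivative_le _).trans ?_)
      omega
  · exact Polynomial.monic_of_natDegree_le_of_coeff_eq_one m hle hc
  · refine le_antisymm hle (Polynomial.le_natDegree_of_ne_zero ?_)
    rw [hc]
    exact one_ne_zero
  · rw [Polynomial.eval₂_mul, h0, mul_zero]

theorem Polynomial.exists_monic_map_eq_zero {V : Type*} [AddCommGroup V] [Module ℚ V]
    [FiniteDimensional ℚ V] (v : Polynomial ℚ →ₗ[ℚ] V) :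
    ∃ n₀ : ℕ, ∀ j, n₀ ≤ j → ∃ γ : Polynomial ℚ, γ.Monic ∧ γ.natDegree = j ∧ v γ = 0 := by
  let W : ℕ →o Submodule ℚ V :=
    ⟨fun k => (Polynomial.degreeLT ℚ k).map v,
      fun a b hab => Submodule.map_mono (Polynomial.degreeLT_mono hab)⟩
  obtain ⟨n₀, hn⟩ := monotone_stabilizes_iff_noetherian.2 (inferInstance : IsNoetherian ℚ V) W
  refine ⟨n₀, fun j hj => ?_⟩
  have h1 : v (Polynomial.X ^ j) ∈ W (j + 1) :=
    Submodule.mem_map_of_mem (Polynomial.mem_degreeLT.2 (by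
      rw [Polynomial.degree_X_pow]; exact_mod_cast Nat.lt_succ_self j))
  rw [← hn (j + 1) (by omega)] at h1
  obtain ⟨g, hg, hgv⟩ := Submodule.mem_map.1 h1
  have hdeg : g.degree < j :=
    (Polynomial.mem_degreeLT.1 hg).trans_le (by exact_mod_cast hj)
  refine ⟨Polynomial.X ^ j - g, Polynomial.monic_X_pow_sub hdeg, ?_, by simp [hgv]⟩
  refine Polynomial.natDegree_eq_of_degree_eq_some ?_
  rw [Polynomial.degree_sub_eq_left_of_degree_lt (by rwa [Polynomial.degree_X_pow]),
    Polynomial.degree_X_pow]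

end IntegralElement

section Blocks

variable {R : Type*} [CommRing R] {m : Type*} [Fintype m]
  {U X Y : Matrix (m ⊕ Unit) (m ⊕ Unit) R} {N M : Matrix m m R} {h g : R}

theorem BlockRel.mul (hX : BlockRel U X N h) (hY : BlockRel U Y M g) :
    BlockRel U (X * Y) (N * M) (h * g) := by
  obtain ⟨c, hc⟩ := hX
  obtain ⟨d, hd⟩ := hY
  refine ⟨N * d + c * Matrix.of fun _ _ => g, ?_⟩
  have : (Matrix.of fun _ _ => h * g : Matrix Unit Unit R) =
      Matrix.of (fun _ _ => h) * Matrix.of fun _ _ => g := by ext; simp [Matrix.mul_apply]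
  rw [← mul_assoc, hc, mul_assoc, hd, ← mul_assoc, Matrix.fromBlocks_multiply, this]
  simp
  congr!

variable [DecidableEq m]

theorem BlockRel.pow (hX : BlockRel U X N h) (k : ℕ) : BlockRel U (X ^ k) (N ^ k) (h ^ k) := by
  induction k with
  | zero => simpa using BlockRel.one
  | succ k ih => simpa only [pow_succ] using ih.mul hX

/-- A left eigenvector with last entry `1` puts a matrix into block triangular form. -/
theorem blockRel_of_eigenvector {A : Matrix m m R} {b : Matrix m Unit R} {d : Matrix Unit m R}
    {e : Matrix Unit Unit R} {u : Matrix Unit m R}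
    (h1 : u * A + d = h • u) (h2 : u * b + e = Matrix.of fun _ _ => h) :
    BlockRel (Matrix.fromBlocks 1 0 u 1) (Matrix.fromBlocks A b d e) (A - b * u) h := by
  refine ⟨b, ?_⟩
  have : (Matrix.of (fun _ _ => h) : Matrix Unit Unit R) * u = h • u := by
    ext i j; simp [Matrix.mul_apply]
  rw [Matrix.fromBlocks_multiply, Matrix.fromBlocks_multiply, this]
  simp [h1, h2]

theorem fromBlocks_one_mul_fromBlocks_neg (u : Matrix Unit m R) :
    (Matrix.fromBlocks 1 0 u 1 : Matrix (m ⊕ Unit) (m ⊕ Unit) R) *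
      Matrix.fromBlocks 1 0 (-u) 1 = 1 := by
  rw [Matrix.fromBlocks_multiply]
  simp [Matrix.fromBlocks_one]

theorem BlockRel.charpoly {V : Matrix (m ⊕ Unit) (m ⊕ Unit) R} (hUV : U * V = 1)
    (hX : BlockRel U X N h) : X.charpoly = N.charpoly * (Polynomial.X - Polynomial.C h) := by
  have h1 : U.map Polynomial.C * V.map Polynomial.C = 1 := by
    rw [← Matrix.map_mul, hUV, Matrix.map_one _ (map_zero _) (map_one _)]
  have h2 : BlockRel (U.map Polynomial.C) X.charmatrix N.charmatrix
      (Polynomial.X - Polynomial.C h) := by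
    have h3 := (BlockRel.one.smul (Polynomial.X : Polynomial R)).add
      ((hX.map Polynomial.C).smul (-1))
    have key : ∀ {ι : Type _} [Fintype ι] [DecidableEq ι] (Z : Matrix ι ι R), Z.charmatrix =
        (Polynomial.X : Polynomial R) • (1 : Matrix ι ι (Polynomial R)) +
          (-1 : Polynomial R) • Z.map Polynomial.C := by
      intro ι _ _ Z
      ext i j : 2
      by_cases hij : i = j
      · subst hij; simp [sub_eq_add_neg]
      · simp [hij]
    rw [key, key]
    simpa [sub_eq_add_neg] using h3
  exact h2.det h1

end Blocks

/-- Every root of a monic polynomial of degree `m + 1` occurs as the scalar block of a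
matrix of size `m + 1` over the base ring. -/
theorem exists_blockRel_of_monic {R K : Type*} [CommRing R] [CommRing K] {φ : R →+* K} {s : K}
    {m : ℕ} {Φ : Polynomial R} (hΦ : Φ.Monic) (hd : Φ.natDegree = m + 1)
    (hs : Φ.eval₂ φ s = 0) :
    ∃ (T : Matrix (Fin m ⊕ Unit) (Fin m ⊕ Unit) R) (U V : Matrix (Fin m ⊕ Unit) (Fin m ⊕ Unit) K)
      (N : Matrix (Fin m) (Fin m) K), U * V = 1 ∧ BlockRel U (T.map φ) N s := by
  classical
  let c : ℕ → ℕ → R := fun k i => if i = m then -Φ.coeff k else if k = i + 1 then 1 else 0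
  have key : ∀ i ≤ m, ∑ k ∈ Finset.range (m + 1), s ^ k * φ (c k i) = s * s ^ i := by
    intro i hi
    rcases hi.eq_or_lt with rfl | hi
    · have h1 := hs
      rw [Polynomial.eval₂_eq_sum_range, hd, Finset.sum_range_succ, ← hd, hΦ.coeff_natDegree,
        map_one, one_mul, hd, pow_succ'] at h1
      simp only [c, if_true, map_neg, mul_neg, Finset.sum_neg_distrib]
      simp only [mul_comm (s ^ _) (φ _)]
      linear_combination -h1
    · rw [Finset.sum_eq_single (i + 1)]
      · simp [c, hi.ne, pow_succ']
      · intro k _ hk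
        simp [c, hi.ne, hk]
      · simp [hi]
  let T : Matrix (Fin m ⊕ Unit) (Fin m ⊕ Unit) R :=
    Matrix.fromBlocks (Matrix.of fun k i => c (k + 1) (i + 1)) (Matrix.of fun k _ => c (k + 1) 0)
      (Matrix.of fun _ i => c 0 (i + 1)) (Matrix.of fun _ _ => c 0 0)
  let u : Matrix Unit (Fin m) K := Matrix.of fun _ k => s ^ ((k : ℕ) + 1)
  refine ⟨T, Matrix.fromBlocks 1 0 u 1, Matrix.fromBlocks 1 0 (-u) 1,
    (T.map φ).toBlocks₁₁ - (T.map φ).toBlocks₁₂ * u, fromBlocks_one_mul_fromBlocks_neg u, ?_⟩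
  rw [← Matrix.fromBlocks_toBlocks (T.map φ)]
  refine blockRel_of_eigenvector ?_ ?_
  · ext a i
    have := key (i + 1) (by omega)
    rw [Finset.sum_range_succ', ← Fin.sum_univ_eq_sum_range
      (fun k => s ^ (k + 1) * φ (c (k + 1) (i + 1)))] at this
    simpa [u, T, Matrix.mul_apply, Matrix.toBlocks₁₁, Matrix.toBlocks₁₂, Matrix.toBlocks₂₁,
      Matrix.toBlocks₂₂] using this
  · ext a i
    have := key 0 (by omega)
    rw [Finset.sum_range_succ', ← Fin.sum_univ_eq_sum_range
      (fun k => s ^ (k + 1) * φ (c (k + 1) 0))] at this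
    simpa [u, T, Matrix.mul_apply, Matrix.toBlocks₁₁, Matrix.toBlocks₁₂, Matrix.toBlocks₂₁,
      Matrix.toBlocks₂₂] using this

section LaurentSplitting

variable {A : Type*} [CommRing A]

theorem exists_ofPowerSeries_eq (x : LaurentSeries A) (hx : ∀ i < 0, x.coeff i = 0) :
    ∃ u, HahnSeries.ofPowerSeries ℤ A u = x := by
  refine ⟨PowerSeries.mk fun j => x.coeff j, ?_⟩
  ext i
  rcases lt_or_ge i 0 with h | h
  · rw [ofPowerSeries_coeff_of_neg _ h, hx i h]
  · obtain ⟨j, rfl⟩ := Int.eq_ofNat_of_zero_le h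
    rw [ofPowerSeries_coeff_natCast, PowerSeries.coeff_mk]

theorem exists_coeff_eq_zero_of_lt {ι : Type*} [Finite ι] (x : ι → LaurentSeries A) :
    ∃ b : ℕ, ∀ i, ∀ t < -(b : ℤ), (x i).coeff t = 0 := by
  have := Fintype.ofFinite ι
  refine ⟨Finset.univ.sup fun i => (x i).order.natAbs, fun i t ht =>
    HahnSeries.coeff_eq_zero_of_lt_order ?_⟩
  have := Finset.le_sup (f := fun i => (x i).order.natAbs) (Finset.mem_univ i)
  omega

theorem exists_polarEmb_coeff_eq (x : LaurentSeries A) :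
    ∃ Q, ∀ i ≤ 0, (polarEmb A Q).coeff i = x.coeff i := by
  obtain ⟨b, hb⟩ := exists_coeff_eq_zero_of_lt fun _ : Unit => x
  refine ⟨∑ j ∈ Finset.range (b + 1), Polynomial.monomial j (x.coeff (-(j : ℤ))), fun i hi => ?_⟩
  obtain ⟨j, rfl⟩ : ∃ j : ℕ, i = -(j : ℤ) := ⟨i.natAbs, by omega⟩
  rw [polarEmb_coeff_neg]
  simp only [Polynomial.finsetSum_coeff, Polynomial.coeff_monomial, Finset.sum_ite_eq',
    Finset.mem_range]
  split_ifs with h'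
  · rfl
  · rw [hb () _ (by omega)]

theorem polarEmb_coeff_of_lt {p : Polynomial A} {d : ℕ} (hp : p.natDegree ≤ d) :
    ∀ i < -(d : ℤ), (polarEmb A p).coeff i = 0 := by
  intro i hi
  obtain ⟨j, rfl⟩ : ∃ j : ℕ, i = -(j : ℤ) := ⟨i.natAbs, by omega⟩
  rw [polarEmb_coeff_neg, Polynomial.coeff_eq_zero_of_natDegree_lt (by omega)]

end LaurentSplitting

/-- A monic polynomial killing `f · q` of minimal degree gives a matrix over `ℚ[t⁻¹]` with
eigenvalue `f · q`, whose complementary block is annihilated by a partition of unity. -/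
theorem exists_spectral_partition {K : Type*} [Field K] {φ : Polynomial ℚ →+* K} {s : K}
    (h : ∃ Φ : Polynomial (Polynomial ℚ), Φ.Monic ∧ Φ.eval₂ φ s = 0) :
    ∃ (m : ℕ) (T : Matrix (Fin m ⊕ Unit) (Fin m ⊕ Unit) (Polynomial ℚ))
      (U V : Matrix (Fin m ⊕ Unit) (Fin m ⊕ Unit) K) (N : Matrix (Fin m) (Fin m) K) (ε : ℕ → K),
      U * V = 1 ∧ BlockRel U (T.map φ) N s ∧
      ∑ i ∈ Finset.range (m + 1), ε i * s ^ i = 1 ∧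
      ∑ i ∈ Finset.range (m + 1), ε i • N ^ i = 0 := by
  obtain ⟨m, Φ, hΦ, hd, hs, hmin⟩ := exists_minimal_monic h
  obtain ⟨T, U, V, N, hUV, hT⟩ := exists_blockRel_of_monic hΦ hd hs
  have hχ := hT.charpoly hUV
  have hne : N.charpoly.eval s ≠ 0 := by
    have h1 := hmin T.charpoly T.charpoly_monic (by rw [Matrix.charpoly_natDegree_eq_dim]; simp)
    rw [← Polynomial.eval_map, ← Polynomial.derivative_map, ← Matrix.charpoly_map, hχ] at h1
    simpa using h1
  have hN : N.charpoly.natDegree < m + 1 := by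
    rw [Matrix.charpoly_natDegree_eq_dim]; simp
  refine ⟨m, T, U, V, N, fun i => (N.charpoly.eval s)⁻¹ * N.charpoly.coeff i, hUV, hT, ?_, ?_⟩
  · simp only [mul_assoc]
    rw [← Finset.mul_sum, ← Polynomial.eval_eq_sum_range' hN, inv_mul_cancel₀ hne]
  · have h2 := N.aeval_self_charpoly
    rw [Polynomial.aeval_eq_sum_range' hN] at h2
    simp only [mul_smul]
    rw [← Finset.smul_sum, h2, smul_zero]

section Curve

variable {m : ℕ} {T : Matrix (Fin m ⊕ Unit) (Fin m ⊕ Unit) (Polynomial ℚ)}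
  {U : Matrix (Fin m ⊕ Unit) (Fin m ⊕ Unit) (LaurentSeries ℚ)}
  {N : Matrix (Fin m) (Fin m) (LaurentSeries ℚ)} {s : LaurentSeries ℚ} {ε : ℕ → LaurentSeries ℚ}

/-- Polynomials in `t⁻¹` of every large degree can be divided among the components of a partition
of unity with arbitrarily small errors. -/
theorem exists_monic_coeff_mul_eq_zero (ε : ℕ → LaurentSeries ℚ) (m B : ℕ) :
    ∃ n₀ : ℕ, ∀ j, n₀ ≤ j → ∃ γ : Polynomial ℚ, γ.Monic ∧ γ.natDegree = j ∧
      ∀ i ∈ Finset.range (m + 1), ∀ t : ℤ, 1 ≤ t → t ≤ B → (polarEmb ℚ γ * ε i).coeff t = 0 := by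
  let v : Polynomial ℚ →ₗ[ℚ] (Fin (m + 1) → Fin B → ℚ) :=
    { toFun := fun γ i c => (polarEmb ℚ γ * ε i).coeff (c + 1)
      map_add' := fun x y => by
        ext i c
        simp [add_mul]
      map_smul' := fun a x => by
        ext i c
        rw [Polynomial.smul_eq_C_mul, map_mul, polarEmb_C, mul_assoc, HahnSeries.C_mul_eq_smul]
        rfl }
  obtain ⟨n₀, hn⟩ := Polynomial.exists_monic_map_eq_zero v
  refine ⟨n₀, fun j hj => ?_⟩
  obtain ⟨γ, h1, h2, h3⟩ := hn j hj
  refine ⟨γ, h1, h2, fun i hi t ht ht' => ?_⟩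
  have := congrFun (congrFun h3 ⟨i, Finset.mem_range.1 hi⟩) ⟨(t - 1).toNat, by omega⟩
  simp only [v, LinearMap.coe_mk, AddHom.coe_mk, Pi.zero_apply] at this
  rwa [show (((t - 1).toNat : ℕ) : ℤ) + 1 = t by omega] at this

theorem exists_blockRel_prescribed (hT : BlockRel U (T.map (polarEmb ℚ)) N s)
    (hε : ∑ i ∈ Finset.range (m + 1), ε i * s ^ i = 1)
    (hN : ∑ i ∈ Finset.range (m + 1), ε i • N ^ i = 0) {w : Polynomial ℚ} (hw : w.Monic) :
    ∃ n₀ : ℕ, ∀ j, n₀ ≤ j → ∃ (Q : ℕ → Polynomial ℚ) (N' M' : Matrix (Fin m) (Fin m) ℚ⟦X⟧)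
      (r : LaurentSeries ℚ), r = ∑ i ∈ Finset.range (m + 1), polarEmb ℚ (Q i) * s ^ i ∧
      (polarEmb ℚ w * r).coeff (-(w.natDegree + j : ℤ)) = 1 ∧
      (∀ t < -(w.natDegree + j : ℤ), (polarEmb ℚ w * r).coeff t = 0) ∧
      BlockRel U ((∑ i ∈ Finset.range (m + 1), Q i • T ^ i).map (polarEmb ℚ))
        (∑ i ∈ Finset.range (m + 1), polarEmb ℚ (Q i) • N ^ i) r ∧
      polarEmb ℚ w • ∑ i ∈ Finset.range (m + 1), polarEmb ℚ (Q i) • N ^ i =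
        N'.map (HahnSeries.ofPowerSeries ℤ ℚ) ∧
      (HahnSeries.single (-2 : ℤ) (1 : ℚ) : LaurentSeries ℚ) •
        ((∑ i ∈ Finset.range (m + 1), polarEmb ℚ (Q i) • N ^ i) * N) =
        M'.map (HahnSeries.ofPowerSeries ℤ ℚ) := by
  obtain ⟨b₁, hb₁⟩ := exists_coeff_eq_zero_of_lt
    fun x : Fin (m + 2) × Fin m × Fin m => (N ^ (x.1 : ℕ)) x.2.1 x.2.2
  obtain ⟨b₂, hb₂⟩ := exists_coeff_eq_zero_of_lt fun x : Fin (m + 1) => s ^ (x : ℕ)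
  obtain ⟨n₀, hn₀⟩ := exists_monic_coeff_mul_eq_zero ε m (b₁ + b₂ + w.natDegree + 2)
  refine ⟨n₀, fun j hj => ?_⟩
  obtain ⟨γ, hγ, hγj, hγ0⟩ := hn₀ j hj
  choose Q hQ using fun i => exists_polarEmb_coeff_eq (polarEmb ℚ γ * ε i)
  set δ : ℕ → LaurentSeries ℚ := fun i => polarEmb ℚ γ * ε i - polarEmb ℚ (Q i) with hδ
  have hδ0 : ∀ i ∈ Finset.range (m + 1), ∀ t < (b₁ + b₂ + w.natDegree + 3 : ℤ),
      (δ i).coeff t = 0 := by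
    intro i hi t ht
    rw [hδ]
    simp only [HahnSeries.coeff_sub]
    rcases le_or_gt t 0 with h | h
    · rw [hQ i t h, sub_self]
    · rw [polarEmb_coeff_pos _ h, hγ0 i hi t (by omega) (by push_cast; omega), sub_zero]
  have hQδ : ∀ i, polarEmb ℚ (Q i) = polarEmb ℚ γ * ε i - δ i := fun i => by simp [hδ]
  have hr : ∑ i ∈ Finset.range (m + 1), polarEmb ℚ (Q i) * s ^ i =
      polarEmb ℚ γ - ∑ i ∈ Finset.range (m + 1), δ i * s ^ i := by
    simp only [hQδ, sub_mul, Finset.sum_sub_distrib, mul_assoc, ← Finset.mul_sum, hε, mul_one]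
  have hQN : ∑ i ∈ Finset.range (m + 1), polarEmb ℚ (Q i) • N ^ i =
      -∑ i ∈ Finset.range (m + 1), δ i • N ^ i := by
    simp only [hQδ, sub_smul, Finset.sum_sub_distrib, mul_smul, ← Finset.smul_sum, hN, smul_zero,
      zero_sub]
  have hint : ∀ (p : Polynomial ℚ), p.natDegree ≤ w.natDegree + 2 → ∀ a ≤ 1,
      ∃ Z : Matrix (Fin m) (Fin m) ℚ⟦X⟧,
      polarEmb ℚ p • ((∑ i ∈ Finset.range (m + 1), polarEmb ℚ (Q i) • N ^ i) * N ^ a) =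
        Z.map (HahnSeries.ofPowerSeries ℤ ℚ) := by
    intro p hp a ha
    have hz : ∀ k l, ∀ t < 0, ((polarEmb ℚ p • ((∑ i ∈ Finset.range (m + 1),
        polarEmb ℚ (Q i) • N ^ i) * N ^ a)) k l).coeff t = 0 := by
      intro k l t ht
      rw [hQN, neg_mul, Finset.sum_mul, smul_neg, Finset.smul_sum, Matrix.neg_apply,
        Matrix.sum_apply, HahnSeries.coeff_neg, HahnSeries.coeff_sum, neg_eq_zero]
      refine Finset.sum_eq_zero fun i hi => ?_
      rw [Matrix.smul_mul, Matrix.smul_apply, Matrix.smul_apply, ← pow_add, smul_eq_mul,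
        smul_eq_mul]
      have h1 := hb₁ (⟨i + a, by have := Finset.mem_range.1 hi; omega⟩, k, l)
      exact HahnSeries.coeff_mul_eq_zero_of_lt (polarEmb_coeff_of_lt hp)
        (HahnSeries.coeff_mul_eq_zero_of_lt (hδ0 i hi) h1) t (by push_cast; omega)
    choose Z hZ using fun k l => exists_ofPowerSeries_eq _ (hz k l)
    exact ⟨Matrix.of Z, by ext1 k l; exact (hZ k l).symm⟩
  obtain ⟨N', hN'⟩ := hint w (by omega) 0 (by omega)
  obtain ⟨M', hM'⟩ := hint (Polynomial.monomial 2 1)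
    ((Polynomial.natDegree_monomial_le _).trans (by omega)) 1 (by omega)
  rw [pow_zero, mul_one] at hN'
  rw [pow_one, polarEmb_monomial] at hM'
  have herr : ∀ t ≤ 0, (polarEmb ℚ w * ∑ i ∈ Finset.range (m + 1), δ i * s ^ i).coeff t = 0 := by
    intro t ht
    rw [Finset.mul_sum, HahnSeries.coeff_sum]
    refine Finset.sum_eq_zero fun i hi => ?_
    have h1 := hb₂ ⟨i, Finset.mem_range.1 hi⟩
    exact HahnSeries.coeff_mul_eq_zero_of_lt (polarEmb_coeff_of_lt le_rfl)
      (HahnSeries.coeff_mul_eq_zero_of_lt (hδ0 i hi) h1) t (by omega)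
  have hdeg : (w * γ).natDegree = w.natDegree + j := by rw [hw.natDegree_mul hγ, hγj]
  refine ⟨Q, N', M', _, rfl, ?_, ?_, ?_, hN', hM'⟩
  · rw [hr, mul_sub, HahnSeries.coeff_sub, herr _ (by omega), sub_zero, ← map_mul,
      ← Nat.cast_add, polarEmb_coeff_neg, ← hdeg]
    exact (hw.mul hγ).coeff_natDegree
  · intro t ht
    rw [hr, mul_sub, HahnSeries.coeff_sub, herr _ (by omega), sub_zero, ← map_mul]
    exact polarEmb_coeff_of_lt hdeg.le t (by push_cast; omega)
  · have h := BlockRel.sum (Finset.range (m + 1)) fun i (_ : i ∈ Finset.range (m + 1)) =>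
      (hT.pow i).smul (polarEmb ℚ (Q i))
    have e : (∑ i ∈ Finset.range (m + 1), Q i • T ^ i).map (polarEmb ℚ) =
        ∑ i ∈ Finset.range (m + 1), polarEmb ℚ (Q i) • (T.map (polarEmb ℚ)) ^ i := by
      change (polarEmb ℚ).mapMatrix _ = ∑ i ∈ Finset.range (m + 1), polarEmb ℚ (Q i) •
        ((polarEmb ℚ).mapMatrix T) ^ i
      rw [map_sum]
      refine Finset.sum_congr rfl fun i _ => ?_
      rw [← map_pow]
      ext1 k l
      simp
    rw [e]
    exact h

theorem exists_reciprocityData {f : LaurentSeries ℚ}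
    (hf : ∃ P : Polynomial (Polynomial ℚ), P ≠ 0 ∧ P.eval₂ (polarEmb ℚ) f = 0) :
    ∃ (m n : ℕ) (_ : n ≠ 0) (R : ReciprocityData f (Fin m) n), ∀ j,
      ∃ P : Polynomial (Polynomial ℚ), R.r j = P.eval₂ (polarEmb ℚ) f := by
  obtain ⟨P, hP, hPf⟩ := hf
  obtain ⟨q, hq, hΦ⟩ := exists_monic_eval₂_mul_eq_zero polarEmb_injective hP hPf
  obtain ⟨m, T, U, V, N, ε, hUV, hT, hε, hN⟩ := exists_spectral_partition hΦ
  set s := polarEmb ℚ q * f with hs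
  set κ : Polynomial ℚ := Polynomial.C q.leadingCoeff⁻¹ with hκ
  have hκq : (κ * q).Monic := by
    rw [hκ, mul_comm]
    exact Polynomial.monic_mul_leadingCoeff_inv hq
  have hw : (κ * q * Polynomial.X ^ 2).Monic := hκq.mul (Polynomial.monic_X_pow 2)
  have hwd : (κ * q * Polynomial.X ^ 2).natDegree = (κ * q).natDegree + 2 := by
    rw [hκq.natDegree_mul (Polynomial.monic_X_pow 2), Polynomial.natDegree_X_pow]
  set w := κ * q * Polynomial.X ^ 2 with hwdef
  obtain ⟨n₀, h⟩ := exists_blockRel_prescribed hT hε hN hw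
  choose Q N' M' r hr hlead hlt hrel hN' hM' using fun j : ℕ => h (n₀ + 1 + j) (by omega)
  have hX2 : polarEmb ℚ (Polynomial.X ^ 2) = HahnSeries.single (-2 : ℤ) (1 : ℚ) := by
    rw [Polynomial.X_pow_eq_monomial, polarEmb_monomial]; rfl
  refine ⟨m, w.natDegree + n₀, by omega,
    { U := U
      V := V
      mul_eq_one := hUV
      r := fun j => polarEmb ℚ w * r j
      coeff_lead := fun j => ?_
      coeff_of_lt := fun j i hi => ?_
      R := fun j => w • ∑ i ∈ Finset.range (m + 1), Q j i • T ^ i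
      S := fun j => κ • ((∑ i ∈ Finset.range (m + 1), Q j i • T ^ i) * T)
      N := N'
      M := fun j => (PowerSeries.C q.leadingCoeff⁻¹) • M' j
      rel := fun j => ?_
      rel_mul := fun j => ?_ }, fun j => ?_⟩
  · have := hlead j
    push_cast at this ⊢
    convert this using 2
    ring
  · refine hlt j i ?_
    push_cast at hi ⊢
    linarith
  · have h1 := (hrel j).smul (polarEmb ℚ w)
    rw [hN'] at h1
    convert h1 using 1
    ext1 k l
    simp
  · have h1 := (((hrel j).mul hT).smul (HahnSeries.single (-2 : ℤ) (1 : ℚ))).smul (polarEmb ℚ κ)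
    rw [hM'] at h1
    convert h1 using 1
    · rw [smul_comm]
      congr 1
      ext1 k l
      simp [Matrix.mul_apply]
    · ext1 k l
      simp [hκ, polarEmb_C]
    · rw [hwdef, map_mul, map_mul, hX2, hs]
      ring
  · refine ⟨∑ i ∈ Finset.range (m + 1), Polynomial.monomial i (w * Q j i * q ^ i), ?_⟩
    simp only
    rw [hr, Polynomial.eval₂_finsetSum, Finset.mul_sum]
    refine Finset.sum_congr rfl fun i _ => ?_
    rw [Polynomial.eval₂_monomial, hs, mul_pow, mul_assoc w,
      map_mul (polarEmb ℚ) w (Q j i * q ^ i), map_mul (polarEmb ℚ) (Q j i) (q ^ i),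
      map_pow (polarEmb ℚ) q i]
    ring

end Curve

section PolarConversion

theorem polarEmb_reflect {p : Polynomial ℚ} {D : ℕ} (hp : p.natDegree ≤ D) :
    polarEmb ℚ (p.reflect D) =
      HahnSeries.single (-(D : ℤ)) 1 * HahnSeries.ofPowerSeries ℤ ℚ (p : ℚ⟦X⟧) := by
  ext i
  rw [HahnSeries.coeff_single_mul, one_mul, sub_neg_eq_add]
  rcases lt_or_ge 0 i with h | h
  · obtain ⟨j, rfl⟩ := Int.eq_ofNat_of_zero_le h.le
    rw [polarEmb_coeff_pos _ h, ← Nat.cast_add, ofPowerSeries_coeff_natCast, Polynomial.coeff_coe,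
      Polynomial.coeff_eq_zero_of_natDegree_lt (by omega)]
  · obtain ⟨j, rfl⟩ : ∃ j : ℕ, i = -(j : ℤ) := ⟨i.natAbs, by omega⟩
    rw [polarEmb_coeff_neg, Polynomial.coeff_reflect]
    rcases le_or_gt j D with hj | hj
    · rw [Polynomial.revAt_le hj, show -(j : ℤ) + D = ((D - j : ℕ) : ℤ) by omega,
        ofPowerSeries_coeff_natCast, Polynomial.coeff_coe]
    · rw [Polynomial.revAt_eq_self_of_lt hj, ofPowerSeries_coeff_of_neg _ (by omega),
        Polynomial.coeff_eq_zero_of_natDegree_lt (by omega)]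

theorem exists_eval₂_polarEmb_eq_zero {f : LaurentSeries ℚ} {P : Polynomial (Polynomial ℚ)}
    (hP : P ≠ 0) (hf : P.eval₂ ((HahnSeries.ofPowerSeries ℤ ℚ).comp
      Polynomial.coeToPowerSeries.ringHom) f = 0) :
    ∃ P' : Polynomial (Polynomial ℚ), P' ≠ 0 ∧ P'.eval₂ (polarEmb ℚ) f = 0 := by
  set D := (Finset.range (P.natDegree + 1)).sup fun k => (P.coeff k).natDegree with hD
  have hk : ∀ k ∈ Finset.range (P.natDegree + 1), (P.coeff k).natDegree ≤ D :=
    fun k hk => Finset.le_sup (f := fun k => (P.coeff k).natDegree) hk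
  refine ⟨∑ k ∈ Finset.range (P.natDegree + 1), Polynomial.monomial k ((P.coeff k).reflect D),
    fun h => hP ?_, ?_⟩
  · have h1 := congrArg (fun Q => Q.coeff P.natDegree) h
    simp only [Polynomial.finsetSum_coeff, Polynomial.coeff_monomial, Finset.sum_ite_eq',
      Finset.mem_range, Nat.lt_succ_self, if_true, Polynomial.coeff_zero,
      Polynomial.reflect_eq_zero_iff] at h1
    exact Polynomial.leadingCoeff_eq_zero.1 h1
  · rw [Polynomial.eval₂_eq_sum_range] at hf
    rw [Polynomial.eval₂_finsetSum, ← mul_zero (HahnSeries.single (-(D : ℤ)) (1 : ℚ)), ← hf,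
      Finset.mul_sum]
    refine Finset.sum_congr rfl fun k hk' => ?_
    rw [Polynomial.eval₂_monomial, polarEmb_reflect (hk k hk'), mul_assoc]
    rfl

end PolarConversion

section Growth

/-- The coefficients of the Laurent series grow at most like the powers of `θ`. -/
def GrowsLike (θ : ℝ) (x : LaurentSeries ℚ) : Prop :=
  ∃ K : ℝ, ∀ i, |((x.coeff i : ℚ) : ℝ)| ≤ K * θ ^ i

variable {θ : ℝ} {x y : LaurentSeries ℚ}

theorem growsLike_zero : GrowsLike θ 0 := ⟨0, fun i => by simp⟩

theorem GrowsLike.add (hx : GrowsLike θ x) (hy : GrowsLike θ y) : GrowsLike θ (x + y) := by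
  obtain ⟨K, hK⟩ := hx
  obtain ⟨L, hL⟩ := hy
  refine ⟨K + L, fun i => ?_⟩
  rw [HahnSeries.coeff_add, Rat.cast_add, add_mul]
  exact (abs_add_le _ _).trans (add_le_add (hK i) (hL i))

theorem GrowsLike.sum {ι : Type*} {s : Finset ι} {x : ι → LaurentSeries ℚ}
    (hx : ∀ i ∈ s, GrowsLike θ (x i)) : GrowsLike θ (∑ i ∈ s, x i) := by
  induction s using Finset.cons_induction with
  | empty => simpa using growsLike_zero
  | cons a s ha ih =>
    rw [Finset.sum_cons]
    exact (hx a (by simp)).add (ih fun i hi => hx i (by simp [hi]))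

theorem GrowsLike.polarEmb_mul (hθ : 0 < θ) (hx : GrowsLike θ x) (p : Polynomial ℚ) :
    GrowsLike θ (polarEmb ℚ p * x) := by
  induction p using Polynomial.induction_on' with
  | add p q hp hq => rw [map_add, add_mul]; exact hp.add hq
  | monomial n c =>
    obtain ⟨K, hK⟩ := hx
    refine ⟨|(c : ℝ)| * K * θ ^ n, fun i => ?_⟩
    rw [polarEmb_monomial, HahnSeries.coeff_single_mul, Rat.cast_mul, abs_mul, sub_neg_eq_add]
    calc |(c : ℝ)| * |((x.coeff (i + n) : ℚ) : ℝ)| ≤ |(c : ℝ)| * (K * θ ^ (i + n)) :=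
          mul_le_mul_of_nonneg_left (hK _) (abs_nonneg _)
      _ = |(c : ℝ)| * K * θ ^ n * θ ^ i := by
          rw [zpow_add₀ hθ.ne', zpow_natCast]; ring

theorem IsEisenstein.growsLike_pow {φ : ℚ⟦X⟧} (hφ : IsEisenstein φ) :
    ∃ θ : ℝ, 1 ≤ θ ∧ ∀ k : ℕ, GrowsLike θ (HahnSeries.ofPowerSeries ℤ ℚ φ ^ k) := by
  obtain ⟨N, hN, h⟩ := hφ
  have hNR : (1 : ℝ) ≤ N := by exact_mod_cast hN
  have hN0 : (N : ℚ) ≠ 0 := by exact_mod_cast hN.ne'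
  refine ⟨2 * N, by linarith, fun k => ?_⟩
  set y : ℚ⟦X⟧ := PowerSeries.C (N : ℚ)⁻¹ * φ with hy
  have hyφ : φ = PowerSeries.C (N : ℚ) * y := by
    rw [hy, ← mul_assoc, ← map_mul, mul_inv_cancel₀ hN0, map_one, one_mul]
  have hyb : ∀ j, |((coeff j y : ℚ) : ℝ)| ≤ (N : ℝ) ^ j := by
    intro j
    have h1 : |coeff j y| ≤ (N : ℚ) ^ j := by
      rw [hy, coeff_C_mul, abs_mul, abs_of_pos (by positivity : (0 : ℚ) < (N : ℚ)⁻¹),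
        inv_mul_le_iff₀ (by positivity), ← pow_succ']
      exact (h j).2
    exact_mod_cast h1
  refine ⟨(N : ℝ) ^ k * 2 ^ k, fun i => ?_⟩
  rw [← map_pow]
  rcases lt_or_ge i 0 with hi | hi
  · rw [ofPowerSeries_coeff_of_neg _ hi]
    simp only [Rat.cast_zero, abs_zero]
    positivity
  · obtain ⟨j, rfl⟩ := Int.eq_ofNat_of_zero_le hi
    rw [ofPowerSeries_coeff_natCast, zpow_natCast, hyφ, mul_pow, ← map_pow, coeff_C_mul,
      Rat.cast_mul, abs_mul, Rat.cast_pow, Rat.cast_natCast, abs_of_nonneg (by positivity),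
      mul_assoc]
    exact mul_le_mul_of_nonneg_left (abs_coeff_pow_le hyb k j) (by positivity)

end Growth

/-- **Algebraicity of exponentials.** If the logarithmic derivative is algebraic and satisfies the
Frobenius congruences for almost all primes, then the solution of the equation is algebraic. -/
theorem exists_odeSol_eval₂_eq_zero {φ : ℚ⟦X⟧}
    (hφ : ∃ P : Polynomial (Polynomial ℚ), P ≠ 0 ∧
      P.eval₂ Polynomial.coeToPowerSeries.ringHom φ = 0) {B : ℕ}
    (h : ∀ p : ℕ, p.Prime → B ≤ p → ∀ n : ℕ, 1 ≤ n →
      ∃ y : ℚ, ¬ p ∣ y.den ∧ coeff (n * p - 1) φ - coeff (n - 1) φ = p * y) :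
    ∃ P : Polynomial (Polynomial ℚ), P ≠ 0 ∧
      P.eval₂ Polynomial.coeToPowerSeries.ringHom (odeSol φ) = 0 := by
  obtain ⟨P, hP, hPφ⟩ := hφ
  have hE := isEisenstein_of_eval₂_eq_zero hP hPφ
  obtain ⟨C, δ, hδ⟩ := exists_denominatorBound hE h
  have hPf : P.eval₂ ((HahnSeries.ofPowerSeries ℤ ℚ).comp Polynomial.coeToPowerSeries.ringHom)
      (HahnSeries.ofPowerSeries ℤ ℚ φ) = 0 := by
    rw [← Polynomial.hom_eval₂, hPφ, map_zero]
  obtain ⟨m, n, hn, R, hR⟩ := exists_reciprocityData (exists_eval₂_polarEmb_eq_zero hP hPf)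
  obtain ⟨θ, hθ, hg⟩ := hE.growsLike_pow
  have : NeZero n := ⟨hn⟩
  refine hδ.exists_polynomial R hθ (by simpa [GrowsLike] using hg 1) fun j => ?_
  obtain ⟨Q, hQ⟩ := hR j
  rw [hQ, Polynomial.eval₂_eq_sum_range]
  exact GrowsLike.sum fun k _ => (hg k).polarEmb_mul (by linarith) _

section AlgebraicElements

variable {R K : Type*} [CommRing R] [Field K] {ψ : R →+* K}

theorem exists_eval₂_mul [IsDomain R] {x y : K} (hx : ∃ P : Polynomial R, P ≠ 0 ∧ P.eval₂ ψ x = 0)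
    (hy : ∃ P : Polynomial R, P ≠ 0 ∧ P.eval₂ ψ y = 0) :
    ∃ P : Polynomial R, P ≠ 0 ∧ P.eval₂ ψ (x * y) = 0 := by
  let := ψ.toAlgebra
  exact IsAlgebraic.mul (R := R) hx hy

theorem exists_eval₂_add [IsDomain R] {x y : K} (hx : ∃ P : Polynomial R, P ≠ 0 ∧ P.eval₂ ψ x = 0)
    (hy : ∃ P : Polynomial R, P ≠ 0 ∧ P.eval₂ ψ y = 0) :
    ∃ P : Polynomial R, P ≠ 0 ∧ P.eval₂ ψ (x + y) = 0 := by
  let := ψ.toAlgebra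
  exact IsAlgebraic.add (R := R) hx hy

theorem exists_eval₂_of_pow {x : K} {n : ℕ} (hn : 0 < n)
    (h : ∃ P : Polynomial R, P ≠ 0 ∧ P.eval₂ ψ (x ^ n) = 0) :
    ∃ P : Polynomial R, P ≠ 0 ∧ P.eval₂ ψ x = 0 := by
  let := ψ.toAlgebra
  exact IsAlgebraic.of_pow (R := R) hn h

theorem exists_eval₂_inv {x : K} (h : ∃ P : Polynomial R, P ≠ 0 ∧ P.eval₂ ψ x = 0) :
    ∃ P : Polynomial R, P ≠ 0 ∧ P.eval₂ ψ x⁻¹ = 0 := by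
  let := ψ.toAlgebra
  exact IsAlgebraic.inv (R := R) h

theorem exists_eval₂_map [Nontrivial R] (r : R) : ∃ P : Polynomial R, P ≠ 0 ∧ P.eval₂ ψ (ψ r) = 0 :=
  ⟨Polynomial.X - Polynomial.C r, Polynomial.X_sub_C_ne_zero r, by simp⟩

end AlgebraicElements

section SeriesEmbedding

theorem ofPowerSeries_rat_coeff_eq_zero {k : ℚ} (hk : ∀ n : ℕ, (n : ℚ) ≠ k) (u : ℚ⟦X⟧) :
    (HahnSeries.ofPowerSeries ℚ ℚ u).coeff k = 0 := by
  rw [HahnSeries.ofPowerSeries_apply]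
  refine HahnSeries.embDomain_of_notMem_range ?_
  rintro ⟨n, hn⟩
  exact hk n hn

theorem ofPowerSeries_rat_coeff_derivative (u : ℚ⟦X⟧) (k : ℚ) :
    (HahnSeries.ofPowerSeries ℚ ℚ (derivative ℚ u)).coeff k =
      (k + 1) * (HahnSeries.ofPowerSeries ℚ ℚ u).coeff (k + 1) := by
  by_cases h : ∃ n : ℕ, (n : ℚ) = k
  · obtain ⟨n, rfl⟩ := h
    rw [HahnSeries.ofPowerSeries_apply_coeff, ← Nat.cast_succ,
      HahnSeries.ofPowerSeries_apply_coeff, coeff_derivative]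
    push_cast
    ring
  · push Not at h
    rw [ofPowerSeries_rat_coeff_eq_zero h]
    by_cases hk : k = -1
    · simp [hk]
    · rw [ofPowerSeries_rat_coeff_eq_zero, mul_zero]
      rintro (_ | n) hn
      · exact hk (by push_cast at hn; linarith)
      · exact h n (by push_cast at hn; linarith)

theorem ofPowerSeries_rat_mul_coeff_eq_zero (u : ℚ⟦X⟧) (w : HahnSeries ℚ ℚ) {k : ℚ}
    (hk : k < w.order) : (HahnSeries.ofPowerSeries ℚ ℚ u * w).coeff k = 0 := by
  by_contra h
  have h0 : HahnSeries.ofPowerSeries ℚ ℚ u * w ≠ 0 := fun h1 => h (by rw [h1]; rfl)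
  have h1 := HahnSeries.order_le_of_coeff_ne_zero h
  rw [HahnSeries.order_mul (left_ne_zero_of_mul h0) (right_ne_zero_of_mul h0)] at h1
  have h2 : (HahnSeries.ofPowerSeries ℚ ℚ u).coeff (HahnSeries.ofPowerSeries ℚ ℚ u).order ≠ 0 :=
    mt HahnSeries.coeff_order_eq_zero.1 (left_ne_zero_of_mul h0)
  refine h2 (ofPowerSeries_rat_coeff_eq_zero (fun n hn => ?_) u)
  have := n.cast_nonneg (α := ℚ)
  linarith

theorem laurentToHahn_coeff (f : LaurentSeries ℚ) (i : ℤ) :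
    (laurentToHahn f).coeff (i : ℚ) = f.coeff i :=
  HahnSeries.embDomain_coeff (f := ⟨⟨fun i : ℤ => (i : ℚ), Int.cast_injective⟩, Int.cast_le⟩)

theorem laurentToHahn_coeff_eq_zero {k : ℚ} (hk : ∀ i : ℤ, (i : ℚ) ≠ k) (f : LaurentSeries ℚ) :
    (laurentToHahn f).coeff k = 0 := by
  refine HahnSeries.embDomain_of_notMem_range
    (f := ⟨⟨fun i : ℤ => (i : ℚ), Int.cast_injective⟩, Int.cast_le⟩) ?_
  rintro ⟨n, hn⟩
  exact hk n hn

theorem laurentToHahn_ofPowerSeries (u : ℚ⟦X⟧) :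
    laurentToHahn (HahnSeries.ofPowerSeries ℤ ℚ u) = HahnSeries.ofPowerSeries ℚ ℚ u := by
  ext k
  by_cases hk : ∃ i : ℤ, (i : ℚ) = k
  · obtain ⟨i, rfl⟩ := hk
    rw [laurentToHahn_coeff]
    rcases lt_or_ge i 0 with h | h
    · rw [ofPowerSeries_coeff_of_neg _ h, ofPowerSeries_rat_coeff_eq_zero]
      intro n hn
      have : (n : ℤ) = i := by exact_mod_cast hn
      omega
    · obtain ⟨n, rfl⟩ := Int.eq_ofNat_of_zero_le h
      rw [ofPowerSeries_coeff_natCast, Int.cast_natCast, HahnSeries.ofPowerSeries_apply_coeff]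
  · push Not at hk
    rw [laurentToHahn_coeff_eq_zero hk, ofPowerSeries_rat_coeff_eq_zero]
    exact fun n hn => hk n (by rw [← hn]; norm_cast)

theorem laurentToHahn_single (i : ℤ) (c : ℚ) :
    laurentToHahn (HahnSeries.single i c) = HahnSeries.single (i : ℚ) c :=
  HahnSeries.embDomain_single (f := ⟨⟨fun i : ℤ => (i : ℚ), Int.cast_injective⟩, Int.cast_le⟩)

theorem exists_eval₂_ofPowerSeries_iff {Γ : Type*} [Semiring Γ] [PartialOrder Γ]
    [IsStrictOrderedRing Γ] {u : ℚ⟦X⟧} :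
    (∃ P : Polynomial (Polynomial ℚ), P ≠ 0 ∧
      P.eval₂ ((HahnSeries.ofPowerSeries Γ ℚ).comp Polynomial.coeToPowerSeries.ringHom)
        (HahnSeries.ofPowerSeries Γ ℚ u) = 0) ↔
    ∃ P : Polynomial (Polynomial ℚ), P ≠ 0 ∧
      P.eval₂ Polynomial.coeToPowerSeries.ringHom u = 0 := by
  simp_rw [← Polynomial.hom_eval₂]
  simp only [map_eq_zero_iff _ (HahnSeries.ofPowerSeries_injective (Γ := Γ) (R := ℚ))]

theorem isAlgebraicHS_C (c : ℚ) : IsAlgebraicHS (HahnSeries.C c) := by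
  have h := exists_eval₂_map (ψ := (HahnSeries.ofPowerSeries ℚ ℚ).comp
    Polynomial.coeToPowerSeries.ringHom) (Polynomial.C c)
  simpa [IsAlgebraicHS] using h

theorem isAlgebraicHS_single_natCast (n : ℕ) : IsAlgebraicHS (HahnSeries.single (n : ℚ) 1) := by
  have h := exists_eval₂_map (ψ := (HahnSeries.ofPowerSeries ℚ ℚ).comp
    Polynomial.coeToPowerSeries.ringHom) (Polynomial.X ^ n)
  simpa [IsAlgebraicHS] using h

theorem isAlgebraicHS_single (c : ℚ) : IsAlgebraicHS (HahnSeries.single c 1) := by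
  refine exists_eval₂_of_pow c.den_pos ?_
  rw [HahnSeries.single_pow, one_pow, nsmul_eq_mul, Rat.den_mul_eq_num]
  rcases le_total 0 c.num with h | h
  · obtain ⟨n, hn⟩ := Int.eq_ofNat_of_zero_le h
    rw [hn]
    exact isAlgebraicHS_single_natCast n
  · obtain ⟨n, hn⟩ := Int.eq_ofNat_of_zero_le (neg_nonneg.2 h)
    have h1 : (HahnSeries.single (c.num : ℚ) (1 : ℚ)) = (HahnSeries.single (n : ℚ) 1)⁻¹ := by
      rw [HahnSeries.inv_single, inv_one, neg_eq_iff_eq_neg.1 hn]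
      push_cast
      rfl
    rw [h1]
    exact exists_eval₂_inv (isAlgebraicHS_single_natCast n)

end SeriesEmbedding

section GeneralizedSolutions

theorem coeff_eq_zero_of_solvesODE {f : LaurentSeries ℚ} {y : HahnSeries ℚ ℚ} (hy : y ≠ 0)
    (h : SolvesODE (laurentToHahn f) y) {n : ℤ} (hn : n < 0) : f.coeff (n - 1) = 0 := by
  by_contra hc
  rw [← laurentToHahn_coeff] at hc
  have h1 := HahnSeries.order_le_of_coeff_ne_zero hc
  have hF : laurentToHahn f ≠ 0 := fun h0 => hc (by rw [h0]; rfl)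
  have hn' : (n : ℚ) < 0 := by exact_mod_cast hn
  push_cast at h1
  have h2 := h ((laurentToHahn f).order + y.order)
  rw [HahnSeries.coeff_mul_order_add_order,
    HahnSeries.coeff_eq_zero_of_lt_order (by linarith), mul_zero] at h2
  exact mul_ne_zero (HahnSeries.leadingCoeff_ne_zero.2 hF) (HahnSeries.leadingCoeff_ne_zero.2 hy)
    h2.symm

/-- The power series part of a Laurent series. -/
def regularPart (f : LaurentSeries ℚ) : ℚ⟦X⟧ := PowerSeries.mk fun j => f.coeff j

theorem coeff_regularPart (f : LaurentSeries ℚ) (j : ℕ) :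
    coeff j (regularPart f) = f.coeff j := coeff_mk _ _

variable {f : LaurentSeries ℚ}

theorem eq_single_add_regularPart (hf : ∀ n : ℤ, n < 0 → f.coeff (n - 1) = 0) :
    f = HahnSeries.single (-1) (f.coeff (-1)) +
    HahnSeries.ofPowerSeries ℤ ℚ (regularPart f) := by
  ext i
  rw [HahnSeries.coeff_add]
  rcases lt_trichotomy i (-1) with h | rfl | h
  · rw [HahnSeries.coeff_single_of_ne h.ne, ofPowerSeries_coeff_of_neg _ (by omega),
      add_zero, ← hf (i + 1) (by omega), add_sub_cancel_right]
  · rw [HahnSeries.coeff_single_same, ofPowerSeries_coeff_of_neg _ (by omega), add_zero]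
  · obtain ⟨j, rfl⟩ := Int.eq_ofNat_of_zero_le (show 0 ≤ i by omega)
    rw [HahnSeries.coeff_single_of_ne h.ne', ofPowerSeries_coeff_natCast, zero_add,
      coeff_regularPart]

theorem laurentToHahn_eq (hf : ∀ n : ℤ, n < 0 → f.coeff (n - 1) = 0) :
    laurentToHahn f = HahnSeries.single (-1) (f.coeff (-1)) +
    HahnSeries.ofPowerSeries ℚ ℚ (regularPart f) := by
  conv_lhs => rw [eq_single_add_regularPart hf]
  rw [map_add, laurentToHahn_single, laurentToHahn_ofPowerSeries]
  norm_num

theorem solvesODE_single_mul_odeSol (hf : ∀ n : ℤ, n < 0 → f.coeff (n - 1) = 0) :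
    SolvesODE (laurentToHahn f)
    (HahnSeries.single (f.coeff (-1)) 1 *
      HahnSeries.ofPowerSeries ℚ ℚ (odeSol (regularPart f))) := by
  intro k
  rw [laurentToHahn_eq hf, add_mul (HahnSeries.single _ _), HahnSeries.coeff_add,
      HahnSeries.coeff_single_mul,
    mul_left_comm (HahnSeries.ofPowerSeries ℚ ℚ (regularPart f)), ← map_mul, ← derivative_odeSol,
        HahnSeries.coeff_single_mul,
    HahnSeries.coeff_single_mul, HahnSeries.coeff_single_mul, ofPowerSeries_rat_coeff_derivative,
    sub_neg_eq_add, sub_add_eq_add_sub]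
  ring

theorem eq_C_mul_of_solvesODE (hf : ∀ n : ℤ, n < 0 → f.coeff (n - 1) = 0)
    {z : HahnSeries ℚ ℚ} (hz : SolvesODE (laurentToHahn f) z) :
    z = HahnSeries.C (z.coeff (f.coeff (-1))) * (HahnSeries.single (f.coeff (-1)) 1 *
      HahnSeries.ofPowerSeries ℚ ℚ (odeSol (regularPart f))) := by
  have hy := solvesODE_single_mul_odeSol hf
  have hy1 : (HahnSeries.single (f.coeff (-1)) 1 *
      HahnSeries.ofPowerSeries ℚ ℚ (odeSol (regularPart f))).coeff (f.coeff (-1)) = 1 := by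
    rw [HahnSeries.coeff_single_mul, sub_self, one_mul, ← Nat.cast_zero,
      HahnSeries.ofPowerSeries_apply_coeff, coeff_zero_eq_constantCoeff_apply,
      constantCoeff_odeSol]
  generalize HahnSeries.single (f.coeff (-1)) 1 *
      HahnSeries.ofPowerSeries ℚ ℚ (odeSol (regularPart f)) = y at hy hy1 ⊢
  generalize hc : z.coeff (f.coeff (-1)) = c
  rw [← sub_eq_zero]
  generalize hw : z - HahnSeries.C c * y = w
  have hwS : SolvesODE (laurentToHahn f) w := by
    intro k
    rw [← hw, mul_sub, HahnSeries.coeff_sub, HahnSeries.coeff_sub, mul_left_comm,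
      HahnSeries.C_mul_eq_smul, HahnSeries.C_mul_eq_smul, HahnSeries.coeff_smul,
      HahnSeries.coeff_smul, ← hz k, ← hy k, smul_eq_mul, smul_eq_mul]
    ring
  have hw0 : w.coeff (f.coeff (-1)) = 0 := by
    rw [← hw, HahnSeries.coeff_sub, HahnSeries.C_mul_eq_smul, HahnSeries.coeff_smul, hy1, hc,
      smul_eq_mul, mul_one, sub_self]
  by_contra hne
  have h1 := hwS (w.order - 1)
  have h2 : w.coeff w.order ≠ 0 := mt HahnSeries.coeff_order_eq_zero.1 hne
  rw [laurentToHahn_eq hf, add_mul (HahnSeries.single _ _), HahnSeries.coeff_add,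
    ofPowerSeries_rat_mul_coeff_eq_zero _ _ (sub_one_lt _), HahnSeries.coeff_single_mul,
    sub_neg_eq_add, sub_add_cancel, add_zero] at h1
  rw [mul_right_cancel₀ h2 h1] at h2
  exact h2 hw0

theorem isAlgebraicHS_solutions_iff (hf : ∀ n : ℤ, n < 0 → f.coeff (n - 1) = 0) :
    (∀ y : HahnSeries ℚ ℚ, SolvesODE (laurentToHahn f) y → IsAlgebraicHS y) ↔
      ∃ P : Polynomial (Polynomial ℚ), P ≠ 0 ∧
        P.eval₂ Polynomial.coeToPowerSeries.ringHom (odeSol (regularPart f)) = 0 := by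
  rw [← exists_eval₂_ofPowerSeries_iff (Γ := ℚ)]
  constructor
  · intro h
    have h1 := exists_eval₂_mul (isAlgebraicHS_single (-f.coeff (-1)))
      (h _ (solvesODE_single_mul_odeSol hf))
    rwa [← mul_assoc, HahnSeries.single_mul_single, neg_add_cancel, one_mul,
      HahnSeries.single_zero_one, one_mul] at h1
  · intro h y hy
    rw [eq_C_mul_of_solvesODE hf hy]
    exact exists_eval₂_mul (isAlgebraicHS_C _) (exists_eval₂_mul (isAlgebraicHS_single _) h)

theorem exists_ne_zero_solvesODE (hf : ∀ n : ℤ, n < 0 → f.coeff (n - 1) = 0) :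
    ∃ y : HahnSeries ℚ ℚ, y ≠ 0 ∧ SolvesODE (laurentToHahn f) y := by
  refine ⟨_, mul_ne_zero (HahnSeries.single_ne_zero one_ne_zero) ?_,
    solvesODE_single_mul_odeSol hf⟩
  rw [map_ne_zero_iff _ HahnSeries.ofPowerSeries_injective]
  intro h
  have := constantCoeff_odeSol (regularPart f)
  rw [h, map_zero] at this
  exact zero_ne_one this

theorem exists_eval₂_regularPart (hf : ∀ n : ℤ, n < 0 → f.coeff (n - 1) = 0)
    (halg : IsAlgebraicLS f) :
    ∃ P : Polynomial (Polynomial ℚ), P ≠ 0 ∧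
      P.eval₂ Polynomial.coeToPowerSeries.ringHom (regularPart f) = 0 := by
  have hX : ∃ P : Polynomial (Polynomial ℚ), P ≠ 0 ∧
      P.eval₂ ((HahnSeries.ofPowerSeries ℤ ℚ).comp Polynomial.coeToPowerSeries.ringHom)
        (HahnSeries.single (1 : ℤ) 1) = 0 := by
    have h := exists_eval₂_map (ψ := (HahnSeries.ofPowerSeries ℤ ℚ).comp
      Polynomial.coeToPowerSeries.ringHom) Polynomial.X
    simpa using h
  have hC : ∃ P : Polynomial (Polynomial ℚ), P ≠ 0 ∧
      P.eval₂ ((HahnSeries.ofPowerSeries ℤ ℚ).comp Polynomial.coeToPowerSeries.ringHom)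
        (HahnSeries.C (-f.coeff (-1))) = 0 := by
    have h := exists_eval₂_map (ψ := (HahnSeries.ofPowerSeries ℤ ℚ).comp
      Polynomial.coeToPowerSeries.ringHom) (Polynomial.C (-f.coeff (-1)))
    rwa [RingHom.comp_apply, Polynomial.coeToPowerSeries.ringHom_apply, Polynomial.coe_C,
      HahnSeries.ofPowerSeries_C] at h
  have hs : HahnSeries.ofPowerSeries ℤ ℚ (regularPart f) =
      (HahnSeries.single (1 : ℤ) (1 : ℚ))⁻¹ * HahnSeries.C (-f.coeff (-1)) + f := by
    rw [HahnSeries.inv_single, HahnSeries.C_apply, HahnSeries.single_mul_single, add_zero,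
      inv_one, one_mul, HahnSeries.single_neg, eq_neg_add_iff_add_eq,
          ← eq_single_add_regularPart hf]
  rw [← exists_eval₂_ofPowerSeries_iff (Γ := ℤ), hs]
  exact exists_eval₂_add (exists_eval₂_mul (exists_eval₂_inv hX) hC) halg

end GeneralizedSolutions

theorem memNPZp_of_odeSol_algebraic {φ : ℚ⟦X⟧} (h : ∃ P : Polynomial (Polynomial ℚ), P ≠ 0 ∧
    P.eval₂ Polynomial.coeToPowerSeries.ringHom (odeSol φ) = 0) :
    ∃ B : ℕ, ∀ p : ℕ, p.Prime → B ≤ p → ∀ n : ℕ, 1 ≤ n →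
      MemNPZp n p (coeff (n * p - 1) φ - coeff (n - 1) φ) := by
  obtain ⟨P, hP, hP0⟩ := h
  obtain ⟨N, hN, hE⟩ := isEisenstein_of_eval₂_eq_zero hP hP0
  refine ⟨N + 1, fun p hp hB n hn => ?_⟩
  have : Fact p.Prime := ⟨hp⟩
  have hmem : odeSol φ ∈ locSeries p := by
    refine mem_locSeries.2 fun m => ?_
    obtain ⟨z, hz⟩ := (hE m).1
    refine mem_locSubring_of_mul_mem (q := N ^ (m + 1))
      (fun h => Nat.not_le.2 hB (Nat.le_of_dvd hN (hp.dvd_of_dvd_pow h))) ?_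
    rw [Nat.cast_pow, hz]
    exact intCast_mem_locSubring z
  obtain ⟨y, hy, hy1⟩ := exists_coeff_sub_eq_of_odeSol_mem hmem hn
  exact ⟨y, mem_locSubring_iff.1 hy, hy1⟩

theorem MemNPZp.memPZp {n p : ℕ} (hp : p.Prime) {x : ℚ} (h : MemNPZp n p x) : MemPZp p x := by
  have : Fact p.Prime := ⟨hp⟩
  obtain ⟨y, hy, rfl⟩ := h
  refine ⟨n * y, mem_locSubring_iff.1 (mul_mem (natCast_mem _ n) (mem_locSubring_iff.2 hy)), ?_⟩
  ring

/-- **Laurent series version of the main theorem.**  Let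
`f(t) = ∑_{n > b} a_n t^{n-1} ∈ ℚ((t))` be algebraic over `ℚ(t)`.  The following are
equivalent:
(a) every solution of `y' = f y` is algebraic over `ℚ(t)` (the solution space — taken among
    generalized series with rational exponents, where it is spanned by a single nonzero
    element — consists of algebraic elements);
(b) for all but finitely many primes `p`, `a_{np} - a_n ∈ p ℤ_(p)` for all `n ≥ 1`, and
    `a_n = 0` for all `n < 0` (the latter saying exactly `t·f(t) ∈ ℚ[[t]]`, which each of the
    conditions forces);
(c) for all but finitely many primes `p`, `a_{np} - a_n ∈ n p ℤ_(p)` for all `n ≥ 1`, and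
    `a_n = 0` for all `n < 0`. -/
theorem laurent_algebraic_solutions_tfae
    (f : LaurentSeries ℚ) (halg : IsAlgebraicLS f)
    (b : ℤ) (a : ℤ → ℚ)
    (ha : ∀ n : ℤ, a n = f.coeff (n - 1))
    (hb : ∀ n : ℤ, n ≤ b → a n = 0) :
    (((∃ y : HahnSeries ℚ ℚ, y ≠ 0 ∧ SolvesODE (laurentToHahn f) y) ∧
        ∀ y : HahnSeries ℚ ℚ, SolvesODE (laurentToHahn f) y → IsAlgebraicHS y) ↔
      ((∃ B : ℕ, ∀ p : ℕ, p.Prime → B ≤ p →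
          ∀ n : ℕ, 1 ≤ n → MemPZp p (a ((n : ℤ) * p) - a n)) ∧
        ∀ n : ℤ, n < 0 → a n = 0)) ∧
    (((∃ B : ℕ, ∀ p : ℕ, p.Prime → B ≤ p →
          ∀ n : ℕ, 1 ≤ n → MemPZp p (a ((n : ℤ) * p) - a n)) ∧
        ∀ n : ℤ, n < 0 → a n = 0) ↔
      ((∃ B : ℕ, ∀ p : ℕ, p.Prime → B ≤ p →
          ∀ n : ℕ, 1 ≤ n → MemNPZp n p (a ((n : ℤ) * p) - a n)) ∧
        ∀ n : ℤ, n < 0 → a n = 0)) := by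
  have hcoeff : ∀ p : ℕ, p.Prime → ∀ n : ℕ, 1 ≤ n → a ((n : ℤ) * p) - a n =
      coeff (n * p - 1) (regularPart f) - coeff (n - 1) (regularPart f) := by
    intro p hp n hn
    have h1 : 1 ≤ n * p := Nat.mul_pos hn hp.pos
    rw [ha, ha, coeff_regularPart, coeff_regularPart]
    push_cast [Nat.cast_sub h1, Nat.cast_sub hn]
    rfl
  have ha0 : (∀ n : ℤ, n < 0 → a n = 0) → ∀ n : ℤ, n < 0 → f.coeff (n - 1) = 0 :=
    fun h n hn => (ha n).symm.trans (h n hn)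
  have hac : ((∃ y : HahnSeries ℚ ℚ, y ≠ 0 ∧ SolvesODE (laurentToHahn f) y) ∧
        ∀ y : HahnSeries ℚ ℚ, SolvesODE (laurentToHahn f) y → IsAlgebraicHS y) →
      (∃ B : ℕ, ∀ p : ℕ, p.Prime → B ≤ p →
          ∀ n : ℕ, 1 ≤ n → MemNPZp n p (a ((n : ℤ) * p) - a n)) ∧
        ∀ n : ℤ, n < 0 → a n = 0 := by
    rintro ⟨⟨y, hy, hyS⟩, h⟩
    have hf : ∀ n : ℤ, n < 0 → f.coeff (n - 1) = 0 :=
      fun n hn => coeff_eq_zero_of_solvesODE hy hyS hn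
    obtain ⟨B, hB⟩ := memNPZp_of_odeSol_algebraic ((isAlgebraicHS_solutions_iff hf).1 h)
    refine ⟨⟨B, fun p hp hBp n hn => ?_⟩, fun n hn => (ha n).trans (hf n hn)⟩
    rw [hcoeff p hp n hn]
    exact hB p hp hBp n hn
  have hcb : ((∃ B : ℕ, ∀ p : ℕ, p.Prime → B ≤ p →
          ∀ n : ℕ, 1 ≤ n → MemNPZp n p (a ((n : ℤ) * p) - a n)) ∧
        ∀ n : ℤ, n < 0 → a n = 0) →
      (∃ B : ℕ, ∀ p : ℕ, p.Prime → B ≤ p →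
          ∀ n : ℕ, 1 ≤ n → MemPZp p (a ((n : ℤ) * p) - a n)) ∧
        ∀ n : ℤ, n < 0 → a n = 0 := by
    rintro ⟨⟨B, hB⟩, h0⟩
    exact ⟨⟨B, fun p hp hBp n hn => (hB p hp hBp n hn).memPZp hp⟩, h0⟩
  have hba : ((∃ B : ℕ, ∀ p : ℕ, p.Prime → B ≤ p →
          ∀ n : ℕ, 1 ≤ n → MemPZp p (a ((n : ℤ) * p) - a n)) ∧
        ∀ n : ℤ, n < 0 → a n = 0) →
      (∃ y : HahnSeries ℚ ℚ, y ≠ 0 ∧ SolvesODE (laurentToHahn f) y) ∧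
        ∀ y : HahnSeries ℚ ℚ, SolvesODE (laurentToHahn f) y → IsAlgebraicHS y := by
    rintro ⟨⟨B, hB⟩, h0⟩
    have hf := ha0 h0
    refine ⟨exists_ne_zero_solvesODE hf, (isAlgebraicHS_solutions_iff hf).2 ?_⟩
    refine exists_odeSol_eval₂_eq_zero (exists_eval₂_regularPart hf halg) (B := B) ?_
    intro p hp hBp n hn
    rw [← hcoeff p hp n hn]
    exact hB p hp hBp n hn
  exact ⟨⟨fun h => hcb (hac h), hba⟩, ⟨fun h => hac (hba h), hcb⟩⟩
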